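/- Let G ∈ C, let v be a vertex of G, and let B be a connected component of G ∖ N[v]. Then v is not a hub of the induced subgraph of G on B ∪ N(B) ∪ {v}. -/

import Mathlib

open Set

/-- `f` enumerates an induced path on `n` vertices in `G`. -/
def IsPathEmb {α : Type} (G : SimpleGraph α) (n : ℕ) (f : Fin n → α) : Prop :=
  Function.Injective f ∧
    ∀ i j : Fin n, G.Adj (f i) (f j) ↔ (i.val = j.val + 1 ∨ j.val = i.val + 1)

/-- `f` enumerates an induced path from `a` to `b`. -/
def IsPathFromTo {α : Type} (G : SimpleGraph α) (n : ℕ) (f : Fin n → α) (a b : α) : Prop :=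
  IsPathEmb G n f ∧ ∃ h : 1 ≤ n, f ⟨0, h⟩ = a ∧ f ⟨n - 1, by omega⟩ = b

/-- The interior (internal vertices) of the path enumerated by `f`. -/
def pathInterior {α : Type} (n : ℕ) (f : Fin n → α) : Set α :=
  {v | ∃ j : Fin n, 0 < j.val ∧ j.val < n - 1 ∧ f j = v}

/-- `k` pairwise internally vertex-disjoint induced paths from `a` to `b` in `G`. -/
def KDisjointPaths {α : Type} (G : SimpleGraph α) (k : ℕ) (a b : α) : Prop :=
  ∃ (n : Fin k → ℕ) (f : ∀ i, Fin (n i) → α),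
    (∀ i, IsPathFromTo G (n i) (f i) a b) ∧
    (∀ i j, i ≠ j → Disjoint (pathInterior (n i) (f i)) (pathInterior (n j) (f j)))

/-- `f` enumerates an induced cycle on `n` vertices. -/
def IsHoleEmb {α : Type} (G : SimpleGraph α) (n : ℕ) (f : ZMod n → α) : Prop :=
  Function.Injective f ∧ ∀ i j : ZMod n, G.Adj (f i) (f j) ↔ (i = j + 1 ∨ j = i + 1)

/-- `H` is the vertex set of a hole of `G` (an induced cycle with at least 4 vertices). -/
def IsHole {α : Type} (G : SimpleGraph α) (H : Set α) : Prop :=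
  ∃ (n : ℕ) (f : ZMod n → α), 4 ≤ n ∧ IsHoleEmb G n f ∧ Set.range f = H

/-- `G` has no even hole. -/
def EvenHoleFree {α : Type} (G : SimpleGraph α) : Prop :=
  ∀ H : Set α, IsHole G H → ¬ Even H.ncard

def Anticomplete {α : Type} (G : SimpleGraph α) (A B : Set α) : Prop :=
  ∀ a ∈ A, ∀ b ∈ B, ¬ G.Adj a b

/-- `X` is a stable (independent) set of `G`. -/
def StableSet {α : Type} (G : SimpleGraph α) (X : Set α) : Prop :=
  ∀ a ∈ X, ∀ b ∈ X, a ≠ b → ¬ G.Adj a b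

/-- The open neighborhood of the set `A`. -/
def setNbhd {α : Type} (G : SimpleGraph α) (A : Set α) : Set α :=
  {v | v ∉ A ∧ ∃ a ∈ A, G.Adj v a}

/-- The set `A` induces a connected (nonempty) subgraph of `G`. -/
def ConnSet {α : Type} (G : SimpleGraph α) (A : Set α) : Prop :=
  (G.induce A).Connected

/-- `D` is a connected component of the subgraph of `G` induced by `S`. -/
def IsCompOf {α : Type} (G : SimpleGraph α) (S D : Set α) : Prop :=
  D ⊆ S ∧ ConnSet G D ∧ ∀ D', D ⊆ D' → D' ⊆ S → ConnSet G D' → D' = D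

/-- `G` contains an (induced) theta. -/
def HasTheta {α : Type} (G : SimpleGraph α) : Prop :=
  ∃ (a b : α) (n : Fin 3 → ℕ) (f : ∀ i, Fin (n i) → α),
    a ≠ b ∧ ¬ G.Adj a b ∧ (∀ i, 3 ≤ n i) ∧
    (∀ i, IsPathFromTo G (n i) (f i) a b) ∧
    (∀ i j : Fin 3, i ≠ j → ∀ (u : Fin (n i)) (v : Fin (n j)),
      0 < u.val → u.val < n i - 1 → 0 < v.val → v.val < n j - 1 →
      f i u ≠ f j v ∧ ¬ G.Adj (f i u) (f j v))

/-- `G` contains an (induced) prism. -/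
def HasPrism {α : Type} (G : SimpleGraph α) : Prop :=
  ∃ (n : Fin 3 → ℕ) (f : ∀ i, Fin (n i) → α),
    (∀ i, 2 ≤ n i) ∧ (∀ i, IsPathEmb G (n i) (f i)) ∧
    (∀ i j : Fin 3, i ≠ j → ∀ u v, f i u ≠ f j v) ∧
    (∀ i j : Fin 3, i ≠ j → ∀ (u : Fin (n i)) (v : Fin (n j)),
      G.Adj (f i u) (f j v) ↔
        ((u.val = 0 ∧ v.val = 0) ∨ (u.val = n i - 1 ∧ v.val = n j - 1)))

/-- The neighbors of `x` in the hole `H`. -/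
def holeNbrs {α : Type} (G : SimpleGraph α) (H : Set α) (x : α) : Set α :=
  {v ∈ H | G.Adj x v}

def IsWheel {α : Type} (G : SimpleGraph α) (H : Set α) (x : α) : Prop :=
  IsHole G H ∧ x ∉ H ∧ 3 ≤ (holeNbrs G H x).ncard

def IsTwinWheel {α : Type} (G : SimpleGraph α) (H : Set α) (x : α) : Prop :=
  IsWheel G H x ∧ ∃ p q r : α, p ≠ q ∧ q ≠ r ∧ p ≠ r ∧
    holeNbrs G H x = {p, q, r} ∧ G.Adj p q ∧ G.Adj q r ∧ ¬ G.Adj p r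

def IsShortPyramid {α : Type} (G : SimpleGraph α) (H : Set α) (x : α) : Prop :=
  IsWheel G H x ∧ ∃ p q r : α, p ≠ q ∧ q ≠ r ∧ p ≠ r ∧
    holeNbrs G H x = {p, q, r} ∧ G.Adj p q ∧ ¬ G.Adj q r ∧ ¬ G.Adj p r

def IsProperWheel {α : Type} (G : SimpleGraph α) (H : Set α) (x : α) : Prop :=
  IsWheel G H x ∧ ¬ IsTwinWheel G H x ∧ ¬ IsShortPyramid G H x

/-- `x` is a hub of the induced subgraph `G[W]`. -/
def IsHubIn {α : Type} (G : SimpleGraph α) (W : Set α) (x : α) : Prop :=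
  x ∈ W ∧ ∃ H : Set α, H ⊆ W ∧ IsProperWheel G H x

/-- `x` is a hub of `G`: the center of some proper wheel. -/
def IsHub {α : Type} (G : SimpleGraph α) (x : α) : Prop :=
  ∃ H : Set α, IsProperWheel G H x

/-- membership in the class `𝒞` of (C₄, theta, prism, even wheel)-free graphs. -/
def MemC {α : Type} (G : SimpleGraph α) : Prop :=
  (∀ H : Set α, IsHole G H → H.ncard ≠ 4) ∧ ¬ HasTheta G ∧ ¬ HasPrism G ∧
    (∀ (H : Set α) (x : α), IsWheel G H x → ¬ Even (holeNbrs G H x).ncard)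

/-- membership in the class `𝒞ₜ`: graphs in `𝒞` with no clique of size `t`. -/
def MemCt {α : Type} (t : ℕ) (G : SimpleGraph α) : Prop :=
  MemC G ∧ G.CliqueFree t

/-- `G` contains a generalized `k`-pyramid as an induced subgraph. -/
def ContainsGenPyramid {α : Type} (G : SimpleGraph α) (k : ℕ) : Prop :=
  ∃ (nP nQ : ℕ) (P : Fin nP → α) (Q : Fin nQ → α)
    (m : Fin k → ℕ) (R : ∀ i, Fin (m i) → α) (xI zI : Fin k → ℕ),
    4 ≤ nP + nQ ∧ 1 ≤ nP ∧ 1 ≤ nQ ∧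
    IsPathEmb G nP P ∧ IsPathEmb G nQ Q ∧
    (∀ i j, P i ≠ Q j) ∧
    (∀ (i : Fin nP) (j : Fin nQ), G.Adj (P i) (Q j) ↔
      ((i.val = 0 ∧ j.val = 0) ∨ (i.val = nP - 1 ∧ j.val = nQ - 1))) ∧
    (∀ i, 1 ≤ m i) ∧ (∀ i, IsPathEmb G (m i) (R i)) ∧
    (∀ i u j, R i u ≠ P j) ∧ (∀ i u j, R i u ≠ Q j) ∧
    (∀ i i', i ≠ i' → ∀ u u', R i u ≠ R i' u' ∧ ¬ G.Adj (R i u) (R i' u')) ∧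
    (∀ i, 0 < xI i ∧ xI i + 1 < nP - 1) ∧
    (∀ (i : Fin k) (u : Fin (m i)) (j : Fin nP), G.Adj (R i u) (P j) ↔
      (u.val = 0 ∧ (j.val = xI i ∨ j.val = xI i + 1))) ∧
    (∀ i, zI i < nQ) ∧
    (∀ (i : Fin k) (u : Fin (m i)) (j : Fin nQ), G.Adj (R i u) (Q j) ↔
      (u.val = m i - 1 ∧ j.val = zI i)) ∧
    (∀ i i' : Fin k, i < i' → xI i + 1 < xI i') ∧
    (∀ i i' : Fin k, i ≤ i' → zI i ≤ zI i')

/-- membership in the class `𝒞ₜₜ`: graphs in `𝒞ₜ` with no induced generalized `t`-pyramid. -/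
def MemCtt {α : Type} (t : ℕ) (G : SimpleGraph α) : Prop :=
  MemCt t G ∧ ¬ ContainsGenPyramid G t

/-- `(T, χ)` is a tree decomposition of `G`. -/
structure IsTD {α ι : Type} (G : SimpleGraph α) (T : SimpleGraph ι) (χ : ι → Set α) : Prop where
  finite : Finite ι
  isTree : T.IsTree
  memBag : ∀ v : α, ∃ t, v ∈ χ t
  edgeBag : ∀ ⦃u v : α⦄, G.Adj u v → ∃ t, u ∈ χ t ∧ v ∈ χ t
  subtree : ∀ v : α, (T.induce {t | v ∈ χ t}).Connected

/-- `G` has a tree decomposition of width at most `w`. -/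
def TwLE {α : Type} (G : SimpleGraph α) (w : ℕ) : Prop :=
  ∃ (ι : Type) (T : SimpleGraph ι) (χ : ι → Set α),
    IsTD G T χ ∧ ∀ t, (χ t).ncard ≤ w + 1

/-- The treewidth of `G`. -/
noncomputable def treeWidth {α : Type} (G : SimpleGraph α) : ℕ :=
  sInf {w | TwLE G w}

/-- For adjacent `t, t'` in a tree `T`, the vertex set of the component of `T - t`
containing `t'`. -/
def branchSet {ι : Type} (T : SimpleGraph ι) (t t' : ι) : Set ι :=
  {s | ∀ w : T.Walk s t, t' ∈ w.support}

/-- The vertex set of `G_{t → t'}`: the union of the bags over the component of `T - t`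
containing `t'`. -/
def sideSet {α ι : Type} (T : SimpleGraph ι) (χ : ι → Set α) (t t' : ι) : Set α :=
  ⋃ s ∈ branchSet T t t', χ s

/-- `(T, χ)` is a tight tree decomposition of `G`. -/
def TightTD {α ι : Type} (G : SimpleGraph α) (T : SimpleGraph ι) (χ : ι → Set α) : Prop :=
  IsTD G T χ ∧ ∀ ⦃t t' : ι⦄, T.Adj t t' →
    ∃ D, IsCompOf G (sideSet T χ t t' \ χ t) D ∧ setNbhd G D = χ t ∩ χ t'

/-- `G` admits a clique cutset. -/
def HasCliqueCutset {α : Type} (G : SimpleGraph α) : Prop :=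
  ∃ C : Set α, G.IsClique C ∧ ¬ (G.induce (Set.univ \ C)).Preconnected

/-- `G` is chordal: it has no hole. -/
def ChordalG {α : Type} (G : SimpleGraph α) : Prop := ∀ H : Set α, ¬ IsHole G H

/-- `G'` is a minimal chordal completion of `G`. -/
def IsMinChordalCompletion {α : Type} (G G' : SimpleGraph α) : Prop :=
  G ≤ G' ∧ ChordalG G' ∧ ∀ G'', G ≤ G'' → G'' ≤ G' → ChordalG G'' → G'' = G'

/-- `Ω` is a potential maximal clique of `G` : a maximal clique of some minimal chordal
completion of `G`. -/
def IsPMC {α : Type} (G : SimpleGraph α) (Ω : Set α) : Prop :=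
  ∃ G' : SimpleGraph α, IsMinChordalCompletion G G' ∧ G'.IsClique Ω ∧
    ∀ Ω' : Set α, G'.IsClique Ω' → Ω ⊆ Ω' → Ω' = Ω

/-- `(T, χ)` is a structured tree decomposition: every bag is a PMC of `G`. -/
def StructuredTD {α ι : Type} (G : SimpleGraph α) (T : SimpleGraph ι) (χ : ι → Set α) : Prop :=
  IsTD G T χ ∧ ∀ t, IsPMC G (χ t)

/-- the decomposition has adhesion less than `m`. -/
def AdhLT {α ι : Type} (T : SimpleGraph ι) (χ : ι → Set α) (m : ℕ) : Prop :=
  ∀ ⦃t t' : ι⦄, T.Adj t t' → (χ t ∩ χ t').ncard < m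

/-- `fatness χ i` is the number of bags of size `i`. -/
noncomputable def fatness {α ι : Type} (χ : ι → Set α) (i : ℕ) : ℕ :=
  {t : ι | (χ t).ncard = i}.ncard

/-- Lexicographic comparison of fatness vectors `(aₙ, …, a₀)` (larger sizes more
significant). -/
def FatLexLE (f g : ℕ → ℕ) : Prop :=
  (∀ i, f i = g i) ∨ ∃ j, f j < g j ∧ ∀ i, j < i → f i = g i

/-- `(T, χ)` is an `m`-atomic tree decomposition of `G`: its adhesion is less than `m` and its
fatness is lexicographically minimum among all tree decompositions with adhesion less than `m`. -/
def IsAtomicTD {α ι : Type} (m : ℕ) (G : SimpleGraph α) (T : SimpleGraph ι)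
    (χ : ι → Set α) : Prop :=
  IsTD G T χ ∧ AdhLT T χ m ∧
    ∀ (ι' : Type) (T' : SimpleGraph ι') (χ' : ι' → Set α),
      IsTD G T' χ' → AdhLT T' χ' m → FatLexLE (fatness χ) (fatness χ')

/-- Adjacency in the torso at the node `x` of the tree decomposition. -/
def torsoAdj {α ι : Type} (G : SimpleGraph α) (T : SimpleGraph ι) (χ : ι → Set α)
    (x : ι) (u v : α) : Prop :=
  u ∈ χ x ∧ v ∈ χ x ∧ u ≠ v ∧
    (G.Adj u v ∨ ∃ y, T.Adj x y ∧ u ∈ χ y ∧ v ∈ χ y)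

/-- The degree of `u` in the torso at `x`. -/
noncomputable def torsoDeg {α ι : Type} (G : SimpleGraph α) (T : SimpleGraph ι)
    (χ : ι → Set α) (x : ι) (u : α) : ℕ :=
  {v | torsoAdj G T χ x u v}.ncard

/-- `u` and `v` lie in the same component of `G[S]`. -/
def SameComp {α : Type} (G : SimpleGraph α) (S : Set α) (u v : α) : Prop :=
  ∃ (hu : u ∈ S) (hv : v ∈ S), (G.induce S).Reachable ⟨u, hu⟩ ⟨v, hv⟩

/-- `X` is a minimal separator of `G`. -/
def IsMinimalSeparator {α : Type} (G : SimpleGraph α) (X : Set α) : Prop :=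
  ∃ u v : α, u ∉ X ∧ v ∉ X ∧ ¬ SameComp G (Set.univ \ X) u v ∧
    ∀ Y : Set α, Y ⊂ X → SameComp G (Set.univ \ Y) u v
/-- The degree of `v` in `H` (as the cardinality of its neighbor set). -/
noncomputable def degreeSet {α : Type} (H : SimpleGraph α) (v : α) : ℕ :=
  (H.neighborSet v).ncard

/-- `H` is a path (as a graph). -/
def IsPathGraph {α : Type} (H : SimpleGraph α) : Prop :=
  ∃ (n : ℕ) (f : Fin n → α), Function.Bijective f ∧
    ∀ i j, H.Adj (f i) (f j) ↔ (i.val = j.val + 1 ∨ j.val = i.val + 1)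

/-- `H` is a caterpillar: a tree of maximum degree three having a path containing all
branch vertices. -/
def IsCaterpillar {α : Type} (H : SimpleGraph α) : Prop :=
  H.IsTree ∧ (∀ v, degreeSet H v ≤ 3) ∧
    ∃ (n : ℕ) (f : Fin n → α), IsPathEmb H n f ∧
      ∀ v, 2 < degreeSet H v → v ∈ Set.range f

/-- `H` is a subdivided star: a tree with exactly one branch vertex (its root), of degree
at least 3. -/
def IsSubdividedStar {α : Type} (H : SimpleGraph α) : Prop :=
  H.IsTree ∧ ∃! r, 2 < degreeSet H r

/-- `H` is (isomorphic to) the line graph of a caterpillar. -/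
def IsLineGraphOfCaterpillar {α : Type} (H : SimpleGraph α) : Prop :=
  ∃ (β : Type) (C : SimpleGraph β), IsCaterpillar C ∧
    Nonempty (SimpleGraph.Iso H C.lineGraph)

/-- `w` is a simplicial vertex of the induced subgraph `G[W]`. -/
def SimplicialIn {α : Type} (G : SimpleGraph α) (W : Set α) (w : α) : Prop :=
  w ∈ W ∧ G.IsClique {u | u ∈ W ∧ G.Adj w u}

/-- `(p, x)` is an alignment: `p` enumerates an induced path, `x` enumerates the set `X`
in the order given by the alignment. -/
structure IsAlignment {α : Type} (G : SimpleGraph α) (n : ℕ) (p : Fin n → α)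
    (k : ℕ) (x : Fin k → α) : Prop where
  hn : 1 ≤ n
  hk : 2 ≤ k
  path : IsPathEmb G n p
  injx : Function.Injective x
  disj : ∀ i j, x i ≠ p j
  cover : ∀ i, ∃ j, G.Adj (x i) (p j)
  first : ∀ j : Fin n, G.Adj (x ⟨0, by omega⟩) (p j) ↔ j.val = 0
  last : ∀ j : Fin n, G.Adj (x ⟨k - 1, by omega⟩) (p j) ↔ j.val = n - 1
  ordered : ∀ (i i' : Fin k) (j j' : Fin n),
    i < i' → G.Adj (x i) (p j) → G.Adj (x i') (p j') → j < j'

/-- A wide alignment: every middle vertex of `X` has two non-adjacent neighbors in `P`. -/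
def IsWideAlignment {α : Type} (G : SimpleGraph α) (n : ℕ) (p : Fin n → α)
    (k : ℕ) (x : Fin k → α) : Prop :=
  IsAlignment G n p k x ∧ ∀ i : Fin k, 0 < i.val → i.val < k - 1 →
    ∃ j j' : Fin n, j.val + 1 < j'.val ∧ G.Adj (x i) (p j) ∧ G.Adj (x i) (p j')

/-- A spiky alignment: every middle vertex of `X` has a unique neighbor in `P`. -/
def IsSpikyAlignment {α : Type} (G : SimpleGraph α) (n : ℕ) (p : Fin n → α)
    (k : ℕ) (x : Fin k → α) : Prop :=
  IsAlignment G n p k x ∧ ∀ i : Fin k, 0 < i.val → i.val < k - 1 →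
    ∃! j : Fin n, G.Adj (x i) (p j)

/-- A triangular alignment: every middle vertex of `X` has exactly two neighbors in `P`,
and they are adjacent. -/
def IsTriangularAlignment {α : Type} (G : SimpleGraph α) (n : ℕ) (p : Fin n → α)
    (k : ℕ) (x : Fin k → α) : Prop :=
  IsAlignment G n p k x ∧ ∀ i : Fin k, 0 < i.val → i.val < k - 1 →
    ∃ j : Fin n, j.val + 1 < n ∧
      ∀ j' : Fin n, G.Adj (x i) (p j') ↔ (j'.val = j.val ∨ j'.val = j.val + 1)

/-- `(H, x)` is a spiky connectifier: `H` is an induced caterpillar with spine `p` and legs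
`ℓ`, and `x` enumerates `X` in the order given by the connectifier (`x 0` and `x (k-1)`
attached at the ends of the spine, the others to the tips of the legs, in the order in which
the legs attach along the spine). -/
def IsSpikyConnectifier {α : Type} (G : SimpleGraph α) (H : Set α)
    (k : ℕ) (x : Fin k → α) : Prop :=
  ∃ (hk : 2 ≤ k) (n : ℕ) (_ : 2 ≤ n) (p : Fin n → α)
    (m : Fin (k - 2) → ℕ) (ℓ : ∀ i, Fin (m i) → α) (a : Fin (k - 2) → ℕ),
    IsPathEmb G n p ∧ (∀ i, 1 ≤ m i) ∧ (∀ i, IsPathEmb G (m i) (ℓ i)) ∧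
    H = Set.range p ∪ ⋃ i, Set.range (ℓ i) ∧
    Function.Injective x ∧ (∀ i, x i ∉ H) ∧
    (∀ i j j', ℓ i j ≠ p j') ∧
    (∀ i i', i ≠ i' → ∀ j j', ℓ i j ≠ ℓ i' j' ∧ ¬ G.Adj (ℓ i j) (ℓ i' j')) ∧
    (∀ i, 0 < a i ∧ a i < n - 1) ∧
    (∀ i i', i < i' → a i < a i') ∧
    (∀ (i : Fin (k - 2)) (j : Fin (m i)) (j' : Fin n),
      G.Adj (ℓ i j) (p j') ↔ (j.val = 0 ∧ j'.val = a i)) ∧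
    (∀ j : Fin n, G.Adj (x ⟨0, by omega⟩) (p j) ↔ j.val = 0) ∧
    (∀ (i : Fin (k - 2)) (j : Fin (m i)), ¬ G.Adj (x ⟨0, by omega⟩) (ℓ i j)) ∧
    (∀ j : Fin n, G.Adj (x ⟨k - 1, by omega⟩) (p j) ↔ j.val = n - 1) ∧
    (∀ (i : Fin (k - 2)) (j : Fin (m i)), ¬ G.Adj (x ⟨k - 1, by omega⟩) (ℓ i j)) ∧
    (∀ (i : Fin (k - 2)) (j : Fin n),
      ¬ G.Adj (x ⟨i.val + 1, by have := i.isLt; omega⟩) (p j)) ∧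
    (∀ (i i' : Fin (k - 2)) (j : Fin (m i')),
      G.Adj (x ⟨i.val + 1, by have := i.isLt; omega⟩) (ℓ i' j) ↔ (i' = i ∧ j.val = m i' - 1))

/-- `(H, x)` is a triangular connectifier: `H` is the line graph of a caterpillar, with
spine `p` and legs `ℓ` attached along triangles, and `x` enumerates `X` in the order given
by the connectifier. -/
def IsTriangularConnectifier {α : Type} (G : SimpleGraph α) (H : Set α)
    (k : ℕ) (x : Fin k → α) : Prop :=
  ∃ (hk : 2 ≤ k) (n : ℕ) (_ : 2 ≤ n) (p : Fin n → α)
    (m : Fin (k - 2) → ℕ) (ℓ : ∀ i, Fin (m i) → α) (a : Fin (k - 2) → ℕ),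
    IsPathEmb G n p ∧ (∀ i, 1 ≤ m i) ∧ (∀ i, IsPathEmb G (m i) (ℓ i)) ∧
    H = Set.range p ∪ ⋃ i, Set.range (ℓ i) ∧
    Function.Injective x ∧ (∀ i, x i ∉ H) ∧
    (∀ i j j', ℓ i j ≠ p j') ∧
    (∀ i i', i ≠ i' → ∀ j j', ℓ i j ≠ ℓ i' j' ∧ ¬ G.Adj (ℓ i j) (ℓ i' j')) ∧
    (∀ i, a i + 1 ≤ n - 1) ∧
    (∀ i i', i < i' → a i < a i') ∧
    (∀ (i : Fin (k - 2)) (j : Fin (m i)) (j' : Fin n),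
      G.Adj (ℓ i j) (p j') ↔ (j.val = 0 ∧ (j'.val = a i ∨ j'.val = a i + 1))) ∧
    (∀ j : Fin n, G.Adj (x ⟨0, by omega⟩) (p j) ↔ j.val = 0) ∧
    (∀ (i : Fin (k - 2)) (j : Fin (m i)), ¬ G.Adj (x ⟨0, by omega⟩) (ℓ i j)) ∧
    (∀ j : Fin n, G.Adj (x ⟨k - 1, by omega⟩) (p j) ↔ j.val = n - 1) ∧
    (∀ (i : Fin (k - 2)) (j : Fin (m i)), ¬ G.Adj (x ⟨k - 1, by omega⟩) (ℓ i j)) ∧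
    (∀ (i : Fin (k - 2)) (j : Fin n),
      ¬ G.Adj (x ⟨i.val + 1, by have := i.isLt; omega⟩) (p j)) ∧
    (∀ (i i' : Fin (k - 2)) (j : Fin (m i')),
      G.Adj (x ⟨i.val + 1, by have := i.isLt; omega⟩) (ℓ i' j) ↔ (i' = i ∧ j.val = m i' - 1))

/-- `(H, x)` is a stellar connectifier: `H` is an induced subdivided star with root `r` and
legs `ℓ`, and the vertices of `X` are attached to the tips of the legs. -/
def IsStellarConnectifier {α : Type} (G : SimpleGraph α) (H : Set α)
    (k : ℕ) (x : Fin k → α) : Prop :=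
  ∃ (_ : 3 ≤ k) (r : α) (m : Fin k → ℕ) (ℓ : ∀ i, Fin (m i) → α),
    (∀ i, 1 ≤ m i) ∧ (∀ i, IsPathEmb G (m i) (ℓ i)) ∧
    H = {r} ∪ ⋃ i, Set.range (ℓ i) ∧
    Function.Injective x ∧ (∀ i, x i ∉ H) ∧
    (∀ i j, ℓ i j ≠ r) ∧
    (∀ i i', i ≠ i' → ∀ j j', ℓ i j ≠ ℓ i' j' ∧ ¬ G.Adj (ℓ i j) (ℓ i' j')) ∧
    (∀ (i : Fin k) (j : Fin (m i)), G.Adj r (ℓ i j) ↔ j.val = 0) ∧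
    (∀ i, ¬ G.Adj (x i) r) ∧
    (∀ (i i' : Fin k) (j : Fin (m i')),
      G.Adj (x i) (ℓ i' j) ↔ (i' = i ∧ j.val = m i' - 1))

/-- `(H, X)` is a wide alignment (set version). -/
def IsWideAlignSet {α : Type} (G : SimpleGraph α) (H X : Set α) : Prop :=
  ∃ (n k : ℕ) (p : Fin n → α) (e : Fin k → α),
    H = Set.range p ∧ X = Set.range e ∧ IsWideAlignment G n p k e

/-- `(H, X)` is a spiky alignment (set version). -/
def IsSpikyAlignSet {α : Type} (G : SimpleGraph α) (H X : Set α) : Prop :=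
  ∃ (n k : ℕ) (p : Fin n → α) (e : Fin k → α),
    H = Set.range p ∧ X = Set.range e ∧ IsSpikyAlignment G n p k e

/-- `(H, X)` is a triangular alignment (set version). -/
def IsTriAlignSet {α : Type} (G : SimpleGraph α) (H X : Set α) : Prop :=
  ∃ (n k : ℕ) (p : Fin n → α) (e : Fin k → α),
    H = Set.range p ∧ X = Set.range e ∧ IsTriangularAlignment G n p k e

/-- `(H, X)` is a spiky connectifier (set version). -/
def IsSpikyConnSet {α : Type} (G : SimpleGraph α) (H X : Set α) : Prop :=
  ∃ (k : ℕ) (e : Fin k → α), X = Set.range e ∧ IsSpikyConnectifier G H k e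

/-- `(H, X)` is a triangular connectifier (set version). -/
def IsTriConnSet {α : Type} (G : SimpleGraph α) (H X : Set α) : Prop :=
  ∃ (k : ℕ) (e : Fin k → α), X = Set.range e ∧ IsTriangularConnectifier G H k e

/-- `(H, X)` is a stellar connectifier (set version). -/
def IsStellarConnSet {α : Type} (G : SimpleGraph α) (H X : Set α) : Prop :=
  ∃ (k : ℕ) (e : Fin k → α), X = Set.range e ∧ IsStellarConnectifier G H k e

/-- `(H, X)` (with order `e` on `X`) is a consistent alignment or consistent connectifier. -/
def IsConsistentWith {α : Type} (G : SimpleGraph α) (H : Set α)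
    (k : ℕ) (e : Fin k → α) : Prop :=
  (∃ (n : ℕ) (p : Fin n → α), H = Set.range p ∧
    (IsWideAlignment G n p k e ∨ IsSpikyAlignment G n p k e ∨ IsTriangularAlignment G n p k e)) ∨
  IsSpikyConnectifier G H k e ∨ IsTriangularConnectifier G H k e ∨
    IsStellarConnectifier G H k e

section

variable {V : Type} {G : SimpleGraph V}

/-- The sets `A` and `B` are disjoint and anticomplete. -/
def Far (G : SimpleGraph V) (A B : Set V) : Prop :=
  ∀ a ∈ A, ∀ b ∈ B, a ≠ b ∧ ¬ G.Adj a b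

/-- `p` restricted to `{0, …, k}` is an induced path. -/
def PathOn (G : SimpleGraph V) (p : ℕ → V) (k : ℕ) : Prop :=
  ∀ i j, i < j → j ≤ k → p i ≠ p j ∧ (G.Adj (p i) (p j) ↔ j = i + 1)

/-- `X` is the vertex set of an induced path from `a` to `b`. -/
def IPath (G : SimpleGraph V) (X : Set V) (a b : V) : Prop :=
  ∃ (k : ℕ) (p : ℕ → V), PathOn G p k ∧ p 0 = a ∧ p k = b ∧ X = p '' Iic k

theorem Far.symm {A B : Set V} (h : Far G A B) : Far G B A :=
  fun a ha b hb => ⟨(h b hb a ha).1.symm, fun e => (h b hb a ha).2 e.symm⟩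

theorem connSet_singleton (a : V) : ConnSet G {a} := by
  unfold ConnSet
  have : Nonempty ({a} : Set V) := ⟨⟨a, rfl⟩⟩
  have : Subsingleton ({a} : Set V) := ⟨fun x y => Subtype.ext (x.2.trans y.2.symm)⟩
  exact ⟨fun x y => by rw [Subsingleton.elim x y]⟩

protected theorem ConnSet.union {s t : Set V} (hs : ConnSet G s) (ht : ConnSet G t) {a b : V} (ha : a ∈ s)
    (hb : b ∈ t) (hab : a = b ∨ G.Adj a b) : ConnSet G (s ∪ t) := by
  rcases hab with rfl | hab
  · exact SimpleGraph.induce_union_connected hs.1 ht.1 ⟨a, ha, hb⟩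
  · exact SimpleGraph.connected_induce_union hs.1 ht.1 ha hb hab

protected theorem ConnSet.insert {t : Set V} (ht : ConnSet G t) {a b : V}
    (hb : b ∈ t) (hab : G.Adj a b) : ConnSet G (insert a t) := by
  have := (connSet_singleton (G := G) a).union ht rfl hb (Or.inr hab)
  rwa [singleton_union] at this

theorem PathOn.connSet {p : ℕ → V} {k : ℕ} (h : ∀ i < k, G.Adj (p i) (p (i + 1))) :
    ConnSet G (p '' Iic k) := by
  induction k with
  | zero =>
    have : p '' Iic 0 = {p 0} := by ext; simp [eq_comm]
    rw [this]; exact connSet_singleton _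
  | succ k ih =>
    have e : p '' Iic (k + 1) = p '' Iic k ∪ {p (k + 1)} := by
      ext v
      simp only [mem_image, mem_Iic, mem_union, mem_singleton_iff]
      constructor
      · rintro ⟨i, hi, rfl⟩
        rcases Nat.lt_or_ge k i with h1 | h1
        · right; congr 1; omega
        · exact Or.inl ⟨i, h1, rfl⟩
      · rintro (⟨i, hi, rfl⟩ | rfl)
        · exact ⟨i, by omega, rfl⟩
        · exact ⟨k + 1, le_rfl, rfl⟩
    rw [e]
    exact (ih fun i hi => h i (by omega)).union (connSet_singleton _) ⟨k, by simp, rfl⟩ rfl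
      (Or.inr (h k (by omega)))

theorem PathOn.shift {p : ℕ → V} {k : ℕ} (h : PathOn G p k) {i j : ℕ} (hj : i + j ≤ k) :
    PathOn G (fun t => p (i + t)) j := by
  intro a b hab hb
  have := h (i + a) (i + b) (by omega) (by omega)
  refine ⟨this.1, this.2.trans (by omega)⟩

theorem PathOn.reverse {p : ℕ → V} {k : ℕ} (h : PathOn G p k) : PathOn G (fun t => p (k - t)) k := by
  intro a b hab hb
  have := h (k - b) (k - a) (by omega) (by omega)
  refine ⟨this.1.symm, ?_⟩
  rw [G.adj_comm, this.2]; omega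

theorem IPath.single (a : V) : IPath G {a} a a :=
  ⟨0, fun _ => a, fun i j hij hj => by omega, rfl, rfl, by ext; simp [eq_comm]⟩

theorem IPath.left_mem {X : Set V} {a b : V} (h : IPath G X a b) : a ∈ X := by
  obtain ⟨k, p, _, rfl, _, rfl⟩ := h; exact ⟨0, by simp, rfl⟩

theorem IPath.right_mem {X : Set V} {a b : V} (h : IPath G X a b) : b ∈ X := by
  obtain ⟨k, p, _, _, rfl, rfl⟩ := h; exact ⟨k, by simp, rfl⟩

theorem IPath.connSet {X : Set V} {a b : V} (h : IPath G X a b) : ConnSet G X := by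
  obtain ⟨k, p, hp, _, _, rfl⟩ := h
  exact PathOn.connSet fun i hi => (hp i (i + 1) (by omega) (by omega)).2.2 rfl

theorem IPath.symm {X : Set V} {a b : V} (h : IPath G X a b) : IPath G X b a := by
  obtain ⟨k, p, hp, ha, hb, rfl⟩ := h
  refine ⟨k, _, hp.reverse, by simpa using hb, by simpa using ha, ?_⟩
  ext v
  simp only [mem_image, mem_Iic]
  constructor
  · rintro ⟨i, hi, rfl⟩; exact ⟨k - i, by omega, by congr 1; omega⟩
  · rintro ⟨i, hi, rfl⟩; exact ⟨k - i, by omega, rfl⟩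

theorem IPath.glue {X Y : Set V} {a b c d : V} (h₁ : IPath G X a b) (h₂ : IPath G Y c d)
    (hbc : G.Adj b c) (hne : ∀ u ∈ X, ∀ w ∈ Y, u ≠ w ∧ (G.Adj u w → u = b ∧ w = c)) :
    IPath G (X ∪ Y) a d := by
  obtain ⟨k, p, hp, rfl, rfl, rfl⟩ := h₁
  obtain ⟨l, q, hq, rfl, rfl, rfl⟩ := h₂
  have hpinj : ∀ i ≤ k, p i = p k → i = k := fun i hi e => by
    by_contra hne; exact (hp i k (by omega) le_rfl).1 e
  have hqinj : ∀ i ≤ l, q i = q 0 → i = 0 := fun i hi e => by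
    by_contra hne; exact (hq 0 i (by omega) hi).1 e.symm
  refine ⟨k + l + 1, fun t => if t ≤ k then p t else q (t - k - 1), ?_, by simp, ?_, ?_⟩
  · intro i j hij hj
    by_cases h1 : j ≤ k
    · simp only [h1, show i ≤ k by omega, if_true]; exact hp i j hij h1
    · by_cases h2 : i ≤ k
      · simp only [h1, h2, if_true, if_false]
        have := hne (p i) ⟨i, h2, rfl⟩ (q (j - k - 1)) ⟨j - k - 1, by simp; omega, rfl⟩
        refine ⟨this.1, fun h => ?_, fun h => ?_⟩
        · obtain ⟨e1, e2⟩ := this.2 h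
          have := hpinj i h2 e1; have := hqinj _ (by omega) e2; omega
        · have e1 : i = k := by omega
          have e2 : j - k - 1 = 0 := by omega
          rw [e1, e2]; exact hbc
      · simp only [h1, h2, if_false]
        have := hq (i - k - 1) (j - k - 1) (by omega) (by omega)
        exact ⟨this.1, this.2.trans (by omega)⟩
  · simp only [show ¬ (k + l + 1 ≤ k) by omega, if_false]; congr 1; omega
  · ext v
    simp only [mem_union, mem_image, mem_Iic]
    constructor
    · rintro (⟨i, hi, rfl⟩ | ⟨i, hi, rfl⟩)
      · exact ⟨i, by omega, by simp [hi]⟩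
      · exact ⟨k + 1 + i, by omega, by simp [show ¬ (k + 1 + i ≤ k) by omega]; congr 1; omega⟩
    · rintro ⟨i, hi, rfl⟩
      by_cases h : i ≤ k
      · exact Or.inl ⟨i, h, by simp [h]⟩
      · exact Or.inr ⟨i - k - 1, by omega, by simp [h]⟩

theorem PathOn.iPath {p : ℕ → V} {k : ℕ} (h : PathOn G p k) {i j : ℕ} (hij : i ≤ j) (hj : j ≤ k) :
    IPath G (p '' Icc i j) (p i) (p j) := by
  refine ⟨j - i, fun t => p (i + t), h.shift (by omega), rfl, by dsimp only; congr 1; omega, ?_⟩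
  ext v
  simp only [mem_image, mem_Iic, mem_Icc]
  constructor
  · rintro ⟨t, ht, rfl⟩; exact ⟨t - i, by omega, by congr 1; omega⟩
  · rintro ⟨t, ht, rfl⟩; exact ⟨i + t, by omega, rfl⟩

theorem IPath.of_int {h : ℤ → V} {i j : ℤ} (hij : i ≤ j)
    (H : ∀ a b, i ≤ a → a < b → b ≤ j → h a ≠ h b ∧ (G.Adj (h a) (h b) ↔ b = a + 1)) :
    IPath G (h '' Icc i j) (h i) (h j) := by
  refine ⟨(j - i).toNat, fun t => h (i + t), ?_, by simp, by dsimp only; congr 1; omega, ?_⟩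
  · intro a b hab hb
    have := H (i + a) (i + b) (by omega) (by omega) (by omega)
    exact ⟨this.1, this.2.trans (by omega)⟩
  · ext v
    simp only [mem_image, mem_Iic, mem_Icc]
    constructor
    · rintro ⟨t, ht, rfl⟩; exact ⟨(t - i).toNat, by omega, by congr 1; omega⟩
    · rintro ⟨t, ht, rfl⟩; exact ⟨i + t, by omega, rfl⟩

theorem ConnSet.exists_path {D : Set V} (hD : ConnSet G D) {a b : V} (ha : a ∈ D) (hb : b ∈ D) :
    ∃ X ⊆ D, IPath G X a b := by
  obtain ⟨w, hw⟩ := hD.exists_walk_length_eq_dist ⟨a, ha⟩ ⟨b, hb⟩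
  refine ⟨(fun i => (w.getVert i : V)) '' Iic w.length, ?_, w.length, fun i => (w.getVert i : V),
    ?_, by simp, by simp, rfl⟩
  · rintro _ ⟨i, _, rfl⟩; exact (w.getVert i).2
  · intro i j hij hj
    have h1 : (G.induce D).dist ⟨a, ha⟩ (w.getVert i) ≤ i :=
      (SimpleGraph.dist_le (w.take i)).trans (by simp)
    have h2 : (G.induce D).dist (w.getVert j) ⟨b, hb⟩ ≤ w.length - j :=
      (SimpleGraph.dist_le (w.drop j)).trans (by simp)
    have h3 := hD.dist_triangle (u := ⟨a, ha⟩) (v := w.getVert i) (w := w.getVert j)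
    have h4 := hD.dist_triangle (u := ⟨a, ha⟩) (v := w.getVert j) (w := ⟨b, hb⟩)
    have h5 : j - i ≤ (G.induce D).dist (w.getVert i) (w.getVert j) := by omega
    refine ⟨fun e => ?_, fun e => ?_, fun e => ?_⟩
    · have e' : w.getVert i = w.getVert j := Subtype.ext e
      rw [e', SimpleGraph.dist_self] at h5; omega
    · have : (G.induce D).dist (w.getVert i) (w.getVert j) = 1 :=
        SimpleGraph.dist_eq_one_iff_adj.2 e
      omega
    · subst e
      exact w.adj_getVert_succ (by omega)


theorem PathOn.isPathEmb {p : ℕ → V} {k : ℕ} (h : PathOn G p k) :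
    IsPathEmb G (k + 1) fun i => p i := by
  constructor
  · intro i j e
    by_contra hne
    rcases Nat.lt_or_gt_of_ne (fun e => hne (Fin.ext e)) with hlt | hlt
    · exact (h i j hlt (by omega)).1 e
    · exact (h j i hlt (by omega)).1 e.symm
  · intro i j
    rcases lt_trichotomy i.val j.val with hlt | heq | hlt
    · rw [(h i j hlt (by omega)).2]; omega
    · simp [heq]
    · rw [G.adj_comm, (h j i hlt (by omega)).2]; omega

theorem PathOn.inj {p : ℕ → V} {k : ℕ} (h : PathOn G p k) {i j : ℕ} (hi : i ≤ k) (hj : j ≤ k)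
    (e : p i = p j) : i = j := by
  rcases lt_trichotomy i j with hlt | heq | hlt
  · exact absurd e (h i j hlt hj).1
  · exact heq
  · exact absurd e.symm (h j i hlt hi).1

theorem theta_of_sets (hC : MemC G) {x q : V} (hne : x ≠ q) (hadj : ¬ G.Adj x q)
    {D₁ D₂ D₃ : Set V} (c₁ : ConnSet G D₁) (c₂ : ConnSet G D₂) (c₃ : ConnSet G D₃)
    (x₁ : ∃ a ∈ D₁, G.Adj x a) (x₂ : ∃ a ∈ D₂, G.Adj x a) (x₃ : ∃ a ∈ D₃, G.Adj x a)
    (q₁ : ∃ a ∈ D₁, G.Adj q a) (q₂ : ∃ a ∈ D₂, G.Adj q a) (q₃ : ∃ a ∈ D₃, G.Adj q a)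
    (h₁₂ : Far G D₁ D₂) (h₁₃ : Far G D₁ D₃) (h₂₃ : Far G D₂ D₃) : False := by
  have main : ∀ D : Set V, ConnSet G D → (∃ a ∈ D, G.Adj x a) → (∃ a ∈ D, G.Adj q a) →
      ∃ (k : ℕ) (p : ℕ → V), PathOn G p k ∧ p 0 = x ∧ p k = q ∧ 2 ≤ k ∧
        ∀ t ≤ k, 0 < t → t < k → p t ∈ D := by
    rintro D hD ⟨a, ha, xa⟩ ⟨b, hb, qb⟩
    obtain ⟨X, hX, k, p, hp, h0, hk, rfl⟩ :=
      ((hD.insert hb qb).insert (mem_insert_of_mem _ ha) xa).exists_path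
        (mem_insert x _) (mem_insert_of_mem x (mem_insert q D))
    refine ⟨k, p, hp, h0, hk, ?_, ?_⟩
    · by_contra h2
      rcases (show k = 0 ∨ k = 1 by omega) with rfl | rfl
      · exact hne (h0.symm.trans hk)
      · exact hadj (h0 ▸ hk ▸ (hp 0 1 (by omega) le_rfl).2.2 rfl)
    · intro t ht h1 h2
      rcases hX ⟨t, ht, rfl⟩ with e | e | e
      · exact absurd (hp.inj ht (Nat.zero_le _) (e.trans h0.symm)) (by omega)
      · exact absurd (hp.inj ht le_rfl (e.trans hk.symm)) (by omega)
      · exact e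
  have key : ∀ i : Fin 3, ConnSet G (![D₁, D₂, D₃] i) ∧ (∃ a ∈ ![D₁, D₂, D₃] i, G.Adj x a) ∧
      ∃ a ∈ ![D₁, D₂, D₃] i, G.Adj q a := by
    intro i; fin_cases i <;> simp_all
  have far : ∀ i j : Fin 3, i ≠ j → Far G (![D₁, D₂, D₃] i) (![D₁, D₂, D₃] j) := by
    intro i j hij
    fin_cases i <;> fin_cases j <;> first | exact absurd rfl hij | assumption | (apply Far.symm; assumption)
  choose k p hp h0 hk k2 hD using fun i => main _ (key i).1 (key i).2.1 (key i).2.2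
  refine hC.2.1 ⟨x, q, fun i => k i + 1, fun i t => p i t, hne, hadj, ?_, ?_, ?_⟩
  · intro i; have := k2 i; dsimp only; omega
  · intro i; exact ⟨(hp i).isPathEmb, Nat.succ_pos _, h0 i, by simpa using hk i⟩
  · intro i j hij u v u1 u2 v1 v2
    exact far i j hij _ (hD i u (Nat.lt_succ_iff.1 u.2) u1 u2) _
      (hD j v (Nat.lt_succ_iff.1 v.2) v1 v2)

theorem prism_of_sets (hC : MemC G) {a₁ a₂ a₃ b₁ b₂ b₃ : V}
    {D₁ D₂ D₃ : Set V} (c₁ : ConnSet G D₁) (c₂ : ConnSet G D₂) (c₃ : ConnSet G D₃)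
    (ha₁ : a₁ ∈ D₁) (ha₂ : a₂ ∈ D₂) (ha₃ : a₃ ∈ D₃) (hb₁ : b₁ ∈ D₁) (hb₂ : b₂ ∈ D₂) (hb₃ : b₃ ∈ D₃)
    (n₁ : a₁ ≠ b₁) (n₂ : a₂ ≠ b₂) (n₃ : a₃ ≠ b₃)
    (h₁₂ : ∀ u ∈ D₁, ∀ w ∈ D₂, u ≠ w ∧ (G.Adj u w ↔ (u = a₁ ∧ w = a₂) ∨ (u = b₁ ∧ w = b₂)))
    (h₁₃ : ∀ u ∈ D₁, ∀ w ∈ D₃, u ≠ w ∧ (G.Adj u w ↔ (u = a₁ ∧ w = a₃) ∨ (u = b₁ ∧ w = b₃)))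
    (h₂₃ : ∀ u ∈ D₂, ∀ w ∈ D₃, u ≠ w ∧ (G.Adj u w ↔ (u = a₂ ∧ w = a₃) ∨ (u = b₂ ∧ w = b₃))) :
    False := by
  have main : ∀ (D : Set V) (a b : V), ConnSet G D → a ∈ D → b ∈ D → a ≠ b →
      ∃ (k : ℕ) (p : ℕ → V), PathOn G p k ∧ p 0 = a ∧ p k = b ∧ 1 ≤ k ∧ ∀ t ≤ k, p t ∈ D := by
    intro D a b hD ha hb hab
    obtain ⟨X, hX, k, p, hp, h0, hk, rfl⟩ := hD.exists_path ha hb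
    refine ⟨k, p, hp, h0, hk, ?_, fun t ht => hX ⟨t, ht, rfl⟩⟩
    rcases Nat.eq_zero_or_pos k with rfl | h
    · exact absurd (h0.symm.trans hk) hab
    · exact h
  have far : ∀ i j : Fin 3, i ≠ j → ∀ u ∈ ![D₁, D₂, D₃] i, ∀ w ∈ ![D₁, D₂, D₃] j,
      u ≠ w ∧ (G.Adj u w ↔ (u = ![a₁, a₂, a₃] i ∧ w = ![a₁, a₂, a₃] j) ∨
        (u = ![b₁, b₂, b₃] i ∧ w = ![b₁, b₂, b₃] j)) := by
    have sy : ∀ {A B : Set V} {a b a' b' : V},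
        (∀ u ∈ A, ∀ w ∈ B, u ≠ w ∧ (G.Adj u w ↔ (u = a ∧ w = b) ∨ (u = a' ∧ w = b'))) →
        ∀ u ∈ B, ∀ w ∈ A, u ≠ w ∧ (G.Adj u w ↔ (u = b ∧ w = a) ∨ (u = b' ∧ w = a')) := by
      intro A B a b a' b' h u hu w hw
      refine ⟨(h w hw u hu).1.symm, ?_⟩
      rw [G.adj_comm, (h w hw u hu).2, and_comm, and_comm (a := w = a')]
    intro i j hij
    fin_cases i <;> fin_cases j <;>
      first | exact absurd rfl hij | assumption | (apply sy; assumption)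
  have key : ∀ i : Fin 3, ConnSet G (![D₁, D₂, D₃] i) ∧ ![a₁, a₂, a₃] i ∈ ![D₁, D₂, D₃] i ∧
      ![b₁, b₂, b₃] i ∈ ![D₁, D₂, D₃] i ∧ ![a₁, a₂, a₃] i ≠ ![b₁, b₂, b₃] i := by
    intro i; fin_cases i <;> simp_all
  choose k p hp h0 hk k1 hD using
    fun i => main _ _ _ (key i).1 (key i).2.1 (key i).2.2.1 (key i).2.2.2
  refine hC.2.2.1 ⟨fun i => k i + 1, fun i t => p i t, ?_, fun i => (hp i).isPathEmb, ?_, ?_⟩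
  · intro i; have := k1 i; dsimp only; omega
  · intro i j hij u v
    exact (far i j hij _ (hD i u (Nat.lt_succ_iff.1 u.2)) _ (hD j v (Nat.lt_succ_iff.1 v.2))).1
  · intro i j hij u v
    rw [(far i j hij _ (hD i u (Nat.lt_succ_iff.1 u.2)) _ (hD j v (Nat.lt_succ_iff.1 v.2))).2]
    have e : ∀ (i : Fin 3) (u : Fin (k i + 1)), (p i u = ![a₁, a₂, a₃] i ↔ u.val = 0) ∧
        (p i u = ![b₁, b₂, b₃] i ↔ u.val = k i + 1 - 1) := by
      intro i u
      refine ⟨⟨fun e => (hp i).inj (by omega) (Nat.zero_le _) (e.trans (h0 i).symm),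
        fun e => by rw [e, h0]⟩, ⟨fun e => (hp i).inj (by omega) le_rfl (e.trans (hk i).symm),
        fun e => by rw [e]; exact hk i⟩⟩
    rw [(e i u).1, (e j v).1, (e i u).2, (e j v).2]

theorem IsHole.of_nat {n : ℕ} (hn : 4 ≤ n) (g : ℕ → V)
    (hg : ∀ i j, i < j → j < n → g i ≠ g j ∧ (G.Adj (g i) (g j) ↔ j = i + 1 ∨ (i = 0 ∧ j = n - 1))) :
    IsHole G (g '' Iio n) := by
  have : NeZero n := ⟨by omega⟩
  have key : ∀ i j : ZMod n, i.val < j.val →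
      ((i = j + 1 ∨ j = i + 1) ↔ (j.val = i.val + 1 ∨ (i.val = 0 ∧ j.val = n - 1))) := by
    intro i j hij
    have hi := i.val_lt
    have hj := j.val_lt
    have one : (1 : ZMod n).val = 1 := ZMod.val_one'' (by omega)
    rw [← (ZMod.val_injective n).eq_iff, ← (ZMod.val_injective n).eq_iff (a := j),
      ZMod.val_add, ZMod.val_add, one, Nat.mod_eq_of_lt (show i.val + 1 < n by omega)]
    rcases Nat.lt_or_ge (j.val + 1) n with h | h
    · rw [Nat.mod_eq_of_lt h]; omega
    · have : j.val + 1 = n := by omega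
      rw [this, Nat.mod_self]; omega
  refine ⟨n, fun i => g i.val, hn, ⟨?_, ?_⟩, ?_⟩
  · intro i j e
    by_contra hne
    rcases Nat.lt_or_gt_of_ne (fun e => hne (ZMod.val_injective n e)) with hlt | hlt
    · exact (hg _ _ hlt j.val_lt).1 e
    · exact (hg _ _ hlt i.val_lt).1 e.symm
  · intro i j
    rcases lt_trichotomy i.val j.val with hlt | heq | hlt
    · rw [(hg _ _ hlt j.val_lt).2, key i j hlt]
    · have : i = j := ZMod.val_injective n heq
      subst this
      have one : (1 : ZMod n) ≠ 0 := fun e => by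
        have := ZMod.val_one'' (n := n) (by omega); rw [e, ZMod.val_zero] at this; omega
      simp [one]
    · rw [G.adj_comm, (hg _ _ hlt i.val_lt).2, or_comm (a := i = j + 1), key j i hlt]
  · ext v
    simp only [mem_range, mem_image, mem_Iio]
    constructor
    · rintro ⟨i, rfl⟩; exact ⟨_, i.val_lt, rfl⟩
    · rintro ⟨i, hi, rfl⟩; exact ⟨(i : ZMod n), by rw [ZMod.val_natCast, Nat.mod_eq_of_lt hi]⟩

theorem close_hole {X Y : Set V} {a b c d : V} (h₁ : IPath G X a b) (h₂ : IPath G Y c d)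
    (hX : ∀ u ∈ X, ∀ w ∈ Y, u ≠ w ∧ (G.Adj u w ↔ (u = a ∧ w = c) ∨ (u = b ∧ w = d)))
    (hl : (a ≠ b ∧ c ≠ d) ∨ (a ≠ b ∧ ¬ G.Adj a b)) : IsHole G (X ∪ Y) := by
  obtain ⟨k, p, hp, rfl, rfl, rfl⟩ := h₁
  obtain ⟨l, q, hq, rfl, rfl, rfl⟩ := h₂
  have hn : 4 ≤ k + l + 2 := by
    rcases hl with ⟨h1, h2⟩ | ⟨h1, h2⟩
    · have : k ≠ 0 := fun e => h1 (by rw [e])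
      have : l ≠ 0 := fun e => h2 (by rw [e])
      omega
    · have : k ≠ 0 := fun e => h1 (by rw [e])
      have : k ≠ 1 := fun e => h2 (by rw [e]; exact (hp 0 1 (by omega) (by omega)).2.2 rfl)
      omega
  have := IsHole.of_nat (G := G) hn (fun i => if i ≤ k then p i else q (k + l + 1 - i)) ?_
  · convert this using 1
    ext v
    simp only [mem_union, mem_image, mem_Iic, mem_Iio]
    constructor
    · rintro (⟨i, hi, rfl⟩ | ⟨i, hi, rfl⟩)
      · exact ⟨i, by omega, by simp [hi]⟩
      · exact ⟨k + l + 1 - i, by omega, by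
          simp only [show ¬ (k + l + 1 - i ≤ k) by omega, if_false]; congr 1; omega⟩
    · rintro ⟨i, hi, rfl⟩
      by_cases h : i ≤ k
      · exact Or.inl ⟨i, h, by simp [h]⟩
      · exact Or.inr ⟨k + l + 1 - i, by omega, by simp [h]⟩
  · intro i j hij hj
    by_cases h1 : j ≤ k
    · simp only [h1, show i ≤ k by omega, if_true]
      exact ⟨(hp i j hij h1).1, (hp i j hij h1).2.trans (by omega)⟩
    · by_cases h2 : i ≤ k
      · simp only [h1, h2, if_true, if_false]
        have := hX (p i) ⟨i, h2, rfl⟩ (q (k + l + 1 - j)) ⟨_, by simp; omega, rfl⟩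
        refine ⟨this.1, this.2.trans ?_⟩
        have e1 : p i = p 0 ↔ i = 0 := ⟨hp.inj h2 (Nat.zero_le _), fun e => by rw [e]⟩
        have e2 : p i = p k ↔ i = k := ⟨hp.inj h2 le_rfl, fun e => by rw [e]⟩
        have e3 : q (k + l + 1 - j) = q 0 ↔ k + l + 1 - j = 0 :=
          ⟨hq.inj (by omega) (Nat.zero_le _), fun e => by rw [e]⟩
        have e4 : q (k + l + 1 - j) = q l ↔ k + l + 1 - j = l :=
          ⟨hq.inj (by omega) le_rfl, fun e => by rw [e]⟩
        rw [e1, e2, e3, e4]; omega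
      · simp only [h1, h2, if_false]
        have := hq (k + l + 1 - j) (k + l + 1 - i) (by omega) (by omega)
        refine ⟨this.1.symm, ?_⟩
        rw [G.adj_comm, this.2]; omega

theorem no_C4 (hC : MemC G) {a b c d : V} (ab : G.Adj a b) (bc : G.Adj b c) (cd : G.Adj c d)
    (da : G.Adj d a) (ac : a ≠ c) (bd : b ≠ d) (nac : ¬ G.Adj a c) : G.Adj b d := by
  by_contra nbd
  have h1 : IPath G ({a} ∪ {b}) a b := (IPath.single a).glue (IPath.single b) ab (by
    rintro u rfl w rfl; exact ⟨ab.ne, fun _ => ⟨rfl, rfl⟩⟩)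
  have h2 : IPath G ({d} ∪ {c}) d c := (IPath.single d).glue (IPath.single c) cd.symm (by
    rintro u rfl w rfl; exact ⟨cd.ne', fun _ => ⟨rfl, rfl⟩⟩)
  have := close_hole h1 h2 (by
    rintro u (rfl | rfl) w (rfl | rfl)
    · exact ⟨da.ne', by simp [da.symm]⟩
    · exact ⟨ac, by simp [nac, ab.ne, cd.ne]⟩
    · exact ⟨bd, by simp [nbd, ab.ne', cd.ne']⟩
    · exact ⟨bc.ne, by simp [bc]⟩) (Or.inl ⟨ab.ne, cd.ne'⟩)
  classical
  refine hC.1 _ this ?_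
  have e : ({a} ∪ {b} ∪ ({d} ∪ {c}) : Set V) = (({a, b, d, c} : Finset V) : Set V) := by
    ext; simp; tauto
  rw [e, Set.ncard_coe_finset]
  rw [Finset.card_insert_of_notMem, Finset.card_insert_of_notMem, Finset.card_insert_of_notMem,
    Finset.card_singleton] <;> simp [ab.ne, bc.ne, cd.ne', da.ne', ac, bd]

/-- A cyclic parametrization, of period `N`, of a hole. -/
structure Cyc (G : SimpleGraph V) (h : ℤ → V) (N : ℤ) : Prop where
  four : 4 ≤ N
  per : ∀ i, h (i + N) = h i
  ne : ∀ i j, i < j → j < i + N → h i ≠ h j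
  adj : ∀ i j, i < j → j < i + N → (G.Adj (h i) (h j) ↔ j = i + 1 ∨ j = i + N - 1)

theorem IsHole.exists_cyc {H : Set V} (hH : IsHole G H) :
    ∃ (h : ℤ → V) (N : ℤ), Cyc G h N ∧ range h = H := by
  obtain ⟨n, f, hn, ⟨finj, fadj⟩, rfl⟩ := hH
  have : NeZero n := ⟨by omega⟩
  have key : ∀ a b : ℤ, (a : ZMod n) = b → -n < b - a → b - a < n → a = b := by
    intro a b e h1 h2
    rw [ZMod.intCast_eq_intCast_iff_dvd_sub] at e
    obtain ⟨c, hc⟩ := e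
    have : c = 0 := by
      have : -1 < c := by nlinarith
      have : c < 1 := by nlinarith
      omega
    subst this; omega
  have per : ((n : ℤ) : ZMod n) = 0 := by simp
  refine ⟨fun i => f (i : ZMod n), n, ⟨by omega, ?_, ?_, ?_⟩, ?_⟩
  · intro i; simp
  · intro i j h1 h2 e
    have := key i j (finj e) (by omega) (by omega)
    omega
  · intro i j h1 h2
    rw [fadj]
    constructor
    · rintro (e | e)
      · right
        have := key j (i + n - 1) (by push_cast at *; rw [e]; simp) (by omega) (by omega)
        omega
      · left
        exact (key (i + 1) j (by rw [e]; simp) (by omega) (by omega)).symm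
    · rintro (e | e)
      · right; rw [e]; simp
      · left; rw [e]; simp
  · ext v; simp only [mem_range]
    constructor
    · rintro ⟨i, rfl⟩; exact ⟨_, rfl⟩
    · rintro ⟨i, rfl⟩; exact ⟨(i.val : ℤ), by simp⟩

namespace Cyc

variable {h : ℤ → V} {N : ℤ}

theorem reflect (C : Cyc G h N) : Cyc G (fun i => h (-i)) N where
  four := C.four
  per i := by rw [← C.per (-(i + N))]; congr 1; ring
  ne i j h1 h2 := (C.ne (-j) (-i) (by omega) (by omega)).symm
  adj i j h1 h2 := by rw [G.adj_comm]; exact (C.adj _ _ (by omega) (by omega)).trans (by omega)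

theorem per_mul (C : Cyc G h N) (i : ℤ) (c : ℤ) : h (i + c * N) = h i := by
  induction c using Int.induction_on with
  | zero => simp
  | succ c ih => rw [← ih, ← C.per (i + c * N)]; congr 1; ring
  | pred c ih => rw [← ih, ← C.per (i + (-c - 1) * N)]; congr 1; ring

theorem rep (C : Cyc G h N) (c i : ℤ) : ∃ j, c ≤ j ∧ j < c + N ∧ h j = h i ∧
    ∃ t, j = i + t * N := by
  have hN : 0 < N := by have := C.four; omega
  have h1 := Int.emod_nonneg (i - c) hN.ne'
  have h2 := Int.emod_lt_of_pos (i - c) hN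
  have h3 := Int.mul_ediv_add_emod (i - c) N
  refine ⟨c + (i - c) % N, by omega, by omega, ?_, -((i - c) / N), ?_⟩
  · rw [← C.per_mul i (-((i - c) / N))]; congr 1; linarith
  · linarith

theorem inj (C : Cyc G h N) {i j : ℤ} (h1 : j < i + N) (h2 : i < j + N) (e : h i = h j) :
    i = j := by
  rcases lt_trichotomy i j with hlt | heq | hlt
  · exact absurd e (C.ne i j hlt h1)
  · exact heq
  · exact absurd e.symm (C.ne j i hlt h2)

theorem adj_succ (C : Cyc G h N) (i : ℤ) : G.Adj (h i) (h (i + 1)) :=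
  (C.adj i (i + 1) (by omega) (by have := C.four; omega)).2 (Or.inl rfl)

theorem adj_pred (C : Cyc G h N) (i : ℤ) : G.Adj (h i) (h (i - 1)) := by
  have := (C.adj_succ (i - 1)).symm
  rwa [sub_add_cancel] at this

theorem iPath (C : Cyc G h N) {i j : ℤ} (h1 : i ≤ j) (h2 : j + 2 ≤ i + N) :
    IPath G (h '' Icc i j) (h i) (h j) :=
  IPath.of_int h1 fun a b ha hab hb =>
    ⟨C.ne a b hab (by omega), (C.adj a b hab (by omega)).trans (by omega)⟩

theorem conn (C : Cyc G h N) {i j : ℤ} (h1 : i ≤ j) : ConnSet G (h '' Icc i j) := by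
  have := PathOn.connSet (G := G) (p := fun t : ℕ => h (i + t)) (k := (j - i).toNat)
    fun t _ => by have := C.adj_succ (i + t); push_cast; rwa [← add_assoc]
  convert this using 1
  ext v
  simp only [mem_image, mem_Iic, mem_Icc]
  constructor
  · rintro ⟨t, ht, rfl⟩; exact ⟨(t - i).toNat, by omega, by congr 1; omega⟩
  · rintro ⟨t, ht, rfl⟩; exact ⟨i + t, by omega, rfl⟩

theorem far (C : Cyc G h N) {i j k l : ℤ} (h1 : j + 2 ≤ k) (h2 : l + 2 ≤ i + N) :
    Far G (h '' Icc i j) (h '' Icc k l) := by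
  rintro _ ⟨a, ⟨ha, hb⟩, rfl⟩ _ ⟨b, ⟨hc, hd⟩, rfl⟩
  refine ⟨C.ne a b (by omega) (by omega), ?_⟩
  rw [C.adj a b (by omega) (by omega)]; omega

end Cyc

theorem hole_parity (hC : MemC G) {H : Set V} {y : V} (hH : IsHole G H) (hy : y ∉ H)
    (hev : Even (holeNbrs G H y).ncard) (hpos : 0 < (holeNbrs G H y).ncard) :
    (holeNbrs G H y).ncard = 2 ∧
      ∃ a ∈ H, ∃ b ∈ H, G.Adj y a ∧ G.Adj y b ∧ G.Adj a b := by
  have h2 : (holeNbrs G H y).ncard = 2 := by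
    by_contra hne
    refine hC.2.2.2 H y ⟨hH, hy, ?_⟩ hev
    obtain ⟨c, hc⟩ := hev; omega
  refine ⟨h2, ?_⟩
  obtain ⟨a, b, hab, hset⟩ := Set.ncard_eq_two.1 h2
  have ma : a ∈ holeNbrs G H y := by rw [hset]; simp
  have mb : b ∈ holeNbrs G H y := by rw [hset]; simp
  refine ⟨a, ma.1, b, mb.1, ma.2, mb.2, ?_⟩
  by_contra nadj
  obtain ⟨h, N, C, rfl⟩ := hH.exists_cyc
  obtain ⟨i, rfl⟩ := ma.1
  obtain ⟨j', rfl⟩ := mb.1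
  obtain ⟨j, hj1, hj2, e, -⟩ := C.rep i j'
  rw [← e] at mb hab nadj
  have hij : i ≠ j := fun e => hab (by rw [e])
  have hadj := C.adj i j (by omega) (by omega)
  have h3 : j ≠ i + 1 ∧ j ≠ i + N - 1 := by
    constructor <;> intro e <;> exact nadj (hadj.2 (by omega))
  have ynot : ∀ k l, (∀ t, k ≤ t → t ≤ l → h t ≠ h i ∧ h t ≠ h j) → Far G {y} (h '' Icc k l) := by
    rintro k l hkl a ha' _ ⟨t, ht, rfl⟩
    rw [mem_singleton_iff.1 ha']
    refine ⟨fun e => hy ⟨t, e.symm⟩, fun ha => ?_⟩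
    have : h t ∈ holeNbrs G (range h) y := ⟨⟨t, rfl⟩, ha⟩
    rw [hset] at this
    have := hkl t ht.1 ht.2
    simp_all
  have f1 := ynot (i + 1) (j - 1) fun t h1 h2 =>
    ⟨(C.ne i t (by omega) (by omega)).symm, C.ne t j (by omega) (by omega)⟩
  have f2 := ynot (j + 1) (i + N - 1) fun t h1 h2 =>
    ⟨by rw [← C.per i]; exact C.ne t (i + N) (by omega) (by omega),
      (C.ne j t (by omega) (by omega)).symm⟩
  refine theta_of_sets hC (x := h i) (q := h j) hab nadj (connSet_singleton y)
    (C.conn (i := i + 1) (j := j - 1) (by omega))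
    (C.conn (i := j + 1) (j := i + N - 1) (by omega))
    ⟨y, rfl, ma.2.symm⟩ ⟨h (i + 1), ⟨i + 1, by constructor <;> omega, rfl⟩, C.adj_succ i⟩
    ⟨h (i + N - 1), ⟨i + N - 1, by constructor <;> omega, rfl⟩, ?_⟩
    ⟨y, rfl, mb.2.symm⟩ ⟨h (j - 1), ⟨j - 1, by constructor <;> omega, rfl⟩, C.adj_pred j⟩
    ⟨h (j + 1), ⟨j + 1, by constructor <;> omega, rfl⟩, C.adj_succ j⟩ f1 f2
    (C.far (by omega) (by omega))
  have := C.adj_pred (i + N)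
  rwa [C.per] at this

open Classical in
/-- The number of `k ∈ [i, j]` such that `h k` is a neighbour of `x`. -/
noncomputable def cnt (G : SimpleGraph V) (x : V) (h : ℤ → V) (i j : ℤ) : ℕ :=
  ((Finset.Icc i j).filter fun k => G.Adj x (h k)).card

section cnt

variable {x : V} {h : ℤ → V}

theorem cnt_split {i j l : ℤ} (h1 : i ≤ j + 1) (h2 : j ≤ l) :
    cnt G x h i l = cnt G x h i j + cnt G x h (j + 1) l := by
  classical
  unfold cnt
  rw [← Finset.card_union_of_disjoint]
  · congr 1; ext k; simp only [Finset.mem_filter, Finset.mem_Icc, Finset.mem_union]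
    constructor
    · rintro ⟨a, b⟩; rcases le_or_gt k j with c | c
      · exact Or.inl ⟨by omega, b⟩
      · exact Or.inr ⟨by omega, b⟩
    · rintro (⟨a, b⟩ | ⟨a, b⟩) <;> exact ⟨by omega, b⟩
  · rw [Finset.disjoint_left]; simp only [Finset.mem_filter, Finset.mem_Icc]; intro k; omega

theorem cnt_eq_zero {i j : ℤ} (H : ∀ k, i ≤ k → k ≤ j → ¬ G.Adj x (h k)) : cnt G x h i j = 0 := by
  classical
  unfold cnt
  rw [Finset.card_eq_zero, Finset.filter_eq_empty_iff]
  intro k hk; rw [Finset.mem_Icc] at hk; exact H k hk.1 hk.2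

theorem cnt_pos {i j k : ℤ} (h1 : i ≤ k) (h2 : k ≤ j) (H : G.Adj x (h k)) : 0 < cnt G x h i j := by
  classical
  unfold cnt
  exact Finset.card_pos.2 ⟨k, by simp [*]⟩

theorem exists_of_cnt_pos {i j : ℤ} (H : 0 < cnt G x h i j) :
    ∃ k, i ≤ k ∧ k ≤ j ∧ G.Adj x (h k) := by
  by_contra hn
  push Not at hn
  have := cnt_eq_zero hn
  omega

theorem cnt_one {i : ℤ} (H : G.Adj x (h i)) : cnt G x h i i = 1 := by
  classical
  unfold cnt
  rw [Finset.Icc_self, Finset.filter_singleton]; simp [H]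

/-- Two intervals sharing a counted endpoint. -/
theorem cnt_join {i m j : ℤ} (h1 : i ≤ m) (h2 : m ≤ j) (H : G.Adj x (h m)) :
    cnt G x h i m + cnt G x h m j = cnt G x h i j + 1 := by
  have e1 := cnt_split (G := G) (x := x) (h := h) (i := i) (j := m - 1) (l := m) (by omega) (by omega)
  have e2 := cnt_split (G := G) (x := x) (h := h) (i := i) (j := m - 1) (l := j) (by omega) (by omega)
  rw [sub_add_cancel] at e1 e2
  have := cnt_one H
  omega

theorem cnt_mono {i j k l : ℤ} (h1 : k ≤ i) (h2 : j ≤ l) : cnt G x h i j ≤ cnt G x h k l := by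
  classical
  unfold cnt
  refine Finset.card_le_card fun t ht => ?_
  simp only [Finset.mem_filter, Finset.mem_Icc] at *
  exact ⟨by omega, ht.2⟩

theorem cnt_translate {i j c : ℤ} :
    cnt G x (fun k => h (k + c)) i j = cnt G x h (i + c) (j + c) := by
  classical
  unfold cnt
  refine Finset.card_bij (fun k _ => k + c) ?_ ?_ ?_
  · simp only [Finset.mem_filter, Finset.mem_Icc]; rintro a ⟨ha, hb⟩; exact ⟨by omega, hb⟩
  · intro a _ b _ e; omega
  · simp only [Finset.mem_filter, Finset.mem_Icc]; rintro a ⟨ha, hb⟩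
    exact ⟨a - c, ⟨by omega, by rwa [sub_add_cancel]⟩, by omega⟩

theorem cnt_neg {i j : ℤ} : cnt G x (fun k => h (-k)) i j = cnt G x h (-j) (-i) := by
  classical
  unfold cnt
  refine Finset.card_bij (fun k _ => -k) ?_ ?_ ?_
  · simp only [Finset.mem_filter, Finset.mem_Icc]; rintro a ⟨ha, hb⟩; exact ⟨by omega, hb⟩
  · intro a _ b _ e; omega
  · simp only [Finset.mem_filter, Finset.mem_Icc]; rintro a ⟨ha, hb⟩
    exact ⟨-a, ⟨by omega, by rwa [neg_neg]⟩, by omega⟩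

theorem Cyc.cnt_per {N : ℤ} (C : Cyc G h N) (i j : ℤ) :
    cnt G x h (i + N) (j + N) = cnt G x h i j := by
  rw [← cnt_translate]
  congr 1
  ext k; exact C.per k

theorem Cyc.ncard_eq_cnt {N : ℤ} (C : Cyc G h N) {i j : ℤ} (hij : j < i + N) :
    {v ∈ h '' Icc i j | G.Adj x v}.ncard = cnt G x h i j := by
  classical
  unfold cnt
  rw [← Set.ncard_coe_finset]
  have : {v ∈ h '' Icc i j | G.Adj x v} =
      h '' (((Finset.Icc i j).filter fun k => G.Adj x (h k) : Finset ℤ) : Set ℤ) := by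
    ext v; simp only [mem_image, mem_Icc, Finset.coe_filter, Finset.mem_Icc, mem_ofPred_eq]
    constructor
    · rintro ⟨⟨k, hk, rfl⟩, ha⟩; exact ⟨k, ⟨hk, ha⟩, rfl⟩
    · rintro ⟨k, ⟨hk, ha⟩, rfl⟩; exact ⟨⟨k, hk, rfl⟩, ha⟩
  rw [this, InjOn.ncard_image]
  intro a ha b hb e
  simp only [Finset.coe_filter, Finset.mem_Icc, mem_ofPred_eq] at ha hb
  exact C.inj (by omega) (by omega) e

end cnt

/-- A wheel with centre `x` and rim `h` in `B ∪ N(B)`, together with the minimality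
of its number `n` of spokes. -/
structure HubWheel (G : SimpleGraph V) (x : V) (B : Set V) (h : ℤ → V) (N : ℤ) (n : ℕ) :
    Prop where
  cls : MemC G
  cyc : Cyc G h N
  hole : IsHole G (range h)
  ne : ∀ i, h i ≠ x
  conn : ConnSet G B
  far : ∀ b ∈ B, b ≠ x ∧ ¬ G.Adj x b
  mem : ∀ i, h i ∈ B ∨ (G.Adj x (h i) ∧ ∃ b ∈ B, G.Adj (h i) b)
  card : ∀ i, cnt G x h i (i + N - 1) = n
  odd : Odd n
  three : 3 ≤ n
  stable : n = 3 → ∀ i, G.Adj x (h i) → ¬ G.Adj x (h (i + 1))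
  min : ∀ K, IsHole G K → (∀ v ∈ K, v ∈ B ∨ (G.Adj x v ∧ ∃ b ∈ B, G.Adj v b)) →
    3 ≤ (holeNbrs G K x).ncard → (holeNbrs G K x).ncard < n → (holeNbrs G K x).ncard = 3

/-- `[c, d]` is a sector of the wheel: consecutive neighbours of `x`. -/
structure Sec (G : SimpleGraph V) (x : V) (h : ℤ → V) (c d : ℤ) : Prop where
  left : G.Adj x (h c)
  right : G.Adj x (h d)
  lt : c < d
  mid : ∀ k, c < k → k < d → ¬ G.Adj x (h k)

/-- Two vertices lie in a common sector. -/
def Cosec (G : SimpleGraph V) (x : V) (h : ℤ → V) (u w : V) : Prop :=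
  ∃ c d, Sec G x h c d ∧ u ∈ h '' Icc c d ∧ w ∈ h '' Icc c d

theorem exists_least_of_mem {P : ℤ → Prop} {a b : ℤ} (H : ∃ k, a ≤ k ∧ k ≤ b ∧ P k) :
    ∃ k, a ≤ k ∧ k ≤ b ∧ P k ∧ ∀ t, a ≤ t → t < k → ¬ P t := by
  obtain ⟨k, ⟨h1, h2, h3⟩, h4⟩ := Int.exists_least_of_bdd (P := fun k => a ≤ k ∧ k ≤ b ∧ P k)
    ⟨a, fun z hz => hz.1⟩ H
  exact ⟨k, h1, h2, h3, fun t t1 t2 t3 => by have := h4 t ⟨t1, by omega, t3⟩; omega⟩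

theorem exists_greatest_of_mem {P : ℤ → Prop} {a b : ℤ} (H : ∃ k, a ≤ k ∧ k ≤ b ∧ P k) :
    ∃ k, a ≤ k ∧ k ≤ b ∧ P k ∧ ∀ t, k < t → t ≤ b → ¬ P t := by
  obtain ⟨k, ⟨h1, h2, h3⟩, h4⟩ := Int.exists_greatest_of_bdd (P := fun k => a ≤ k ∧ k ≤ b ∧ P k)
    ⟨b, fun z hz => hz.2.1⟩ H
  exact ⟨k, h1, h2, h3, fun t t1 t2 t3 => by have := h4 t ⟨by omega, t2, t3⟩; omega⟩

section

variable {x : V} {h : ℤ → V} {N : ℤ} {B : Set V} {n : ℕ}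

theorem Sec.reflect {c d : ℤ} (S : Sec G x h c d) :
    Sec G x (fun i => h (-i)) (-d) (-c) where
  left := by simpa using S.right
  right := by simpa using S.left
  lt := by have := S.lt; omega
  mid k h1 h2 := S.mid _ (by omega) (by omega)

theorem Sec.translate {c d : ℤ} (S : Sec G x h c d) (C : Cyc G h N) (t : ℤ) :
    Sec G x h (c + t * N) (d + t * N) where
  left := by rw [C.per_mul]; exact S.left
  right := by rw [C.per_mul]; exact S.right
  lt := by have := S.lt; omega
  mid k h1 h2 := by
    have := S.mid (k - t * N) (by omega) (by omega)
    rwa [← C.per_mul (k - t * N) t, sub_add_cancel] at this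

theorem Sec.next {c d : ℤ} (S : Sec G x h c d) (C : Cyc G h N) : Sec G x h (c + N) (d + N) := by
  simpa using S.translate C 1

theorem Sec.prev {c d : ℤ} (S : Sec G x h c d) (C : Cyc G h N) : Sec G x h (c - N) (d - N) := by
  simpa [sub_eq_add_neg] using S.translate C (-1)

theorem Sec.cnt {c d : ℤ} (S : Sec G x h c d) : cnt G x h c d = 2 := by
  have e1 := cnt_split (G := G) (x := x) (h := h) (i := c) (j := c) (l := d) (by omega) S.lt.le
  have hlt := S.lt
  have e2 := cnt_split (G := G) (x := x) (h := h) (i := c + 1) (j := d - 1) (l := d)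
    (by omega) (by omega)
  rw [sub_add_cancel] at e2
  have := cnt_eq_zero (G := G) (x := x) (h := h) (i := c + 1) (j := d - 1)
    fun k h1 h2 => S.mid k (by omega) (by omega)
  have := cnt_one S.left
  have := cnt_one S.right
  omega

namespace HubWheel

theorem reflect (W : HubWheel G x B h N n) : HubWheel G x B (fun i => h (-i)) N n where
  cls := W.cls
  cyc := W.cyc.reflect
  hole := by
    convert W.hole using 1
    ext v; constructor
    · rintro ⟨i, rfl⟩; exact ⟨_, rfl⟩
    · rintro ⟨i, rfl⟩; exact ⟨-i, by simp⟩
  ne i := W.ne _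
  conn := W.conn
  far := W.far
  mem i := W.mem _
  card i := by rw [cnt_neg, ← W.card (-(i + N - 1))]; congr 1; ring
  odd := W.odd
  three := W.three
  stable e i h1 h2 := W.stable e (-(i + 1)) h2 (by simpa using h1)
  min := W.min

variable (W : HubWheel G x B h N n)
include W

theorem mem_B {i : ℤ} (hi : ¬ G.Adj x (h i)) : h i ∈ B :=
  (W.mem i).resolve_right fun e => hi e.1

theorem per_adj {i : ℤ} (v : V) : G.Adj v (h (i + N)) ↔ G.Adj v (h i) := by rw [W.cyc.per]

theorem exists_next (i : ℤ) : ∃ r, i < r ∧ G.Adj x (h r) ∧ ∀ k, i < k → k < r → ¬ G.Adj x (h k) := by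
  have := W.card (i + 1)
  have h3 := W.three
  obtain ⟨k, h1, h2, h3, h4⟩ := exists_least_of_mem (P := fun k => G.Adj x (h k))
    (exists_of_cnt_pos (G := G) (x := x) (h := h) (i := i + 1) (j := i + 1 + N - 1) (by omega))
  exact ⟨k, by omega, h3, fun t t1 t2 => h4 t (by omega) t2⟩

theorem exists_prev (i : ℤ) : ∃ l, l < i ∧ G.Adj x (h l) ∧ ∀ k, l < k → k < i → ¬ G.Adj x (h k) := by
  obtain ⟨r, h1, h2, h3⟩ := W.reflect.exists_next (-i)
  refine ⟨-r, by omega, h2, fun k k1 k2 => ?_⟩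
  have := h3 (-k) (by omega) (by omega)
  simpa using this

theorem next_sec {m : ℤ} (hm : G.Adj x (h m)) : ∃ r, Sec G x h m r := by
  obtain ⟨r, h1, h2, h3⟩ := W.exists_next m
  exact ⟨r, hm, h2, h1, h3⟩

theorem prev_sec {m : ℤ} (hm : G.Adj x (h m)) : ∃ l, Sec G x h l m := by
  obtain ⟨r, h1, h2, h3⟩ := W.exists_prev m
  exact ⟨r, h2, hm, h1, h3⟩

/-- Every position lies in a half-open sector. -/
theorem exists_sec (i : ℤ) : ∃ c d, Sec G x h c d ∧ c ≤ i ∧ i < d := by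
  obtain ⟨c, h1, h2, h3⟩ := W.exists_prev (i + 1)
  obtain ⟨d, S⟩ := W.next_sec h2
  refine ⟨c, d, S, by omega, ?_⟩
  by_contra hn
  exact h3 d S.lt (by omega) S.right

theorem two_secs {l m r : ℤ} (S : Sec G x h l m) (T : Sec G x h m r) : r + 2 ≤ l + N := by
  have e := cnt_join S.lt.le T.lt.le S.right
  rw [S.cnt, T.cnt] at e
  have h3 := W.three
  by_contra hn
  have hc := W.card l
  rcases lt_or_ge r (l + N) with h1 | h1
  · obtain rfl : r = l + N - 1 := by omega
    refine W.stable (by omega) _ T.right ?_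
    rw [sub_add_cancel, W.cyc.per]; exact S.left
  · have e1 := cnt_split (G := G) (x := x) (h := h) (i := l) (j := l + N - 1) (l := r)
      (by have := W.cyc.four; omega) (by omega)
    have : 0 < _root_.cnt G x h (l + N - 1 + 1) r :=
      cnt_pos (k := l + N) (by omega) h1 (by rw [W.cyc.per]; exact S.left)
    omega

theorem sec_le {a b : ℤ} (S : Sec G x h a b) : b + 3 ≤ a + N := by
  obtain ⟨r, T⟩ := W.next_sec S.right
  have := W.two_secs S T
  have := T.lt
  omega

theorem clique {b : V} (hb : b ∈ B) {s t : ℤ} (h1 : G.Adj b (h s)) (h2 : G.Adj b (h t))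
    (h3 : G.Adj x (h s)) (h4 : G.Adj x (h t)) (hst : s < t) (htN : t < s + N) :
    t = s + 1 ∨ t = s + N - 1 := by
  rw [← W.cyc.adj s t hst htN]
  exact no_C4 W.cls h3 h1.symm h2 h4.symm (W.far b hb).1.symm (W.cyc.ne s t hst htN) (W.far b hb).2

theorem reroute {D : Set V} (hD : ConnSet G D) (hDB : D ⊆ B) (hoff : ∀ d ∈ D, ∀ i, d ≠ h i)
    {i j : ℤ} (hij : i < j) (hjN : j + 2 ≤ i + N) (hi : ∃ d ∈ D, G.Adj d (h i))
    (hj : ∃ d ∈ D, G.Adj d (h j)) (hno : ∀ k, i < k → k < j → ∀ d ∈ D, ¬ G.Adj d (h k)) :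
    (Even (cnt G x h i j) → 0 < cnt G x h i j → cnt G x h i j = 2 ∧
      ∃ k, i ≤ k ∧ k < j ∧ G.Adj x (h k) ∧ G.Adj x (h (k + 1))) ∧
    (cnt G x h i j < n → cnt G x h i j ≤ 3) := by
  classical
  rcases eq_or_ne j (i + 1) with rfl | hj1
  · have h2 := cnt_split (G := G) (x := x) (h := h) (i := i) (j := i) (l := i + 1)
      (by omega) (by omega)
    by_cases a1 : G.Adj x (h i)
    · by_cases a2 : G.Adj x (h (i + 1))
      · have := cnt_one a1; have := cnt_one a2
        exact ⟨fun _ _ => ⟨by omega, i, by omega, by omega, a1, a2⟩, fun _ => by omega⟩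
      · have := cnt_one a1
        have := cnt_eq_zero (G := G) (x := x) (h := h) (i := i + 1) (j := i + 1)
          fun k h1 h2 => by rwa [le_antisymm h2 h1]
        refine ⟨fun he => ?_, fun _ => by omega⟩
        obtain ⟨c, hc⟩ := he; omega
    · have := cnt_eq_zero (G := G) (x := x) (h := h) (i := i) (j := i)
          fun k h1 h2 => by rwa [le_antisymm h2 h1]
      by_cases a2 : G.Adj x (h (i + 1))
      · have := cnt_one a2
        refine ⟨fun he => ?_, fun _ => by omega⟩
        obtain ⟨c, hc⟩ := he; omega
      · have := cnt_eq_zero (G := G) (x := x) (h := h) (i := i + 1) (j := i + 1)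
          fun k h1 h2 => by rwa [le_antisymm h2 h1]
        exact ⟨fun _ _ => by omega, fun _ => by omega⟩
  · obtain ⟨d, hd, hd'⟩ := hi
    obtain ⟨e, he, he'⟩ := hj
    obtain ⟨X, hX, hP⟩ := ((hD.insert he he'.symm).insert (mem_insert_of_mem _ hd) hd'.symm).exists_path
      (mem_insert (h i) _) (mem_insert_of_mem _ (mem_insert (h j) D))
    have hne := W.cyc.ne i j hij (by omega)
    have hK := close_hole hP (W.cyc.iPath (i := i + 1) (j := j - 1) (by omega) (by omega)) (by
      rintro u hu _ ⟨k, hk, rfl⟩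
      rw [mem_Icc] at hk
      have ek : ∀ t, i < t → t < j → h k = h t → k = t := fun t h1 h2 => W.cyc.inj (by omega) (by omega)
      rcases hX hu with rfl | rfl | hu'
      · refine ⟨W.cyc.ne i k (by omega) (by omega), ?_⟩
        rw [W.cyc.adj i k (by omega) (by omega)]
        constructor
        · intro e; left; refine ⟨rfl, ?_⟩; congr 1; omega
        · rintro (⟨-, e⟩ | ⟨e, -⟩)
          · left; exact ek _ (by omega) (by omega) e
          · exact absurd e hne
      · refine ⟨(W.cyc.ne k j (by omega) (by omega)).symm, ?_⟩
        rw [G.adj_comm, W.cyc.adj k j (by omega) (by omega)]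
        constructor
        · intro e; right; refine ⟨rfl, ?_⟩; congr 1; omega
        · rintro (⟨e, -⟩ | ⟨-, e⟩)
          · exact absurd e.symm hne
          · left; have := ek _ (by omega) (by omega) e; omega
      · refine ⟨hoff u hu' k, ?_⟩
        constructor
        · intro e; exact absurd e (hno k (by omega) (by omega) u hu')
        · rintro (⟨e, -⟩ | ⟨e, -⟩) <;> exact absurd e (hoff u hu' _))
      (Or.inr ⟨hne, by rw [W.cyc.adj i j hij (by omega)]; omega⟩)
    have hKsub : ∀ v ∈ X ∪ h '' Icc (i + 1) (j - 1), v ∈ D ∨ v ∈ h '' Icc i j := by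
      rintro v (hv | ⟨k, hk, rfl⟩)
      · rcases hX hv with rfl | rfl | hv'
        · exact Or.inr ⟨i, ⟨le_rfl, hij.le⟩, rfl⟩
        · exact Or.inr ⟨j, ⟨hij.le, le_rfl⟩, rfl⟩
        · exact Or.inl hv'
      · rw [mem_Icc] at hk; exact Or.inr ⟨k, ⟨by omega, by omega⟩, rfl⟩
    have hnbr : holeNbrs G (X ∪ h '' Icc (i + 1) (j - 1)) x = {v ∈ h '' Icc i j | G.Adj x v} := by
      ext v; constructor
      · rintro ⟨hv, hxv⟩
        exact ⟨(hKsub v hv).resolve_left fun h => (W.far v (hDB h)).2 hxv, hxv⟩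
      · rintro ⟨⟨k, hk, rfl⟩, hxv⟩
        refine ⟨?_, hxv⟩
        rw [mem_Icc] at hk
        rcases eq_or_ne k i with rfl | h1
        · exact Or.inl hP.left_mem
        · rcases eq_or_ne k j with rfl | h2
          · exact Or.inl hP.right_mem
          · exact Or.inr ⟨k, ⟨by omega, by omega⟩, rfl⟩
    have hcard : (holeNbrs G (X ∪ h '' Icc (i + 1) (j - 1)) x).ncard = cnt G x h i j := by
      rw [hnbr]; exact W.cyc.ncard_eq_cnt (by omega)
    have hxK : x ∉ X ∪ h '' Icc (i + 1) (j - 1) := fun hx => by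
      rcases hKsub x hx with h1 | ⟨k, -, e⟩
      · exact (W.far x (hDB h1)).1 rfl
      · exact W.ne k e
    constructor
    · intro hev hpos
      rw [← hcard] at hev hpos ⊢
      obtain ⟨h2, a, ha, b, hb, xa, xb, ab⟩ := hole_parity W.cls hK hxK hev hpos
      refine ⟨h2, ?_⟩
      obtain ⟨s, hs, rfl⟩ := (hKsub a ha).resolve_left fun h => (W.far a (hDB h)).2 xa
      obtain ⟨t, ht, rfl⟩ := (hKsub b hb).resolve_left fun h => (W.far b (hDB h)).2 xb
      rw [mem_Icc] at hs ht
      rcases lt_trichotomy s t with h1 | h1 | h1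
      · have := (W.cyc.adj s t h1 (by omega)).1 ab
        obtain rfl : t = s + 1 := by omega
        exact ⟨s, by omega, by omega, xa, xb⟩
      · rw [h1] at ab; exact absurd rfl ab.ne
      · have := (W.cyc.adj t s h1 (by omega)).1 ab.symm
        obtain rfl : s = t + 1 := by omega
        exact ⟨t, by omega, by omega, xb, xa⟩
    · intro hlt
      by_contra hgt
      rw [← hcard] at hlt hgt
      have := W.min _ hK (fun v hv => ?_) (by omega) hlt
      · omega
      · rcases hKsub v hv with h1 | ⟨k, -, rfl⟩
        · exact Or.inl (hDB h1)
        · exact W.mem k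

end HubWheel

end

theorem no_four_nbrs (hC : MemC G) {K : Set V} {y a b c d : V} (hK : IsHole G K) (hy : y ∉ K)
    (hN : holeNbrs G K y = {a, b, c, d}) (ab : a ≠ b) (ac : a ≠ c) (ad : a ≠ d) (bc : b ≠ c)
    (bd : b ≠ d) (cd : c ≠ d) : False := by
  classical
  have h4 : (holeNbrs G K y).ncard = 4 := by
    have e : ({a, b, c, d} : Set V) = (({a, b, c, d} : Finset V) : Set V) := by simp
    rw [hN, e, Set.ncard_coe_finset, Finset.card_insert_of_notMem, Finset.card_insert_of_notMem,
      Finset.card_insert_of_notMem, Finset.card_singleton] <;> simp [*]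
  exact hC.2.2.2 K y ⟨hK, hy, by omega⟩ (by rw [h4]; decide)

theorem far_insert {p : V} {A X : Set V} (h1 : Far G A X) (h2 : ∀ v ∈ X, p ≠ v ∧ ¬ G.Adj p v) :
    Far G (insert p A) X := by
  rintro a (rfl | ha) b hb
  · exact h2 b hb
  · exact h1 a ha b hb

theorem far_union {A A' X : Set V} (h1 : Far G A X) (h2 : Far G A' X) : Far G (A ∪ A') X := by
  rintro a (ha | ha) b hb
  · exact h1 a ha b hb
  · exact h2 a ha b hb

theorem mem_arc {h : ℤ → V} {i j k : ℤ} (h1 : i ≤ k) (h2 : k ≤ j) : h k ∈ h '' Icc i j :=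
  ⟨k, ⟨h1, h2⟩, rfl⟩

theorem far_arc {h : ℤ → V} {p : V} {i j : ℤ} (hp : ∀ i, p ≠ h i)
    (hno : ∀ k, i ≤ k → k ≤ j → ¬ G.Adj p (h k)) : ∀ v ∈ h '' Icc i j, p ≠ v ∧ ¬ G.Adj p v := by
  rintro _ ⟨k, hk, rfl⟩
  exact ⟨hp k, hno k hk.1 hk.2⟩

namespace HubWheel

variable {x : V} {h : ℤ → V} {N : ℤ} {B : Set V} {n : ℕ} (W : HubWheel G x B h N n)
include W

theorem no_straddle {D : Set V} (hD : ConnSet G D) (hDB : D ⊆ B) (hoff : ∀ d ∈ D, ∀ i, d ≠ h i)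
    {l m r : ℤ} (S : Sec G x h l m) (T : Sec G x h m r)
    (hwin : ∀ i, l ≤ i → i < l + N → ∀ d ∈ D, G.Adj d (h i) → i ≤ r)
    (h1 : ∃ i, l ≤ i ∧ i < m ∧ ∃ d ∈ D, G.Adj d (h i))
    (h2 : ∃ i, m < i ∧ i ≤ r ∧ ∃ d ∈ D, G.Adj d (h i)) : False := by
  obtain ⟨i₁, a1, a2, a3⟩ := h1
  obtain ⟨i₂, b1, b2, b3⟩ := h2
  obtain ⟨u, u1, u2, u3, u4⟩ := exists_least_of_mem (P := fun i => ∃ d ∈ D, G.Adj d (h i))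
    (a := l) (b := i₁) ⟨i₁, a1, le_rfl, a3⟩
  obtain ⟨v, v1, v2, v3, v4⟩ := exists_greatest_of_mem (P := fun i => ∃ d ∈ D, G.Adj d (h i))
    (a := i₂) (b := r) ⟨i₂, le_rfl, b2, b3⟩
  have hr := W.two_secs S T
  have := S.lt
  have := T.lt
  have key := (W.reroute hD hDB hoff (i := v) (j := u + N) (by omega) (by omega) v3
    (by simpa only [W.cyc.per] using u3) (fun k k1 k2 d hd hk => by
      rcases lt_or_ge k (l + N) with hk' | hk'
      · exact v4 k k1 (hwin k (by omega) hk' d hd hk) ⟨d, hd, hk⟩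
      · refine u4 (k - N) (by omega) (by omega) ⟨d, hd, ?_⟩
        rwa [← W.per_adj, sub_add_cancel])).1
  have e1 := cnt_split (G := G) (x := x) (h := h) (i := u) (j := v - 1) (l := u + N - 1)
    (by omega) (by omega)
  have e2 := cnt_split (G := G) (x := x) (h := h) (i := v) (j := u + N - 1) (l := u + N)
    (by omega) (by omega)
  have e3 := cnt_split (G := G) (x := x) (h := h) (i := u) (j := u) (l := v - 1)
    (by omega) (by omega)
  have e4 := cnt_split (G := G) (x := x) (h := h) (i := u + 1) (j := m - 1) (l := v - 1)
    (by omega) (by omega)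
  have e5 := cnt_split (G := G) (x := x) (h := h) (i := m) (j := m) (l := v - 1)
    (by omega) (by omega)
  have z1 := cnt_eq_zero (G := G) (x := x) (h := h) (i := u + 1) (j := m - 1)
    fun k h1 h2 => S.mid k (by omega) (by omega)
  have z2 := cnt_eq_zero (G := G) (x := x) (h := h) (i := m + 1) (j := v - 1)
    fun k h1 h2 => T.mid k (by omega) (by omega)
  have o := cnt_one S.right
  have p1 := W.cyc.cnt_per (x := x) (G := G) u u
  have hc := W.card u
  rw [sub_add_cancel] at e1 e2 e4
  have h3 := W.three
  have hcnt : cnt G x h v (u + N) = n - 1 := by omega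
  obtain ⟨q, hq⟩ := W.odd
  obtain ⟨k1, t, -, -, k4, k5⟩ := key ⟨q, by omega⟩ (by omega)
  exact W.stable (by omega) t k4 k5

theorem pair {a b : ℤ} (S : Sec G x h a b) {q : V} (hq : ∀ i, q ≠ h i) (hqx : q ≠ x)
    (hqx' : ¬ G.Adj q x) {E : Set V} (hE : ConnSet G E) (hfar : Far G E (h '' Icc a b))
    (hx : ∃ e ∈ E, G.Adj x e) (hqe : ∃ e ∈ E, G.Adj q e)
    {u u' : ℤ} (hu : a ≤ u) (huu : u ≤ u') (hu' : u' ≤ b) (huq : G.Adj q (h u)) (hu'q : G.Adj q (h u'))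
    (hext : ∀ k, a ≤ k → k ≤ b → G.Adj q (h k) → u ≤ k ∧ k ≤ u') :
    u' ≤ u + 1 ∧ (u = u' → u = a ∨ u = b) := by
  have hb := W.sec_le S
  constructor
  · by_contra hn
    exact theta_of_sets W.cls hqx.symm (fun e => hqx' e.symm) (W.cyc.conn hu) (W.cyc.conn hu') hE
      ⟨h a, mem_arc le_rfl hu, S.left⟩ ⟨h b, mem_arc hu' le_rfl, S.right⟩ hx
      ⟨h u, mem_arc hu le_rfl, huq⟩ ⟨h u', mem_arc le_rfl hu', hu'q⟩ hqe
      (W.cyc.far (by omega) (by omega))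
      (fun v hv w hw => hfar.symm v (by
        obtain ⟨k, hk, rfl⟩ := hv; exact mem_arc hk.1 (by have := hk.2; omega)) w hw)
      (fun v hv w hw => hfar.symm v (by
        obtain ⟨k, hk, rfl⟩ := hv; exact mem_arc (by have := hk.1; omega) hk.2) w hw)
  · rintro rfl
    by_contra hn
    push Not at hn
    refine theta_of_sets W.cls (W.ne u).symm (S.mid u (by omega) (by omega))
      (W.cyc.conn (i := a) (j := u - 1) (by omega)) (W.cyc.conn (i := u + 1) (j := b) (by omega))
      (hE.insert hqe.choose_spec.1 hqe.choose_spec.2)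
      ⟨h a, mem_arc le_rfl (by omega), S.left⟩ ⟨h b, mem_arc (by omega) le_rfl, S.right⟩
      (hx.imp fun e he => ⟨mem_insert_of_mem _ he.1, he.2⟩)
      ⟨h (u - 1), mem_arc (by omega) le_rfl, W.cyc.adj_pred u⟩
      ⟨h (u + 1), mem_arc le_rfl (by omega), W.cyc.adj_succ u⟩ ⟨q, mem_insert _ _, huq.symm⟩
      (W.cyc.far (by omega) (by omega)) (Far.symm (far_insert ?_ ?_)) (Far.symm (far_insert ?_ ?_))
    · rintro e he _ ⟨k, hk, rfl⟩
      exact hfar e he _ (mem_arc hk.1 (by have := hk.2; omega))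
    · exact far_arc hq fun k k1 k2 hk => by have := hext k k1 (by omega) hk; omega
    · rintro e he _ ⟨k, hk, rfl⟩
      exact hfar e he _ (mem_arc (by have := hk.1; omega) hk.2)
    · exact far_arc hq fun k k1 k2 hk => by have := hext k (by omega) k2 hk; omega

theorem no_triple {l m r : ℤ} (S : Sec G x h l m) (T : Sec G x h m r) {p : V} (hp : p ∈ B)
    (hoff : ∀ i, p ≠ h i)
    (hadj : ∀ k, l ≤ k → k ≤ r → (G.Adj p (h k) ↔ k = m - 1 ∨ k = m ∨ k = m + 1)) : False := by
  have hr := W.two_secs S T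
  have hl := S.lt
  have ht := T.lt
  have a1 := (hadj (m - 1) (by omega) (by omega)).2 (by omega)
  have a3 := (hadj (m + 1) (by omega) (by omega)).2 (by omega)
  have a2 := (hadj m (by omega) (by omega)).2 (by omega)
  have P1 := (W.cyc.iPath (i := l) (j := m - 1) (by omega) (by omega)).glue (IPath.single p) a1.symm (by
    rintro _ ⟨k, hk, rfl⟩ w hw
    rw [mem_singleton_iff.1 hw]
    rw [mem_Icc] at hk
    refine ⟨(hoff k).symm, fun e => ⟨?_, rfl⟩⟩
    have := (hadj k (by omega) (by omega)).1 e.symm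
    congr 1; omega)
  have P2 := P1.glue (W.cyc.iPath (i := m + 1) (j := r) (by omega) (by omega)) a3 (by
    rintro u (⟨k, hk, rfl⟩ | hu) _ ⟨t, ht, rfl⟩
    · rw [mem_Icc] at hk ht
      refine ⟨W.cyc.ne k t (by omega) (by omega), fun e => ?_⟩
      have := (W.cyc.adj k t (by omega) (by omega)).1 e
      omega
    · rw [mem_singleton_iff.1 hu]
      rw [mem_Icc] at ht
      refine ⟨hoff t, fun e => ⟨rfl, ?_⟩⟩
      have := (hadj t (by omega) (by omega)).1 e
      congr 1; omega)
  have key : ∀ k, l ≤ k → k ≤ r → k ≠ m → (G.Adj x (h k) ↔ h k = h l ∨ h k = h r) := by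
    intro k k1 k2 k3
    constructor
    · intro e
      rcases lt_or_gt_of_ne k3 with h1 | h1
      · left; congr 1; by_contra hn; exact S.mid k (by omega) h1 e
      · right; congr 1; by_contra hn; exact T.mid k h1 (by omega) e
    · rintro (e | e) <;> rw [e]
      · exact S.left
      · exact T.right
  have hK := close_hole P2 (IPath.single x) (by
    rintro u hu w hw
    rw [mem_singleton_iff.1 hw]
    rcases hu with (⟨k, hk, rfl⟩ | hu) | ⟨k, hk, rfl⟩
    · rw [mem_Icc] at hk
      refine ⟨W.ne k, ?_⟩
      rw [G.adj_comm, key k (by omega) (by omega) (by omega)]; simp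
    · rw [mem_singleton_iff.1 hu]
      refine ⟨(W.far p hp).1, ?_⟩
      constructor
      · intro e; exact absurd e.symm (W.far p hp).2
      · rintro (⟨e, -⟩ | ⟨e, -⟩) <;> exact absurd e (hoff _)
    · rw [mem_Icc] at hk
      refine ⟨W.ne k, ?_⟩
      rw [G.adj_comm, key k (by omega) (by omega) (by omega)]; simp)
    (Or.inr ⟨W.cyc.ne l r (by omega) (by omega), by
      rw [W.cyc.adj l r (by omega) (by omega)]; omega⟩)
  have hm : ∀ k, l ≤ k → k ≤ r → k ≠ m → h m ≠ h k ∧ (G.Adj (h m) (h k) → k = m - 1 ∨ k = m + 1) := by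
    intro k k1 k2 k3
    rcases lt_or_gt_of_ne k3 with h1 | h1
    · refine ⟨(W.cyc.ne k m h1 (by omega)).symm, fun e => ?_⟩
      have := (W.cyc.adj k m h1 (by omega)).1 e.symm
      omega
    · refine ⟨W.cyc.ne m k h1 (by omega), fun e => ?_⟩
      have := (W.cyc.adj m k h1 (by omega)).1 e
      omega
  refine no_four_nbrs W.cls hK (y := h m) (a := x) (b := h (m - 1)) (c := p) (d := h (m + 1))
    ?_ ?_ (W.ne _).symm (W.far p hp).1.symm (W.ne _).symm (hoff _).symm
    (W.cyc.ne _ _ (by omega) (by omega)) (hoff _)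
  · rintro (((⟨k, hk, e⟩ | e) | ⟨k, hk, e⟩) | e)
    · rw [mem_Icc] at hk; exact (hm k (by omega) (by omega) (by omega)).1 e.symm
    · exact hoff m (mem_singleton_iff.1 e).symm
    · rw [mem_Icc] at hk; exact (hm k (by omega) (by omega) (by omega)).1 e.symm
    · exact W.ne m e
  · ext v
    simp only [mem_insert_iff, mem_singleton_iff]
    constructor
    · rintro ⟨((⟨k, hk, rfl⟩ | e) | ⟨k, hk, rfl⟩) | e, ha⟩
      · rw [mem_Icc] at hk
        have := (hm k (by omega) (by omega) (by omega)).2 ha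
        right; left; congr 1; omega
      · right; right; left; exact e
      · rw [mem_Icc] at hk
        have := (hm k (by omega) (by omega) (by omega)).2 ha
        right; right; right; congr 1; omega
      · exact Or.inl e
    · rintro (rfl | rfl | rfl | rfl)
      · exact ⟨Or.inr rfl, S.right.symm⟩
      · exact ⟨Or.inl (Or.inl (Or.inl (mem_arc (by omega) le_rfl))), W.cyc.adj_pred m⟩
      · exact ⟨Or.inl (Or.inl (Or.inr rfl)), a2.symm⟩
      · exact ⟨Or.inl (Or.inr (mem_arc le_rfl (by omega))), W.cyc.adj_succ m⟩

theorem junction {l m r : ℤ} (S : Sec G x h l m) (T : Sec G x h m r) {p : V}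
    (hoff : ∀ i, p ≠ h i) {k v : ℤ} (hv : m < v) (hv' : v ≤ r) (hpv : G.Adj p (h v))
    (hk : k + 1 = m) (hpk : G.Adj p (h k)) (hl : l < k)
    (hno : ∀ t, l ≤ t → t < k → ¬ G.Adj p (h t)) : G.Adj p (h m) := by
  by_contra hpm
  have hr := W.two_secs S T
  obtain rfl : k = m - 1 := by omega
  obtain ⟨v', v1, v2, v3, v4⟩ := exists_greatest_of_mem (P := fun i => G.Adj p (h i))
    (a := v) (b := r) ⟨v, le_rfl, hv', hpv⟩
  rcases eq_or_ne v' (m + 1) with rfl | hne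
  · have e := no_C4 W.cls hpk (W.cyc.adj_pred m).symm (W.cyc.adj_succ m) v3.symm (hoff m)
      (W.cyc.ne (m - 1) (m + 1) (by omega) (by omega)) hpm
    rw [W.cyc.adj _ _ (by omega) (by omega)] at e
    omega
  · refine theta_of_sets W.cls (W.ne (m - 1)).symm (S.mid _ hl (by omega))
      (W.cyc.conn (i := l) (j := m - 1 - 1) (by omega)) (W.cyc.conn (le_refl m))
      ((W.cyc.conn (i := v') (j := r) v2).insert (mem_arc le_rfl v2) v3)
      ⟨h l, mem_arc le_rfl (by omega), S.left⟩ ⟨h m, mem_arc le_rfl le_rfl, S.right⟩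
      ⟨h r, mem_insert_of_mem _ (mem_arc v2 le_rfl), T.right⟩
      ⟨h (m - 1 - 1), mem_arc (by omega) le_rfl, W.cyc.adj_pred _⟩
      ⟨h m, mem_arc le_rfl le_rfl, (W.cyc.adj_pred m).symm⟩ ⟨p, mem_insert _ _, hpk.symm⟩
      (W.cyc.far (by omega) (by omega)) (Far.symm (far_insert (W.cyc.far (by omega) (by omega)).symm ?_))
      (Far.symm (far_insert (W.cyc.far (by omega) (by omega)).symm ?_))
    · exact far_arc hoff fun t t1 t2 => hno t t1 (by omega)
    · exact far_arc hoff fun t t1 t2 => by rwa [le_antisymm t2 t1]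

theorem junction' {l m r : ℤ} (S : Sec G x h l m) (T : Sec G x h m r) {p : V}
    (hoff : ∀ i, p ≠ h i) {k v : ℤ} (hv : v < m) (hv' : l ≤ v) (hpv : G.Adj p (h v))
    (hk : k = m + 1) (hpk : G.Adj p (h k)) (hr : k < r)
    (hno : ∀ t, k < t → t ≤ r → ¬ G.Adj p (h t)) : G.Adj p (h m) := by
  have := W.reflect.junction T.reflect S.reflect (fun i => hoff _) (k := -k) (v := -v)
    (by omega) (by omega) (by simpa using hpv) (by omega) (by simpa using hpk) (by omega)
    (fun t t1 t2 => hno (-t) (by omega) (by omega))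
  simpa using this

theorem no_three_arcs {p : V} (hp : p ∈ B) {l₁ r₁ l₂ r₂ l₃ r₃ : ℤ}
    (e₁ : l₁ ≤ r₁) (e₂ : l₂ ≤ r₂) (e₃ : l₃ ≤ r₃) (h₁₂ : r₁ + 2 ≤ l₂) (h₂₃ : r₂ + 2 ≤ l₃)
    (h₃₁ : r₃ + 2 ≤ l₁ + N)
    (x₁ : ∃ k, l₁ ≤ k ∧ k ≤ r₁ ∧ G.Adj x (h k)) (x₂ : ∃ k, l₂ ≤ k ∧ k ≤ r₂ ∧ G.Adj x (h k))
    (x₃ : ∃ k, l₃ ≤ k ∧ k ≤ r₃ ∧ G.Adj x (h k))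
    (p₁ : ∃ k, l₁ ≤ k ∧ k ≤ r₁ ∧ G.Adj p (h k)) (p₂ : ∃ k, l₂ ≤ k ∧ k ≤ r₂ ∧ G.Adj p (h k))
    (p₃ : ∃ k, l₃ ≤ k ∧ k ≤ r₃ ∧ G.Adj p (h k)) : False := by
  have cv : ∀ {y : V} {l r : ℤ}, (∃ k, l ≤ k ∧ k ≤ r ∧ G.Adj y (h k)) →
      ∃ a ∈ h '' Icc l r, G.Adj y a := fun ⟨k, k1, k2, k3⟩ => ⟨h k, mem_arc k1 k2, k3⟩
  exact theta_of_sets W.cls (W.far p hp).1.symm (W.far p hp).2 (W.cyc.conn e₁) (W.cyc.conn e₂)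
    (W.cyc.conn e₃) (cv x₁) (cv x₂) (cv x₃) (cv p₁) (cv p₂) (cv p₃) (W.cyc.far h₁₂ (by omega))
    (W.cyc.far (by omega) (by omega)) (W.cyc.far h₂₃ (by omega))

end HubWheel

/-- The five sectors of a wheel with five spokes. -/
structure Five (G : SimpleGraph V) (x : V) (h : ℤ → V) (N e₀ e₁ e₂ e₃ e₄ : ℤ) : Prop where
  s₀ : Sec G x h e₀ e₁
  s₁ : Sec G x h e₁ e₂
  s₂ : Sec G x h e₂ e₃
  s₃ : Sec G x h e₃ e₄
  s₄ : Sec G x h e₄ (e₀ + N)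

/-- An induced path off the rim of a wheel. -/
structure OffPath (G : SimpleGraph V) (B : Set V) (h : ℤ → V) (p : ℕ → V) (k : ℕ) : Prop where
  path : PathOn G p k
  inB : ∀ t ≤ k, p t ∈ B
  off : ∀ t ≤ k, ∀ i, p t ≠ h i

/-- A path from a rim edge of the sector `[e₂, e₃]` to the opposite spoke `e₀`. -/
structure StarPath (G : SimpleGraph V) (x : V) (B : Set V) (h : ℤ → V) (N : ℤ) (p : ℕ → V) (k : ℕ)
    (e₀ e₁ e₂ e₃ e₄ u : ℤ) : Prop where
  five : Five G x h N e₀ e₁ e₂ e₃ e₄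
  path : OffPath G B h p k
  le : e₂ ≤ u
  lt : u + 1 ≤ e₃
  adj : ∀ t ≤ k, ∀ i, e₀ ≤ i → i < e₀ + N →
    (G.Adj (p t) (h i) ↔ (t = 0 ∧ (i = u ∨ i = u + 1)) ∨ (t = k ∧ i = e₀))

/-- A path whose rim neighbours lie in two disjoint sectors, one for each end. -/
structure TwoSec (G : SimpleGraph V) (x : V) (B : Set V) (h : ℤ → V) (N : ℤ) (p : ℕ → V) (k : ℕ)
    (a b c d u u' v v' : ℤ) : Prop where
  path : OffPath G B h p k
  S : Sec G x h a b
  T : Sec G x h c d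
  bc : b < c
  dN : d < a + N
  au : a ≤ u
  uu : u ≤ u'
  ub : u' ≤ b
  cv : c ≤ v
  vv : v ≤ v'
  vd : v' ≤ d
  hu : G.Adj (p 0) (h u)
  hu' : G.Adj (p 0) (h u')
  hv : G.Adj (p k) (h v)
  hv' : G.Adj (p k) (h v')
  hit : ∀ t ≤ k, ∀ i, a ≤ i → i < a + N → G.Adj (p t) (h i) →
    (t = 0 ∧ u ≤ i ∧ i ≤ u') ∨ (t = k ∧ v ≤ i ∧ i ≤ v')

theorem OffPath.conn {B : Set V} {h : ℤ → V} {p : ℕ → V} {k : ℕ} (P : OffPath G B h p k) {i j : ℕ}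
    (hij : i ≤ j) (hj : j ≤ k) : ConnSet G (p '' Icc i j) := (P.path.iPath hij hj).connSet

theorem OffPath.reverse {B : Set V} {h : ℤ → V} {p : ℕ → V} {k : ℕ} (P : OffPath G B h p k) :
    OffPath G B h (fun t => p (k - t)) k :=
  ⟨P.path.reverse, fun _ _ => P.inB _ (Nat.sub_le _ _), fun _ _ => P.off _ (Nat.sub_le _ _)⟩

theorem image_reverse (p : ℕ → V) (k : ℕ) : (fun t => p (k - t)) '' Iic k = p '' Iic k := by
  ext v
  simp only [mem_image, mem_Iic]
  constructor
  · rintro ⟨i, hi, rfl⟩; exact ⟨k - i, by omega, rfl⟩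
  · rintro ⟨i, hi, rfl⟩; exact ⟨k - i, by omega, by congr 1; omega⟩

section

variable {x : V} {h : ℤ → V} {N : ℤ} {B : Set V} {n : ℕ}

/-- If an interval contains exactly two spokes `i < j` and these are consecutive somewhere, then
`j = i + 1`. -/
theorem two_adjacent {l r i j k : ℤ} (hc : cnt G x h l r = 2) (hi : G.Adj x (h i))
    (hj : G.Adj x (h j)) (hij : i < j) (hl : l ≤ i) (hr : j ≤ r) (h1 : l ≤ k) (h2 : k < r)
    (hk : G.Adj x (h k)) (hk' : G.Adj x (h (k + 1))) : j = i + 1 := by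
  have key : ∀ t, l ≤ t → t ≤ r → G.Adj x (h t) → t = i ∨ t = j := by
    intro t t1 t2 t3
    by_contra hne
    push Not at hne
    classical
    have : ({i, j, t} : Finset ℤ).card ≤ cnt G x h l r := by
      unfold cnt
      refine Finset.card_le_card ?_
      intro s hs
      simp only [Finset.mem_insert, Finset.mem_singleton] at hs
      simp only [Finset.mem_filter, Finset.mem_Icc]
      rcases hs with rfl | rfl | rfl
      · exact ⟨by omega, hi⟩
      · exact ⟨by omega, hj⟩
      · exact ⟨by omega, t3⟩
    rw [Finset.card_insert_of_notMem, Finset.card_insert_of_notMem, Finset.card_singleton] at this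
    · omega
    · simp [Ne.symm hne.2]
    · simp [Ne.symm hne.1, hij.ne]
  have := key k h1 h2.le hk
  have := key (k + 1) (by omega) (by omega) hk'
  omega

theorem Sec.cnt_tail {a b u u' : ℤ} (S : Sec G x h a b) (h1 : a ≤ u) (h2 : u ≤ u') (h3 : u' ≤ b) :
    _root_.cnt G x h u' u' =
      _root_.cnt G x h (u + 1) u' + if u = u' then _root_.cnt G x h u u else 0 := by
  rcases eq_or_lt_of_le h2 with rfl | hlt
  · have : _root_.cnt G x h (u + 1) u = 0 := cnt_eq_zero fun k _ _ => by omega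
    simp [this]
  · have e1 := cnt_split (G := G) (x := x) (h := h) (i := u + 1) (j := u' - 1) (l := u')
      (by omega) (by omega)
    rw [sub_add_cancel] at e1
    have := cnt_eq_zero (G := G) (x := x) (h := h) (i := u + 1) (j := u' - 1)
      fun k _ _ => S.mid k (by omega) (by omega)
    rw [if_neg hlt.ne]; omega

theorem cnt_self (i : ℤ) : (G.Adj x (h i) ∧ cnt G x h i i = 1) ∨
    (¬ G.Adj x (h i) ∧ cnt G x h i i = 0) := by
  by_cases hi : G.Adj x (h i)
  · exact Or.inl ⟨hi, cnt_one hi⟩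
  · exact Or.inr ⟨hi, cnt_eq_zero fun k h1 h2 => by rwa [le_antisymm h2 h1]⟩

namespace TwoSec

variable {p : ℕ → V} {k : ℕ} {a b c d u u' v v' : ℤ}

theorem route_lt (Q : TwoSec G x B h N p k a b c d u u' v v')
    (hns : ¬ (u = u' ∧ v = v' ∧ G.Adj x (h u) ∧ G.Adj x (h v) ∧ (v = u + 1 ∨ v = u + N - 1))) :
    v + 2 ≤ u' + N := by
  obtain ⟨-, S, T, bc, dN, au, uu, ub, cv, vv, vd, -, -, -, -, -⟩ := Q
  by_contra hn
  obtain rfl : u' = a := by omega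
  obtain rfl : u = u' := by omega
  obtain rfl : v = d := by omega
  exact hns ⟨rfl, by omega, S.left, T.right, by omega⟩

variable (W : HubWheel G x B h N n)
include W

theorem swap (Q : TwoSec G x B h N p k a b c d u u' v v') :
    TwoSec G x B h N (fun t => p (k - t)) k c d (a + N) (b + N) v v' (u + N) (u' + N) where
  path := Q.path.reverse
  S := Q.T
  T := Q.S.next W.cyc
  bc := Q.dN
  dN := by have := Q.bc; omega
  au := Q.cv
  uu := Q.vv
  ub := Q.vd
  cv := by have := Q.au; omega
  vv := by have := Q.uu; omega
  vd := by have := Q.ub; omega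
  hu := Q.hv
  hu' := Q.hv'
  hv := by rw [W.per_adj]; simpa using Q.hu
  hv' := by rw [W.per_adj]; simpa using Q.hu'
  hit t ht i h1 h2 h3 := by
    have := Q.S.lt
    have := Q.T.lt
    have := Q.bc
    have := Q.uu
    have := Q.vv
    have := Q.cv
    have := Q.ub
    have := Q.au
    have := Q.vd
    have := Q.dN
    rcases lt_or_ge i (a + N) with h4 | h4
    · have := Q.hit (k - t) (Nat.sub_le _ _) i (by omega) h4 h3
      omega
    · have := Q.hit (k - t) (Nat.sub_le _ _) (i - N) (by omega) (by omega)
        (by rwa [← W.per_adj, sub_add_cancel])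
      omega

theorem sum (Q : TwoSec G x B h N p k a b c d u u' v v') :
    cnt G x h u' v + cnt G x h v' (u + N) = n + (if u = u' then cnt G x h u u else 0) +
      (if v = v' then cnt G x h v v else 0) := by
  have t1 := Q.S.cnt_tail Q.au Q.uu Q.ub
  have t2 := Q.T.cnt_tail Q.cv Q.vv Q.vd
  obtain ⟨-, -, -, bc, dN, au, uu, ub, cv, vv, vd, -, -, -, -, -⟩ := Q
  have hc := W.card u'
  have e1 := cnt_split (G := G) (x := x) (h := h) (i := u') (j := u' + N - 1) (l := u' + N)
    (by have := W.cyc.four; omega) (by omega)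
  have e2 := cnt_split (G := G) (x := x) (h := h) (i := u') (j := v) (l := u' + N)
    (by omega) (by omega)
  have e3 := cnt_split (G := G) (x := x) (h := h) (i := v + 1) (j := v') (l := u' + N)
    (by omega) (by omega)
  have e4 := cnt_split (G := G) (x := x) (h := h) (i := v' + 1) (j := u + N) (l := u' + N)
    (by omega) (by omega)
  have e5 := cnt_split (G := G) (x := x) (h := h) (i := v') (j := v') (l := u + N)
    (by omega) (by omega)
  have p1 := W.cyc.cnt_per (x := x) (G := G) u' u'
  have p2 := W.cyc.cnt_per (x := x) (G := G) (u + 1) u'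
  rw [sub_add_cancel] at e1
  rw [add_right_comm] at p2
  omega

theorem five_le (Q : TwoSec G x B h N p k a b c d u u' v v') : 5 ≤ n := by
  have hc := W.card a
  have e1 := cnt_split (G := G) (x := x) (h := h) (i := a) (j := b) (l := a + N - 1)
    (by have := Q.S.lt; omega) (by have := Q.bc; have := Q.dN; have := Q.T.lt; omega)
  have : cnt G x h c d ≤ cnt G x h (b + 1) (a + N - 1) :=
    cnt_mono (by have := Q.bc; omega) (by have := Q.dN; omega)
  rw [Q.S.cnt] at e1
  rw [Q.T.cnt] at this
  obtain ⟨q, hq⟩ := W.odd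
  omega

theorem route (Q : TwoSec G x B h N p k a b c d u u' v v') (hlt : v + 2 ≤ u' + N) :
    (Even (cnt G x h u' v) → 0 < cnt G x h u' v → cnt G x h u' v = 2 ∧
      ∃ k, u' ≤ k ∧ k < v ∧ G.Adj x (h k) ∧ G.Adj x (h (k + 1))) ∧
    (cnt G x h u' v < n → cnt G x h u' v ≤ 3) := by
  have := Q.au
  have := Q.uu
  have := Q.ub
  have := Q.bc
  have := Q.cv
  have := Q.vv
  have := Q.vd
  have := Q.dN
  refine W.reroute (D := p '' Icc 0 k) (Q.path.conn (Nat.zero_le _) le_rfl) ?_ ?_ (by omega) hlt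
    ⟨p 0, ⟨0, by simp, rfl⟩, Q.hu'⟩ ⟨p k, ⟨k, by simp, rfl⟩, Q.hv⟩ ?_
  · rintro _ ⟨t, ht, rfl⟩; exact Q.path.inB t ht.2
  · rintro _ ⟨t, ht, rfl⟩; exact Q.path.off t ht.2
  · rintro i h1 h2 _ ⟨t, ht, rfl⟩ h3
    have := Q.hit t ht.2 i (by omega) (by omega) h3
    omega

theorem both_single (Q : TwoSec G x B h N p k a b c d u u v v) (hu : G.Adj x (h u))
    (hv : G.Adj x (h v)) : v = u + 1 ∨ v = u + N - 1 := by
  by_contra hns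
  have r1 := (Q.route W (Q.route_lt (by tauto))).1
  have r2 := ((Q.swap W).route W ((Q.swap W).route_lt (by
    rintro ⟨-, -, -, -, e⟩; omega))).1
  have s := Q.sum W
  rw [if_pos rfl, if_pos rfl, cnt_one hu, cnt_one hv] at s
  have huv : u < v := by have := Q.ub; have := Q.bc; have := Q.cv; omega
  have hvu : v < u + N := by have := Q.vd; have := Q.dN; have := Q.au; omega
  have hu2 : G.Adj x (h (u + N)) := by rwa [W.per_adj]
  rcases Nat.even_or_odd (cnt G x h u v) with he | he
  · obtain ⟨c2, t, t1, t2, t3, t4⟩ := r1 he (cnt_pos le_rfl huv.le hu)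
    have := two_adjacent c2 hu hv huv le_rfl le_rfl t1 t2 t3 t4
    omega
  · have : Even (cnt G x h v (u + N)) := by
      obtain ⟨y, hy⟩ := he
      obtain ⟨z, hz⟩ := W.odd
      exact ⟨z + 1 - y, by omega⟩
    obtain ⟨c2, t, t1, t2, t3, t4⟩ := r2 this (cnt_pos le_rfl hvu.le hv)
    have := two_adjacent c2 hv hu2 hvu le_rfl le_rfl t1 t2 t3 t4
    omega

end TwoSec

end

section

variable {x : V} {h : ℤ → V} {N : ℤ} {B : Set V} {n : ℕ}

theorem Cyc.eq_iff (C : Cyc G h N) {i j : ℤ} (h1 : j < i + N) (h2 : i < j + N) :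
    h i = h j ↔ i = j :=
  ⟨C.inj h1 h2, fun e => by rw [e]⟩

theorem OffPath.eq_iff {p : ℕ → V} {k : ℕ} (P : OffPath G B h p k) {s t : ℕ} (hs : s ≤ k)
    (ht : t ≤ k) : p s = p t ↔ s = t :=
  ⟨P.path.inj hs ht, fun e => by rw [e]⟩

/-- Two complementary arcs, joined by the rim edges at both ends. -/
theorem Cyc.arcs_adj (C : Cyc G h N) {i j k l : ℤ} (hij : i ≤ j) (hk : k = j + 1) (hkl : k ≤ l)
    (hl : l + 1 = i + N) : ∀ u ∈ h '' Icc i j, ∀ w ∈ h '' Icc k l,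
    u ≠ w ∧ (G.Adj u w ↔ (u = h i ∧ w = h l) ∨ (u = h j ∧ w = h k)) := by
  rintro _ ⟨s, ⟨hs, hs'⟩, rfl⟩ _ ⟨t, ⟨ht, ht'⟩, rfl⟩
  refine ⟨C.ne s t (by omega) (by omega), ?_⟩
  rw [C.adj s t (by omega) (by omega), C.eq_iff (by omega) (by omega),
    C.eq_iff (by omega) (by omega), C.eq_iff (by omega) (by omega), C.eq_iff (by omega) (by omega)]
  omega

theorem HubWheel.split_three (W : HubWheel G x B h N n) {i j : ℤ} (hi : G.Adj x (h i))
    (hj : G.Adj x (h j)) (hij : i < j) (hc : cnt G x h i j = 3) :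
    ∃ m, Sec G x h i m ∧ Sec G x h m j := by
  obtain ⟨m, S⟩ := W.next_sec hi
  obtain ⟨r, T⟩ := W.next_sec S.right
  have e := cnt_join S.lt.le T.lt.le S.right
  rw [S.cnt, T.cnt] at e
  have s1 := S.lt
  have s2 := T.lt
  have h1 : m ≤ j := by
    by_contra hn
    exact S.mid j hij (by omega) hj
  have h2 : r ≤ j := by
    by_contra hn
    rcases eq_or_lt_of_le h1 with rfl | h3
    · rw [S.cnt] at hc; omega
    · exact T.mid j h3 (by omega) hj
  have h3 : r = j := by
    by_contra hn
    have := cnt_split (G := G) (x := x) (h := h) (i := i) (j := r) (l := j) (by omega) h2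
    have := cnt_pos (G := G) (x := x) (h := h) (i := r + 1) (j := j) (k := j) (by omega) le_rfl hj
    omega
  subst h3
  exact ⟨m, S, T⟩

/-- A path off the rim cannot attach exactly at two disjoint rim edges, one for each end. -/
theorem HubWheel.no_two_edges (W : HubWheel G x B h N n) {p : ℕ → V} {k : ℕ}
    (P : OffPath G B h p k) (hk : 0 < k) {u v : ℤ} (h1 : u + 1 < v) (h2 : v + 1 < u + N)
    (adj : ∀ t ≤ k, ∀ i, u ≤ i → i < u + N → (G.Adj (p t) (h i) ↔
      (t = 0 ∧ (i = u ∨ i = u + 1)) ∨ (t = k ∧ (i = v ∨ i = v + 1)))) : False := by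
  have h₁₂ := W.cyc.arcs_adj (i := u + 1) (j := v) (k := v + 1) (l := u + N) (by omega) rfl
    (by omega) (by omega)
  have h₁₃ : ∀ s ∈ h '' Icc (v + 1) (u + N), ∀ w ∈ p '' Icc 0 k, s ≠ w ∧
      (G.Adj s w ↔ (s = h (v + 1) ∧ w = p k) ∨ (s = h (u + N) ∧ w = p 0)) := by
    rintro _ ⟨i, ⟨i1, i2⟩, rfl⟩ _ ⟨t, ⟨-, ht⟩, rfl⟩
    refine ⟨(P.off t ht i).symm, ?_⟩
    rw [G.adj_comm, P.eq_iff ht le_rfl, P.eq_iff ht (Nat.zero_le _),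
      W.cyc.eq_iff (by omega) (by omega), W.cyc.eq_iff (by omega) (by omega)]
    rcases lt_or_ge i (u + N) with i3 | i3
    · rw [adj t ht i (by omega) i3]; omega
    · rw [← sub_add_cancel i N, W.per_adj, adj t ht (i - N) (by omega) (by omega)]; omega
  have h₂₃ : ∀ s ∈ h '' Icc (u + 1) v, ∀ w ∈ p '' Icc 0 k, s ≠ w ∧
      (G.Adj s w ↔ (s = h v ∧ w = p k) ∨ (s = h (u + 1) ∧ w = p 0)) := by
    rintro _ ⟨i, ⟨i1, i2⟩, rfl⟩ _ ⟨t, ⟨-, ht⟩, rfl⟩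
    refine ⟨(P.off t ht i).symm, ?_⟩
    rw [G.adj_comm, P.eq_iff ht le_rfl, P.eq_iff ht (Nat.zero_le _),
      W.cyc.eq_iff (by omega) (by omega), W.cyc.eq_iff (by omega) (by omega),
      adj t ht i (by omega) (by omega)]
    omega
  refine prism_of_sets W.cls (W.cyc.conn (by omega)) (W.cyc.conn (by omega))
    (P.conn (Nat.zero_le _) le_rfl) (mem_arc le_rfl (by omega)) (mem_arc (by omega) le_rfl)
    ⟨k, by simp, rfl⟩ (mem_arc (by omega) le_rfl) (mem_arc le_rfl (by omega)) ⟨0, by simp, rfl⟩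
    (W.cyc.ne _ _ (by omega) (by omega)) (W.cyc.ne _ _ (by omega) (by omega)).symm
    (fun e => by have := P.path.inj le_rfl (Nat.zero_le _) e; omega) ?_ h₁₃ h₂₃
  intro s hs w hw
  have := h₁₂ w hw s hs
  rw [G.adj_comm]
  exact ⟨this.1.symm, this.2.trans (by tauto)⟩

namespace TwoSec

variable {p : ℕ → V} {k : ℕ} {a b c d u u' v v' : ℤ} (W : HubWheel G x B h N n)
include W

theorem pair (Q : TwoSec G x B h N p k a b c d u u' v v') {l r w : ℤ} (hl : b + 2 ≤ l)
    (hr : r + 2 ≤ a + N) (hlw : l ≤ w) (hwr : w ≤ r) (hw : G.Adj (p k) (h w))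
    (hα : ∃ i, l ≤ i ∧ i ≤ r ∧ G.Adj x (h i)) : u' ≤ u + 1 ∧ (u = u' → u = a ∨ u = b) := by
  have e1 := Q.bc
  have e2 := Q.cv
  have e3 := Q.vd
  have e4 := Q.S.lt
  have fA : Far G (h '' Icc l r) (h '' Icc a b) := (W.cyc.far hl hr).symm
  have key : ∃ E : Set V, ConnSet G E ∧ Far G E (h '' Icc a b) ∧ h '' Icc l r ⊆ E ∧
      ∃ e ∈ E, G.Adj (p 0) e := by
    rcases Nat.eq_zero_or_pos k with rfl | hk
    · exact ⟨_, W.cyc.conn (hlw.trans hwr), fA, subset_rfl, h w, mem_arc hlw hwr, hw⟩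
    · refine ⟨h '' Icc l r ∪ p '' Icc 1 k, ?_, far_union fA ?_, subset_union_left,
        p 1, Or.inr ⟨1, by simp; omega, rfl⟩, ((Q.path.path 0 1 (by omega) hk).2).2 rfl⟩
      · exact (W.cyc.conn (hlw.trans hwr)).union (Q.path.conn hk le_rfl) (mem_arc hlw hwr)
          ⟨k, by simp; omega, rfl⟩ (Or.inr hw.symm)
      · rintro _ ⟨t, ht, rfl⟩
        rw [mem_Icc] at ht
        refine far_arc (Q.path.off t ht.2) fun i i1 i2 i3 => ?_
        have := Q.hit t ht.2 i i1 (by have := Q.dN; have := Q.T.lt; omega) i3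
        omega
  obtain ⟨E, hE, hfar, hsub, hq⟩ := key
  obtain ⟨i, i1, i2, i3⟩ := hα
  have hx := W.far _ (Q.path.inB 0 (Nat.zero_le _))
  refine W.pair Q.S (Q.path.off 0 (Nat.zero_le _)) hx.1 (fun e => hx.2 e.symm) hE hfar
    ⟨h i, hsub (mem_arc i1 i2), i3⟩ hq Q.au Q.uu Q.ub Q.hu Q.hu' ?_
  intro i i1 i2 i3
  have := Q.hit 0 (Nat.zero_le _) i i1 (by have := Q.dN; have := Q.T.lt; omega) i3
  omega

theorem none_even (Q : TwoSec G x B h N p k a b c d u u' v v') (hs : ¬ (u = u' ∧ G.Adj x (h u)))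
    (ht : ¬ (v = v' ∧ G.Adj x (h v))) (he : Even (cnt G x h u' v)) : False := by
  have e1 := Q.bc
  have e2 := Q.cv
  have e3 := Q.vd
  have e4 := Q.S.lt
  have e5 := Q.dN
  have e6 := Q.au
  have e7 := Q.ub
  have e8 := Q.uu
  have e9 := Q.vv
  have h5 := Q.five_le W
  obtain ⟨c2, i, i1, i2, i3, i4⟩ := (Q.route W (Q.route_lt (by tauto))).1 he
    (cnt_pos e7 (by omega) Q.S.right)
  obtain rfl : c = b + 1 := two_adjacent c2 Q.S.right Q.T.left e1 e7 e2 i1 i2 i3 i4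
  have hub : u < b := by
    rcases eq_or_ne u b with rfl | hn
    · exact absurd ⟨by omega, Q.S.right⟩ hs
    · omega
  have hvc : b + 1 < v' := by
    rcases eq_or_ne v' (b + 1) with rfl | hn
    · obtain rfl : v = b + 1 := by omega
      exact absurd ⟨rfl, Q.T.left⟩ ht
    · omega
  have hd : d + 2 ≤ a + N := by
    by_contra hn
    have := W.card a
    have e := cnt_split (G := G) (x := x) (h := h) (i := a) (j := b) (l := a + N - 1)
      (by omega) (by omega)
    rw [show a + N - 1 = d by omega] at e this
    rw [Q.S.cnt, Q.T.cnt] at e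
    omega
  have p1 := Q.pair W (l := v') (r := d) (by omega) hd le_rfl e3 Q.hv' ⟨d, e3, le_rfl, Q.T.right⟩
  have p2 := (Q.swap W).pair W (l := a + N) (r := u + N) hd (by omega) (by omega) le_rfl
    (by rw [W.per_adj]; simpa using Q.hu)
    ⟨a + N, le_rfl, by omega, by rw [W.per_adj]; exact Q.S.left⟩
  obtain rfl : u' = u + 1 := by
    rcases eq_or_ne u u' with e | hn
    · rcases p1.2 e with rfl | rfl
      · exact absurd ⟨e, Q.S.left⟩ hs
      · omega
    · omega
  obtain rfl : v' = v + 1 := by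
    rcases eq_or_ne v v' with e | hn
    · rcases p2.2 e with rfl | rfl
      · exact absurd ⟨e, Q.T.left⟩ ht
      · exact absurd ⟨e, Q.T.right⟩ ht
    · omega
  have adj : ∀ t ≤ k, ∀ i, a ≤ i → i < a + N → (G.Adj (p t) (h i) ↔
      (t = 0 ∧ (i = u ∨ i = u + 1)) ∨ (t = k ∧ (i = v ∨ i = v + 1))) := by
    intro t ht i i1 i2
    constructor
    · intro e
      have := Q.hit t ht i i1 i2 e
      omega
    · rintro (⟨rfl, rfl | rfl⟩ | ⟨rfl, rfl | rfl⟩)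
      exacts [Q.hu, Q.hu', Q.hv, Q.hv']
  have per : h (u + N) = h u := W.cyc.per u
  rcases Nat.eq_zero_or_pos k with rfl | hk
  · refine no_four_nbrs W.cls (y := p 0) (a := h u) (b := h (u + 1)) (c := h v) (d := h (v + 1))
      W.hole ?_ ?_ (W.cyc.ne _ _ (by omega) (by omega)) (W.cyc.ne _ _ (by omega) (by omega))
      (W.cyc.ne _ _ (by omega) (by omega)) (W.cyc.ne _ _ (by omega) (by omega))
      (W.cyc.ne _ _ (by omega) (by omega)) (W.cyc.ne _ _ (by omega) (by omega))
    · rintro ⟨i, e⟩; exact Q.path.off 0 le_rfl i e.symm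
    · ext w
      constructor
      · rintro ⟨⟨i, rfl⟩, hw⟩
        obtain ⟨j, j1, j2, j3, -⟩ := W.cyc.rep a i
        rw [← j3] at hw ⊢
        rcases (adj 0 le_rfl j j1 j2).1 hw with ⟨-, rfl | rfl⟩ | ⟨-, rfl | rfl⟩ <;> simp
      · rintro (rfl | rfl | rfl | rfl)
        exacts [⟨⟨_, rfl⟩, Q.hu⟩, ⟨⟨_, rfl⟩, Q.hu'⟩, ⟨⟨_, rfl⟩, Q.hv⟩, ⟨⟨_, rfl⟩, Q.hv'⟩]
  · refine W.no_two_edges Q.path hk (u := u) (v := v) (by omega) (by omega) fun t ht i i1 i2 => ?_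
    rcases lt_or_ge i (a + N) with i3 | i3
    · exact adj t ht i (by omega) i3
    · rw [← sub_add_cancel i N, W.per_adj, adj t ht (i - N) (by omega) (by omega)]; omega

theorem not_none (Q : TwoSec G x B h N p k a b c d u u' v v') (hs : ¬ (u = u' ∧ G.Adj x (h u)))
    (ht : ¬ (v = v' ∧ G.Adj x (h v))) : False := by
  have s := Q.sum W
  have z : ∀ {i j : ℤ}, ¬ (i = j ∧ G.Adj x (h i)) → (if i = j then cnt G x h i i else 0) = 0 := by
    intro i j hij
    rcases cnt_self (G := G) (x := x) (h := h) i with e | e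
    · rw [if_neg (by tauto)]
    · rw [e.2]; simp
  rw [z hs, z ht] at s
  rcases Nat.even_or_odd (cnt G x h u' v) with he | he
  · exact Q.none_even W hs ht he
  · refine (Q.swap W).none_even W ht ?_ ?_
    · rw [W.per_adj]; rintro ⟨e, e'⟩; exact hs ⟨by omega, e'⟩
    · obtain ⟨y, hy⟩ := he
      obtain ⟨z, hz⟩ := W.odd
      exact ⟨z - y, by omega⟩

theorem one_star (Q : TwoSec G x B h N p k a b c d u u' v v') (hs : ¬ (u = u' ∧ G.Adj x (h u)))
    (hvv : v = v') (hv : G.Adj x (h v)) :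
    ∃ e₀ e₁ e₂ e₃ e₄ w, StarPath G x B h N p k e₀ e₁ e₂ e₃ e₄ w := by
  subst hvv
  have s := Q.sum W
  have e1 := Q.bc
  have e2 := Q.cv
  have e3 := Q.vd
  have e4 := Q.S.lt
  have e5 := Q.dN
  have e6 := Q.au
  have e7 := Q.ub
  have e8 := Q.uu
  have h5 := Q.five_le W
  rw [if_pos rfl, cnt_one hv] at s
  have z : (if u = u' then cnt G x h u u else 0) = 0 := by
    rcases cnt_self (G := G) (x := x) (h := h) u with e | e
    · rw [if_neg (by tauto)]
    · rw [e.2]; simp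
  rw [z] at s
  have r1 := Q.route W (Q.route_lt (by tauto))
  have r2 := (Q.swap W).route W ((Q.swap W).route_lt (by
    rw [W.per_adj]; rintro ⟨-, e, -, e', -⟩; exact hs ⟨by omega, e'⟩))
  have hua : G.Adj x (h (a + N)) := by rw [W.per_adj]; exact Q.S.left
  have hbu : u < b := by
    rcases eq_or_ne u b with rfl | hn
    · exact absurd ⟨by omega, Q.S.right⟩ hs
    · omega
  have hau : a < u' := by
    rcases eq_or_ne u' a with rfl | hn
    · obtain rfl : u = u' := by omega
      exact absurd ⟨rfl, Q.S.left⟩ hs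
    · omega
  have s1 : cnt G x h u' v = cnt G x h b v := by
    have e := cnt_split (G := G) (x := x) (h := h) (i := u') (j := b - 1) (l := v)
      (by omega) (by omega)
    rw [sub_add_cancel] at e
    have := cnt_eq_zero (G := G) (x := x) (h := h) (i := u') (j := b - 1)
      fun k _ _ => Q.S.mid k (by omega) (by omega)
    omega
  have s2 : cnt G x h v (u + N) = cnt G x h v (a + N) := by
    have e := cnt_split (G := G) (x := x) (h := h) (i := v) (j := a + N) (l := u + N)
      (by omega) (by omega)
    have := cnt_eq_zero (G := G) (x := x) (h := h) (i := a + N + 1) (j := u + N)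
      fun k _ _ => (Q.S.next W.cyc).mid k (by omega) (by omega)
    omega
  have t1 := cnt_pos (G := G) (x := x) (h := h) (i := b) (j := b) (k := b) le_rfl le_rfl Q.S.right
  have t2 := cnt_split (G := G) (x := x) (h := h) (i := b) (j := b) (l := v) (by omega) (by omega)
  have t3 := cnt_pos (G := G) (x := x) (h := h) (i := b + 1) (j := v) (k := v) (by omega) le_rfl hv
  have t4 := cnt_split (G := G) (x := x) (h := h) (i := v) (j := v) (l := a + N)
    (by omega) (by omega)
  have t5 := cnt_pos (G := G) (x := x) (h := h) (i := v) (j := v) (k := v) le_rfl le_rfl hv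
  have t6 := cnt_pos (G := G) (x := x) (h := h) (i := v + 1) (j := a + N) (k := a + N)
    (by omega) le_rfl hua
  rw [s1, s2] at s
  rw [s1] at r1
  rw [s2] at r2
  obtain ⟨z, hz⟩ := W.odd
  have r1e := fun e => (r1.1 e (by omega)).1
  have r2e := fun e => (r2.1 e (by omega)).1
  rw [Nat.even_iff] at r1e r2e
  have c1 : cnt G x h b v = 3 := by omega
  have c2 : cnt G x h v (a + N) = 3 := by omega
  obtain ⟨y, Y1, Y2⟩ := W.split_three Q.S.right hv (by omega) c1
  obtain ⟨y', Z1, Z2⟩ := W.split_three hv hua (by omega) c2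
  have y1 := Y1.lt
  have y2 := Y2.lt
  have y3 := Z1.lt
  have y4 := Z2.lt
  have pr := Q.pair W (l := v) (r := v) (by omega) (by omega) le_rfl le_rfl Q.hv
    ⟨v, le_rfl, le_rfl, hv⟩
  obtain rfl : u' = u + 1 := by
    rcases eq_or_ne u u' with e | hn
    · rcases pr.2 e with rfl | rfl <;> omega
    · omega
  refine ⟨v, y', a + N, b + N, y + N, u + N, ⟨Z1, Z2, Q.S.next W.cyc, Y1.next W.cyc, Y2.next W.cyc⟩,
    Q.path, by omega, by omega, ?_⟩
  intro t ht i i1 i2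
  constructor
  · intro e
    rcases lt_or_ge i (a + N) with i3 | i3
    · have := Q.hit t ht i (by omega) i3 e; omega
    · have := Q.hit t ht (i - N) (by omega) (by omega) (by rwa [← W.per_adj, sub_add_cancel])
      omega
  · rintro (⟨rfl, rfl | rfl⟩ | ⟨rfl, rfl⟩)
    · rw [W.per_adj]; exact Q.hu
    · rw [add_right_comm, W.per_adj]; exact Q.hu'
    · exact Q.hv

theorem exists_star (Q : TwoSec G x B h N p k a b c d u u' v v')
    (hns : ¬ ((u = u' ∧ G.Adj x (h u)) ∧ v = v' ∧ G.Adj x (h v))) :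
    ∃ q e₀ e₁ e₂ e₃ e₄ w, StarPath G x B h N q k e₀ e₁ e₂ e₃ e₄ w ∧ q '' Iic k = p '' Iic k := by
  by_cases hs : u = u' ∧ G.Adj x (h u)
  · by_cases ht : v = v' ∧ G.Adj x (h v)
    · exact absurd ⟨hs, ht⟩ hns
    · obtain ⟨e₀, e₁, e₂, e₃, e₄, w, H⟩ := (Q.swap W).one_star W ht (by omega)
        (by rw [W.per_adj]; exact hs.2)
      exact ⟨_, e₀, e₁, e₂, e₃, e₄, w, H, image_reverse p k⟩
  · by_cases ht : v = v' ∧ G.Adj x (h v)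
    · obtain ⟨e₀, e₁, e₂, e₃, e₄, w, H⟩ := Q.one_star W hs ht.1 ht.2
      exact ⟨p, e₀, e₁, e₂, e₃, e₄, w, H, rfl⟩
    · exact (Q.not_none W hs ht).elim

end TwoSec

end

/-- The first and last neighbours of `p` in a sector with an interior neighbour of `p`. -/
structure SecHit (G : SimpleGraph V) (x : V) (h : ℤ → V) (p : V) (c d u v : ℤ) : Prop where
  sec : Sec G x h c d
  cu : c ≤ u
  ud : u + 1 ≤ d
  cv : c + 1 ≤ v
  vd : v ≤ d
  uv : u ≤ v
  gap : c + 2 ≤ d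
  hu : G.Adj p (h u)
  hv : G.Adj p (h v)
  hit : ∀ i, c ≤ i → i ≤ d → G.Adj p (h i) → u ≤ i ∧ i ≤ v

section

variable {x : V} {h : ℤ → V} {N : ℤ} {B : Set V} {n : ℕ} {p : V}

theorem SecHit.exists {c d w : ℤ} (S : Sec G x h c d) (h1 : c < w) (h2 : w < d)
    (hw : G.Adj p (h w)) : ∃ u v, SecHit G x h p c d u v := by
  obtain ⟨u, u1, u2, u3, u4⟩ := exists_least_of_mem (P := fun i => G.Adj p (h i)) (a := c) (b := w)
    ⟨w, h1.le, le_rfl, hw⟩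
  obtain ⟨v, v1, v2, v3, v4⟩ := exists_greatest_of_mem (P := fun i => G.Adj p (h i)) (a := w) (b := d)
    ⟨w, le_rfl, h2.le, hw⟩
  refine ⟨u, v, S, u1, by omega, by omega, v2, by omega, by omega, u3, v3, fun i i1 i2 i3 => ?_⟩
  constructor
  · by_contra hn; exact u4 i i1 (by omega) i3
  · by_contra hn; exact v4 i (by omega) i2 i3

theorem SecHit.reflect {c d u v : ℤ} (S : SecHit G x h p c d u v) :
    SecHit G x (fun i => h (-i)) p (-d) (-c) (-v) (-u) where
  sec := S.sec.reflect
  cu := by have := S.vd; omega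
  ud := by have := S.cv; omega
  cv := by have := S.ud; omega
  vd := by have := S.cu; omega
  uv := by have := S.uv; omega
  gap := by have := S.gap; omega
  hu := by simpa using S.hv
  hv := by simpa using S.hu
  hit i h1 h2 h3 := by
    have := S.hit (-i) (by omega) (by omega) h3
    omega

theorem SecHit.next {c d u v : ℤ} (S : SecHit G x h p c d u v) (C : Cyc G h N) :
    SecHit G x h p (c + N) (d + N) (u + N) (v + N) where
  sec := S.sec.next C
  cu := by have := S.cu; omega
  ud := by have := S.ud; omega
  cv := by have := S.cv; omega
  vd := by have := S.vd; omega
  uv := by have := S.uv; omega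
  gap := by have := S.gap; omega
  hu := by rw [C.per]; exact S.hu
  hv := by rw [C.per]; exact S.hv
  hit i h1 h2 h3 := by
    have := S.hit (i - N) (by omega) (by omega) (by rwa [← C.per (i - N), sub_add_cancel])
    omega

namespace HubWheel

variable (W : HubWheel G x B h N n)
include W

theorem hit_left_end {l m r u v u' v' : ℤ} (S : SecHit G x h p l m u v) (T : SecHit G x h p m r u' v')
    (hoff : ∀ i, p ≠ h i) (hu : u + 1 = m) : G.Adj p (h m) := by
  have := S.gap
  have := T.cv
  exact W.junction S.sec T.sec hoff (by omega) T.vd T.hv hu S.hu (by omega) fun t t1 t2 t3 => by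
    have := S.hit t t1 (by omega) t3; omega

theorem hit_right_end {l m r u v u' v' : ℤ} (S : SecHit G x h p l m u v)
    (T : SecHit G x h p m r u' v') (hoff : ∀ i, p ≠ h i) (hv : v' = m + 1) : G.Adj p (h m) := by
  have := T.gap
  have := S.ud
  exact W.junction' S.sec T.sec hoff (by omega) S.cu S.hu hv T.hv (by omega) fun t t1 t2 t3 => by
    have := T.hit t (by omega) t2 t3; omega

theorem not_both_hit {l m r u v u' v' : ℤ} (S : SecHit G x h p l m u v)
    (T : SecHit G x h p m r u' v') (hp : p ∈ B) (hoff : ∀ i, p ≠ h i) (hu : u + 1 = m)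
    (hv : v' = m + 1) : False := by
  have hm := W.hit_left_end S T hoff hu
  have := S.ud
  have := T.cv
  have := S.cu
  have := T.vd
  refine W.no_triple S.sec T.sec hp hoff fun k h1 h2 => ⟨fun e => ?_, ?_⟩
  · rcases le_total k m with h3 | h3
    · have := S.hit k h1 h3 e; omega
    · have := T.hit k h3 h2 e; omega
  · rintro (rfl | rfl | rfl)
    · have e := S.hu; rwa [show u = m - 1 by omega] at e
    · exact hm
    · rw [← hv]; exact T.hv

theorem not_ends {c d u v : ℤ} (S : SecHit G x h p c d u v) (hp : p ∈ B) (h1 : G.Adj p (h c))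
    (h2 : G.Adj p (h d)) : False := by
  have := S.gap
  have := W.sec_le S.sec
  have := W.clique hp h1 h2 S.sec.left S.sec.right (by omega) (by omega)
  omega

theorem no_three_sectors {c₁ d₁ u₁ v₁ c₂ d₂ u₂ v₂ c₃ d₃ u₃ v₃ : ℤ} (hp : p ∈ B)
    (hoff : ∀ i, p ≠ h i) (S₁ : SecHit G x h p c₁ d₁ u₁ v₁) (S₂ : SecHit G x h p c₂ d₂ u₂ v₂)
    (S₃ : SecHit G x h p c₃ d₃ u₃ v₃) (h12 : d₁ ≤ c₂) (h23 : d₂ ≤ c₃) (h31 : d₃ ≤ c₁ + N) :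
    False := by
  have a1 := S₁.cu
  have a2 := S₁.ud
  have a3 := S₁.cv
  have a4 := S₁.vd
  have b1 := S₂.cu
  have b2 := S₂.ud
  have b3 := S₂.cv
  have b4 := S₂.vd
  have c1 := S₃.cu
  have c2 := S₃.ud
  have c3 := S₃.cv
  have c4 := S₃.vd
  have st : (d₁ = c₂ ∧ u₁ + 1 = d₁) ∨ (d₂ = c₃ ∧ u₂ + 1 = d₂) ∨ (d₃ = c₁ + N ∧ u₃ + 1 = d₃) := by
    by_contra hn
    exact W.no_three_arcs hp (l₁ := c₁) (r₁ := u₁) (l₂ := c₂) (r₂ := u₂) (l₃ := c₃) (r₃ := u₃)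
      a1 b1 c1 (by omega) (by omega) (by omega) ⟨c₁, le_rfl, a1, S₁.sec.left⟩
      ⟨c₂, le_rfl, b1, S₂.sec.left⟩ ⟨c₃, le_rfl, c1, S₃.sec.left⟩ ⟨u₁, a1, le_rfl, S₁.hu⟩
      ⟨u₂, b1, le_rfl, S₂.hu⟩ ⟨u₃, c1, le_rfl, S₃.hu⟩
  have en : (d₁ = c₂ ∧ v₂ = d₁ + 1) ∨ (d₂ = c₃ ∧ v₃ = d₂ + 1) ∨ (d₃ = c₁ + N ∧ v₁ + N = d₃ + 1) := by
    by_contra hn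
    exact W.no_three_arcs hp (l₁ := v₁) (r₁ := d₁) (l₂ := v₂) (r₂ := d₂) (l₃ := v₃) (r₃ := d₃)
      a4 b4 c4 (by omega) (by omega) (by omega) ⟨d₁, a4, le_rfl, S₁.sec.right⟩
      ⟨d₂, b4, le_rfl, S₂.sec.right⟩ ⟨d₃, c4, le_rfl, S₃.sec.right⟩ ⟨v₁, le_rfl, a4, S₁.hv⟩
      ⟨v₂, le_rfl, b4, S₂.hv⟩ ⟨v₃, le_rfl, c4, S₃.hv⟩
  have T₁ := S₁.next W.cyc
  rcases st with ⟨rfl, e1⟩ | ⟨rfl, e1⟩ | ⟨rfl, e1⟩ <;> rcases en with ⟨e3, e2⟩ | ⟨e3, e2⟩ | ⟨e3, e2⟩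
  · exact W.not_both_hit S₁ S₂ hp hoff e1 e2
  · subst e3
    exact W.not_ends S₂ hp (W.hit_left_end S₁ S₂ hoff e1) (W.hit_right_end S₂ S₃ hoff e2)
  · subst e3
    exact W.not_ends S₁ hp (by rw [← W.per_adj]; exact W.hit_right_end S₃ T₁ hoff e2)
      (W.hit_left_end S₁ S₂ hoff e1)
  · subst e3
    exact W.not_ends S₂ hp (W.hit_right_end S₁ S₂ hoff e2) (W.hit_left_end S₂ S₃ hoff e1)
  · exact W.not_both_hit S₂ S₃ hp hoff e1 e2
  · subst e3
    exact W.not_ends S₃ hp (W.hit_left_end S₂ S₃ hoff e1) (W.hit_right_end S₃ T₁ hoff e2)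
  · subst e3
    exact W.not_ends S₁ hp (by rw [← W.per_adj]; exact W.hit_left_end S₃ T₁ hoff e1)
      (W.hit_right_end S₁ S₂ hoff e2)
  · subst e3
    exact W.not_ends S₃ hp (W.hit_right_end S₂ S₃ hoff e2) (W.hit_left_end S₃ T₁ hoff e1)
  · exact W.not_both_hit S₃ T₁ hp hoff e1 e2

theorem no_tight_point {c₁ d₁ u₁ v₁ c₂ d₂ u₂ v₂ m : ℤ} (hp : p ∈ B)
    (hoff : ∀ i, p ≠ h i) (S₁ : SecHit G x h p c₁ d₁ u₁ v₁) (S₂ : SecHit G x h p c₂ d₂ u₂ v₂)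
    (h12 : c₂ = d₁ + 1) (h23 : m = d₂ + 1) (h31 : m + 1 = c₁ + N) (xm : G.Adj x (h m))
    (pm : G.Adj p (h m)) (hc : ¬ G.Adj p (h c₁)) : False := by
  have a1 := S₁.cu
  have a2 := S₁.ud
  have a3 := S₁.cv
  have a4 := S₁.vd
  have a5 := S₁.uv
  have b3 := S₂.cv
  have b4 := S₂.vd
  have hpx := W.far p hp
  have pr := W.pair S₁.sec hoff hpx.1 (fun e => hpx.2 e.symm) (W.cyc.conn b4)
    (W.cyc.far (by omega) (by omega)).symm ⟨h d₂, mem_arc b4 le_rfl, S₂.sec.right⟩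
    ⟨h v₂, mem_arc le_rfl b4, S₂.hv⟩ a1 a5 a4 S₁.hu S₁.hv S₁.hit
  have hcu : c₁ ≠ u₁ := fun e => hc (by rw [e]; exact S₁.hu)
  obtain rfl : v₁ = u₁ + 1 := by
    rcases eq_or_ne u₁ v₁ with e | e
    · have := pr.2 e; omega
    · omega
  have h₁₂ : ∀ s ∈ h '' Icc c₁ u₁, ∀ w ∈ insert x (h '' Icc (u₁ + 1) d₁), s ≠ w ∧
      (G.Adj s w ↔ (s = h c₁ ∧ w = x) ∨ (s = h u₁ ∧ w = h (u₁ + 1))) := by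
    rintro _ ⟨i, ⟨i1, i2⟩, rfl⟩ w (rfl | ⟨j, ⟨j1, j2⟩, rfl⟩)
    · refine ⟨W.ne i, ?_⟩
      rw [G.adj_comm, W.cyc.eq_iff (by omega) (by omega)]
      constructor
      · intro e
        by_contra hn
        exact S₁.sec.mid i (by simp at hn; omega) (by omega) e
      · rintro (⟨rfl, -⟩ | ⟨-, e⟩)
        · exact S₁.sec.left
        · exact absurd e.symm (W.ne _)
    · refine ⟨W.cyc.ne _ _ (by omega) (by omega), ?_⟩
      rw [W.cyc.adj _ _ (by omega) (by omega), W.cyc.eq_iff (by omega) (by omega),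
        W.cyc.eq_iff (by omega) (by omega), W.cyc.eq_iff (by omega) (by omega)]
      have := W.ne j
      simp only [this, and_false, false_or]
      omega
  have h₁₃ : ∀ s ∈ h '' Icc c₁ u₁, ∀ w ∈ ({h m, p} : Set V), s ≠ w ∧
      (G.Adj s w ↔ (s = h c₁ ∧ w = h m) ∨ (s = h u₁ ∧ w = p)) := by
    rintro _ ⟨i, ⟨i1, i2⟩, rfl⟩ w (rfl | rfl)
    · refine ⟨W.cyc.ne _ _ (by omega) (by omega), ?_⟩
      have := (hoff m).symm
      rw [W.cyc.adj _ _ (by omega) (by omega), W.cyc.eq_iff (by omega) (by omega)]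
      simp only [this, and_false, or_false, and_true]
      omega
    · refine ⟨(hoff i).symm, ?_⟩
      rw [G.adj_comm, W.cyc.eq_iff (j := u₁) (by omega) (by omega)]
      simp only [hoff m, and_false, false_or, and_true]
      constructor
      · intro e; have := S₁.hit i i1 (by omega) e; omega
      · rintro rfl; exact S₁.hu
  have h₂₃ : ∀ s ∈ insert x (h '' Icc (u₁ + 1) d₁), ∀ w ∈ ({h m, p} : Set V), s ≠ w ∧
      (G.Adj s w ↔ (s = x ∧ w = h m) ∨ (s = h (u₁ + 1) ∧ w = p)) := by
    rintro s (rfl | ⟨i, ⟨i1, i2⟩, rfl⟩) w (rfl | rfl)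
    · exact ⟨(W.ne m).symm, by simp [xm]⟩
    · refine ⟨hpx.1.symm, ?_⟩
      simp [hpx.2, hoff m, (W.ne _).symm]
    · refine ⟨W.cyc.ne _ _ (by omega) (by omega), ?_⟩
      have := (hoff m).symm
      rw [W.cyc.adj _ _ (by omega) (by omega)]
      simp only [this, W.ne i, and_false, false_and, or_false, iff_false]
      omega
    · refine ⟨(hoff i).symm, ?_⟩
      rw [G.adj_comm, W.cyc.eq_iff (by omega) (by omega)]
      simp only [hoff m, and_false, false_or, and_true]
      constructor
      · intro e; have := S₁.hit i (by omega) i2 e; omega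
      · rintro rfl; exact S₁.hv
  refine prism_of_sets W.cls (W.cyc.conn a1)
    ((W.cyc.conn (by omega)).insert (mem_arc (by omega) le_rfl) S₁.sec.right)
    ((connSet_singleton p).insert (mem_singleton p) pm.symm) (mem_arc le_rfl a1)
    (mem_insert _ _) (mem_insert _ _) (mem_arc a1 le_rfl) (Or.inr (mem_arc le_rfl (by omega)))
    (Or.inr rfl) (W.cyc.ne _ _ (by omega) (by omega)) (W.ne _).symm (hoff m).symm h₁₂ h₁₃ h₂₃

theorem no_two_sectors_point {c₁ d₁ u₁ v₁ c₂ d₂ u₂ v₂ m : ℤ} (hp : p ∈ B)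
    (hoff : ∀ i, p ≠ h i) (S₁ : SecHit G x h p c₁ d₁ u₁ v₁) (S₂ : SecHit G x h p c₂ d₂ u₂ v₂)
    (h12 : d₁ ≤ c₂) (h23 : d₂ < m) (h31 : m < c₁ + N) (xm : G.Adj x (h m)) (pm : G.Adj p (h m)) :
    False := by
  have a1 := S₁.cu
  have a2 := S₁.ud
  have a3 := S₁.cv
  have a4 := S₁.vd
  have b1 := S₂.cu
  have b2 := S₂.ud
  have b3 := S₂.cv
  have b4 := S₂.vd
  have g1 := S₁.gap
  have g2 := S₂.gap
  have nj : d₁ = c₂ → ¬ G.Adj p (h d₁) := by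
    intro e e'
    have := W.clique hp e' pm S₁.sec.right xm (by omega) (by omega)
    omega
  have j1 : ¬ (d₁ = c₂ ∧ u₁ + 1 = d₁) := by
    rintro ⟨rfl, e⟩; exact nj rfl (W.hit_left_end S₁ S₂ hoff e)
  have j2 : ¬ (d₁ = c₂ ∧ v₂ = d₁ + 1) := by
    rintro ⟨rfl, e⟩; exact nj rfl (W.hit_right_end S₁ S₂ hoff e)
  have k1 : m + 1 = c₁ + N := by
    by_contra hn
    exact W.no_three_arcs hp (l₁ := c₁) (r₁ := u₁) (l₂ := c₂) (r₂ := u₂) (l₃ := m) (r₃ := m)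
      a1 b1 le_rfl (by omega) (by omega) (by omega) ⟨c₁, le_rfl, a1, S₁.sec.left⟩
      ⟨c₂, le_rfl, b1, S₂.sec.left⟩ ⟨m, le_rfl, le_rfl, xm⟩ ⟨u₁, a1, le_rfl, S₁.hu⟩
      ⟨u₂, b1, le_rfl, S₂.hu⟩ ⟨m, le_rfl, le_rfl, pm⟩
  have k2 : m = d₂ + 1 := by
    by_contra hn
    exact W.no_three_arcs hp (l₁ := v₁) (r₁ := d₁) (l₂ := v₂) (r₂ := d₂) (l₃ := m) (r₃ := m)
      a4 b4 le_rfl (by omega) (by omega) (by omega) ⟨d₁, a4, le_rfl, S₁.sec.right⟩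
      ⟨d₂, b4, le_rfl, S₂.sec.right⟩ ⟨m, le_rfl, le_rfl, xm⟩ ⟨v₁, le_rfl, a4, S₁.hv⟩
      ⟨v₂, le_rfl, b4, S₂.hv⟩ ⟨m, le_rfl, le_rfl, pm⟩
  have k3 : c₂ < d₁ + 2 := by
    by_contra hn
    exact W.no_three_arcs hp (l₁ := v₁) (r₁ := d₁) (l₂ := c₂) (r₂ := u₂) (l₃ := m) (r₃ := m)
      a4 b1 le_rfl (by omega) (by omega) (by omega) ⟨d₁, a4, le_rfl, S₁.sec.right⟩
      ⟨c₂, le_rfl, b1, S₂.sec.left⟩ ⟨m, le_rfl, le_rfl, xm⟩ ⟨v₁, le_rfl, a4, S₁.hv⟩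
      ⟨u₂, b1, le_rfl, S₂.hu⟩ ⟨m, le_rfl, le_rfl, pm⟩
  rcases eq_or_ne c₂ d₁ with rfl | hne
  · have e1 := cnt_join (by omega) (by omega) S₁.sec.right (G := G) (i := c₁) (j := d₂)
    rw [S₁.sec.cnt, S₂.sec.cnt] at e1
    have e2 := cnt_split (G := G) (x := x) (h := h) (i := c₁) (j := d₂) (l := m)
      (by omega) (by omega)
    have e3 := W.card c₁
    have e4 := cnt_one xm
    rw [show c₁ + N - 1 = m by omega] at e3
    rw [← k2] at e2
    obtain ⟨z, hz⟩ := W.odd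
    omega
  · by_cases hc : G.Adj p (h c₁)
    · refine W.reflect.no_tight_point hp (fun i => hoff _) S₂.reflect S₁.reflect (m := -m + N)
        (by omega) (by omega) (by omega) ?_ ?_ ?_
      · have e : -(-m + N) = m - N := by ring
        simp only [e]
        rwa [← W.per_adj, sub_add_cancel]
      · have e : -(-m + N) = m - N := by ring
        simp only [e]
        rwa [← W.per_adj, sub_add_cancel]
      · simp only [neg_neg]
        intro e
        have := W.clique hp hc e S₁.sec.left S₂.sec.right (by omega) (by omega)
        omega
    · exact W.no_tight_point hp hoff S₁ S₂ (by omega) k2 k1 xm pm hc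

end HubWheel

end

section

variable {x : V} {h : ℤ → V} {N : ℤ} {B : Set V} {n : ℕ}

theorem Cosec.symm {s t : V} (H : Cosec G x h s t) : Cosec G x h t s := by
  obtain ⟨c, d, S, h1, h2⟩ := H
  exact ⟨c, d, S, h2, h1⟩

theorem Sec.unique {a b c d i : ℤ} (S : Sec G x h a b) (T : Sec G x h c d) (h1 : a < i) (h2 : i < b)
    (h3 : c ≤ i) (h4 : i ≤ d) : c = a ∧ d = b := by
  have hi := S.mid i h1 h2
  have h5 : c ≠ i := fun e => hi (e ▸ T.left)
  have h6 : d ≠ i := fun e => hi (e ▸ T.right)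
  constructor
  · rcases lt_trichotomy c a with h7 | h7 | h7
    · exact absurd S.left (T.mid a h7 (by omega))
    · exact h7
    · exact absurd T.left (S.mid c h7 (by omega))
  · rcases lt_trichotomy d b with h7 | h7 | h7
    · exact absurd T.right (S.mid d (by omega) h7)
    · exact h7
    · exact absurd S.right (T.mid b (by omega) h7)

theorem Sec.le_of_mem {a b c d i : ℤ} (S : Sec G x h a b) (T : Sec G x h c d) (h1 : b < i)
    (h2 : i ≤ d) : b ≤ c := by
  by_contra hn
  exact T.mid b (by omega) (by omega) S.right

theorem Sec.ge_of_mem {a b c d i : ℤ} (S : Sec G x h a b) (T : Sec G x h c d) (h1 : i < a)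
    (h2 : c ≤ i) : d ≤ a := by
  by_contra hn
  exact T.mid a (by omega) (by omega) S.left

namespace HubWheel

variable (W : HubWheel G x B h N n)
include W

theorem le_of_mem_arc {a b i : ℤ} (h1 : a ≤ i) (h2 : i < a + N) (h3 : b < a + N)
    (hi : h i ∈ h '' Icc a b) : i ≤ b := by
  obtain ⟨j, ⟨j1, j2⟩, e⟩ := hi
  have := W.cyc.inj (by omega) (by omega) e
  omega

/-- Translate a sector so that it contains a given position. -/
theorem sec_through {c d i : ℤ} (S : Sec G x h c d) (hi : h i ∈ h '' Icc c d) :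
    ∃ c' d', Sec G x h c' d' ∧ c' ≤ i ∧ i ≤ d' ∧ h '' Icc c' d' = h '' Icc c d := by
  obtain ⟨j, ⟨j1, j2⟩, e⟩ := hi
  obtain ⟨r, r1, r2, r3, t, r4⟩ := W.cyc.rep j i
  obtain rfl : j = r := W.cyc.inj (by omega) (by omega) (e.trans r3.symm)
  have hneg := neg_mul t N
  refine ⟨_, _, S.translate W.cyc (-t), by omega, by omega, ?_⟩
  ext v
  constructor
  · rintro ⟨k, hk, rfl⟩
    exact ⟨k + t * N, by simp only [mem_Icc] at *; constructor <;> linarith [hk.1, hk.2], W.cyc.per_mul _ _⟩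
  · rintro ⟨k, hk, rfl⟩
    exact ⟨k + -t * N, by simp only [mem_Icc] at *; constructor <;> linarith [hk.1, hk.2], W.cyc.per_mul _ _⟩

theorem cosec_mid {a b i : ℤ} {w : V} (S : Sec G x h a b) (h1 : a < i) (h2 : i < b)
    (H : Cosec G x h (h i) w) : w ∈ h '' Icc a b := by
  obtain ⟨c, d, T, h3, h4⟩ := H
  obtain ⟨c', d', T', t1, t2, e⟩ := W.sec_through T h3
  obtain ⟨rfl, rfl⟩ := S.unique T' h1 h2 t1 t2
  rwa [e]

theorem cosec_spoke {l m r : ℤ} {w : V} (S : Sec G x h l m) (T : Sec G x h m r)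
    (H : Cosec G x h (h m) w) : w ∈ h '' Icc l m ∨ w ∈ h '' Icc m r := by
  obtain ⟨c, d, U, h3, h4⟩ := H
  obtain ⟨c', d', U', t1, t2, e⟩ := W.sec_through U h3
  rw [← e] at h4
  have := S.lt
  have := T.lt
  rcases eq_or_lt_of_le t1 with rfl | t3
  · rcases lt_trichotomy d' r with h5 | rfl | h5
    · exact absurd U'.right (T.mid _ U'.lt h5)
    · exact Or.inr h4
    · exact absurd T.right (U'.mid r T.lt h5)
  · rcases eq_or_lt_of_le t2 with rfl | t4
    · rcases lt_trichotomy c' l with h5 | rfl | h5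
      · exact absurd S.left (U'.mid l h5 S.lt)
      · exact Or.inl h4
      · exact absurd U'.left (S.mid _ h5 U'.lt)
    · exact absurd S.right (U'.mid m t3 t4)

theorem cosec_of_spokes {p : V} (hp : p ∈ B) {i j : ℤ} (hi : G.Adj p (h i)) (hj : G.Adj p (h j))
    (xi : G.Adj x (h i)) (xj : G.Adj x (h j)) : Cosec G x h (h i) (h j) := by
  obtain ⟨r, r1, r2, r3, -⟩ := W.cyc.rep i j
  rw [← r3] at hj xj ⊢
  rcases eq_or_lt_of_le r1 with rfl | r4
  · obtain ⟨d, S⟩ := W.next_sec xi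
    exact ⟨i, d, S, mem_arc le_rfl S.lt.le, mem_arc le_rfl S.lt.le⟩
  · rcases W.clique hp hi hj xi xj r4 r2 with rfl | rfl
    · exact ⟨i, i + 1, ⟨xi, xj, by omega, fun k _ _ => by omega⟩, mem_arc le_rfl (by omega),
        mem_arc (by omega) le_rfl⟩
    · refine ⟨i + N - 1, i + N, ⟨xj, by rwa [W.per_adj], by omega, fun k _ _ => by omega⟩, ?_,
        mem_arc le_rfl (by omega)⟩
      rw [← W.cyc.per i]
      exact mem_arc (by omega) le_rfl

theorem sec_of_cosec {p : V} (hp : p ∈ B) {Z : Set V} (hZ : ∀ z ∈ Z, z ∈ range h ∧ G.Adj p z)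
    (hne : Z.Nonempty) (hco : ∀ z ∈ Z, ∀ w ∈ Z, Cosec G x h z w) :
    ∃ c d, Sec G x h c d ∧ Z ⊆ h '' Icc c d := by
  by_cases hA : ∃ z ∈ Z, ¬ G.Adj x z
  · obtain ⟨z, hz, hxz⟩ := hA
    obtain ⟨⟨i, rfl⟩, -⟩ := hZ z hz
    obtain ⟨c, d, S, h1, h2⟩ := W.exists_sec i
    have : c ≠ i := fun e => hxz (e ▸ S.left)
    exact ⟨c, d, S, fun w hw => W.cosec_mid S (by omega) h2 (hco _ hz w hw)⟩
  · push Not at hA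
    obtain ⟨z, hz⟩ := hne
    by_cases h1 : ∃ w ∈ Z, w ≠ z
    · obtain ⟨w, hw, hwz⟩ := h1
      have key : ∃ i, h i ∈ Z ∧ h (i + 1) ∈ Z := by
        obtain ⟨⟨i, rfl⟩, pi⟩ := hZ z hz
        obtain ⟨⟨j, rfl⟩, pj⟩ := hZ w hw
        obtain ⟨r, r1, r2, r3, -⟩ := W.cyc.rep i j
        rw [← r3] at hw hwz pj
        rcases eq_or_lt_of_le r1 with rfl | r4
        · exact absurd rfl hwz
        · rcases W.clique hp pi pj (hA _ hz) (hA _ hw) r4 r2 with rfl | rfl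
          · exact ⟨i, hz, hw⟩
          · exact ⟨i + N - 1, hw, by rw [sub_add_cancel, W.cyc.per]; exact hz⟩
      obtain ⟨i, i1, i2⟩ := key
      refine ⟨i, i + 1, ⟨hA _ i1, hA _ i2, by omega, fun k _ _ => by omega⟩, fun v hv => ?_⟩
      obtain ⟨⟨j, rfl⟩, pj⟩ := hZ v hv
      obtain ⟨r, r1, r2, r3, -⟩ := W.cyc.rep i j
      rw [← r3] at hv pj ⊢
      by_cases hr : r ≤ i + 1
      · exact mem_arc r1 hr
      · have e1 := W.clique hp (hZ _ i1).2 pj (hA _ i1) (hA _ hv) (by omega) r2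
        have e2 := W.clique hp (hZ _ i2).2 pj (hA _ i2) (hA _ hv) (by omega) (by omega)
        have := W.cyc.four
        omega
    · push Not at h1
      obtain ⟨⟨i, rfl⟩, -⟩ := hZ z hz
      obtain ⟨d, S⟩ := W.next_sec (hA _ hz)
      exact ⟨i, d, S, fun w hw => by rw [h1 w hw]; exact mem_arc le_rfl S.lt.le⟩

/-- A path whose rim neighbours lie in two sectors contains a star path, unless all rim neighbours
lie in a common sector. -/
theorem star_of_two_secs {p : ℕ → V} {k : ℕ} (P : OffPath G B h p k) {a b c d s s' : ℤ}
    (S : Sec G x h a b) (T : Sec G x h c d) (bc : b ≤ c) (dN : d ≤ a + N)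
    (hit : ∀ t ≤ k, ∀ i, a ≤ i → i < a + N → G.Adj (p t) (h i) →
      (t = 0 ∧ i ≤ b) ∨ (t = k ∧ ((c ≤ i ∧ i ≤ d) ∨ (c ≤ i + N ∧ i + N ≤ d))))
    (as : a ≤ s) (sb : s ≤ b) (cs : c ≤ s') (sd : s' ≤ d) (hs : G.Adj (p 0) (h s))
    (hs' : G.Adj (p k) (h s')) (hco : ¬ Cosec G x h (h s) (h s')) :
    ∃ q e₀ e₁ e₂ e₃ e₄ w, StarPath G x B h N q k e₀ e₁ e₂ e₃ e₄ w ∧ q '' Iic k = p '' Iic k := by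
  have hD := P.conn (Nat.zero_le k) le_rfl
  have hDB : p '' Icc 0 k ⊆ B := by rintro _ ⟨t, ht, rfl⟩; exact P.inB t ht.2
  have hoff : ∀ d ∈ p '' Icc 0 k, ∀ i, d ≠ h i := by rintro _ ⟨t, ht, rfl⟩; exact P.off t ht.2
  have d0 : ∃ d ∈ p '' Icc 0 k, G.Adj d (h s) := ⟨p 0, ⟨0, by simp, rfl⟩, hs⟩
  have d1 : ∃ d ∈ p '' Icc 0 k, G.Adj d (h s') := ⟨p k, ⟨k, by simp, rfl⟩, hs'⟩
  have s1 := S.lt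
  have s2 := T.lt
  rcases eq_or_lt_of_le bc with rfl | bc
  · have := W.two_secs S T
    refine (W.no_straddle hD hDB hoff S T ?_ ⟨s, as, ?_, d0⟩ ⟨s', ?_, sd, d1⟩).elim
    · rintro i i1 i2 _ ⟨t, ht, rfl⟩ i3
      have := hit t ht.2 i i1 i2 i3
      omega
    · by_contra hn
      obtain rfl : s = b := by omega
      exact hco ⟨s, d, T, mem_arc le_rfl s2.le, mem_arc cs sd⟩
    · by_contra hn
      obtain rfl : s' = b := by omega
      exact hco ⟨a, s', S, mem_arc as sb, mem_arc s1.le le_rfl⟩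
  rcases eq_or_lt_of_le dN with rfl | dN
  · have T' := T.prev W.cyc
    rw [add_sub_cancel_right] at T'
    have := W.two_secs T' S
    refine (W.no_straddle hD hDB hoff T' S ?_ ⟨s' - N, by omega, ?_, ?_⟩ ⟨s, ?_, sb, d0⟩).elim
    · rintro i i1 i2 _ ⟨t, ht, rfl⟩ i3
      rcases lt_or_ge i a with i4 | i4
      · omega
      · have := hit t ht.2 i i4 (by omega) i3
        omega
    · by_contra hn
      obtain rfl : s' = a + N := by omega
      rw [W.cyc.per] at hco
      exact hco ⟨a, b, S, mem_arc as sb, mem_arc le_rfl s1.le⟩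
    · rwa [← W.cyc.per (s' - N), sub_add_cancel]
    · by_contra hn
      obtain rfl : s = a := by omega
      rw [← W.cyc.per s] at hco
      exact hco ⟨c, s + N, T, mem_arc s2.le le_rfl, mem_arc cs sd⟩
  obtain ⟨u, u1, u2, u3, u4⟩ := exists_least_of_mem (P := fun i => G.Adj (p 0) (h i))
    ⟨s, as, sb, hs⟩
  obtain ⟨u', v1, v2, v3, v4⟩ := exists_greatest_of_mem (P := fun i => G.Adj (p 0) (h i))
    ⟨s, as, sb, hs⟩
  obtain ⟨v, w1, w2, w3, w4⟩ := exists_least_of_mem (P := fun i => G.Adj (p k) (h i))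
    ⟨s', cs, sd, hs'⟩
  obtain ⟨v', z1, z2, z3, z4⟩ := exists_greatest_of_mem (P := fun i => G.Adj (p k) (h i))
    ⟨s', cs, sd, hs'⟩
  have ss1 : u ≤ s := by by_contra hn; exact u4 s as (by omega) hs
  have ss2 : s ≤ u' := by by_contra hn; exact v4 s (by omega) sb hs
  have ss3 : v ≤ s' := by by_contra hn; exact w4 s' cs (by omega) hs'
  have ss4 : s' ≤ v' := by by_contra hn; exact z4 s' (by omega) sd hs'
  have Q : TwoSec G x B h N p k a b c d u u' v v' := by
    refine ⟨P, S, T, bc, dN, u1, by omega, v2, w1, by omega, z2, u3, v3, w3, z3, ?_⟩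
    intro t ht i i1 i2 i3
    rcases hit t ht i i1 i2 i3 with ⟨rfl, i4⟩ | ⟨rfl, ⟨i4, i5⟩ | i4⟩
    · refine Or.inl ⟨rfl, ?_, ?_⟩
      · by_contra hn; exact u4 i i1 (by omega) i3
      · by_contra hn; exact v4 i (by omega) i4 i3
    · refine Or.inr ⟨rfl, ?_, ?_⟩
      · by_contra hn; exact w4 i i4 (by omega) i3
      · by_contra hn; exact z4 i (by omega) i5 i3
    · omega
  refine Q.exists_star W ?_
  rintro ⟨⟨rfl, xu⟩, rfl, xv⟩
  obtain rfl : s = u := by omega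
  obtain rfl : s' = v := by omega
  rcases Q.both_single W xu xv with rfl | rfl
  · exact hco ⟨s, s + 1, ⟨xu, xv, by omega, fun k _ _ => by omega⟩, mem_arc le_rfl (by omega),
      mem_arc (by omega) le_rfl⟩
  · refine hco ⟨s + N - 1, s + N, ⟨xv, by rwa [W.per_adj], by omega, fun k _ _ => by omega⟩, ?_,
      mem_arc le_rfl (by omega)⟩
    rw [← W.cyc.per s]
    exact mem_arc (by omega) le_rfl

end HubWheel

end

section

variable {x : V} {h : ℤ → V} {N : ℤ} {B : Set V} {n : ℕ}

namespace HubWheel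

variable (W : HubWheel G x B h N n)
include W

theorem cosec_outside_sector {p : V} (hp : p ∈ B) (hoff : ∀ i, p ≠ h i) {a b s i j : ℤ}
    (S : Sec G x h a b) (as : a < s) (sb : s < b) (ps : G.Adj p (h s)) (bi : b < i) (ij : i < j)
    (jN : j < a + N) (pi : G.Adj p (h i)) (pj : G.Adj p (h j)) : Cosec G x h (h i) (h j) := by
  by_contra hco
  obtain ⟨u, v, S₁⟩ := SecHit.exists S as sb ps
  by_cases xi : G.Adj x (h i)
  · by_cases xj : G.Adj x (h j)
    · exact hco (W.cosec_of_spokes hp pi pj xi xj)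
    · obtain ⟨c, d, T, h1, h2⟩ := W.exists_sec j
      have hc : c ≠ j := fun e => xj (e ▸ T.left)
      obtain ⟨u', v', S₂⟩ := SecHit.exists T (by omega) h2 pj
      have hic : i < c := by
        by_contra hn
        exact hco ⟨c, d, T, mem_arc (by omega) (by omega), mem_arc h1 h2.le⟩
      refine W.no_two_sectors_point hp hoff S₂ (S₁.next W.cyc) (m := i + N) ?_ (by omega) (by omega)
        (by rwa [W.per_adj]) (by rwa [W.per_adj])
      exact (S.next W.cyc).ge_of_mem T (i := j) jN h1
  · obtain ⟨c, d, T, h1, h2⟩ := W.exists_sec i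
    have hc : c ≠ i := fun e => xi (e ▸ T.left)
    have hbc := S.le_of_mem T bi h2.le
    obtain ⟨u', v', S₂⟩ := SecHit.exists T (by omega) h2 pi
    have hdj : d < j := by
      by_contra hn
      exact hco ⟨c, d, T, mem_arc h1 h2.le, mem_arc (by omega) (by omega)⟩
    by_cases xj : G.Adj x (h j)
    · exact W.no_two_sectors_point hp hoff S₁ S₂ hbc hdj jN xj pj
    · obtain ⟨c', d', T', h1', h2'⟩ := W.exists_sec j
      have hc' : c' ≠ j := fun e => xj (e ▸ T'.left)
      obtain ⟨u'', v'', S₃⟩ := SecHit.exists T' (by omega) h2' pj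
      exact W.no_three_sectors hp hoff S₁ S₂ S₃ hbc (T.le_of_mem T' hdj h2'.le)
        ((S.next W.cyc).ge_of_mem T' (i := j) jN h1')

theorem star_of_single {p : V} (hp : p ∈ B) (hoff : ∀ i, p ≠ h i) {s s' : ℤ}
    (ps : G.Adj p (h s)) (ps' : G.Adj p (h s')) (hco : ¬ Cosec G x h (h s) (h s'))
    (xs : ¬ G.Adj x (h s)) :
    ∃ q e₀ e₁ e₂ e₃ e₄ w, StarPath G x B h N q 0 e₀ e₁ e₂ e₃ e₄ w ∧ q '' Iic 0 = {p} := by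
  obtain ⟨a, b, S, h1, h2⟩ := W.exists_sec s
  have ha : a ≠ s := fun e => xs (e ▸ S.left)
  have hb := W.sec_le S
  obtain ⟨r, r1, r2, r3, -⟩ := W.cyc.rep a s'
  rw [← r3] at ps' hco
  have hbr : b < r := by
    by_contra hn
    exact hco ⟨a, b, S, mem_arc h1 h2.le, mem_arc r1 (by omega)⟩
  obtain ⟨c, d, T, hZ⟩ := W.sec_of_cosec hp (Z := {z | ∃ i, b < i ∧ i < a + N ∧ z = h i ∧ G.Adj p z})
    (by rintro z ⟨i, -, -, rfl, hz⟩; exact ⟨⟨i, rfl⟩, hz⟩) ⟨h r, r, hbr, r2, rfl, ps'⟩ (by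
      rintro _ ⟨i, i1, i2, rfl, i3⟩ _ ⟨j, j1, j2, rfl, j3⟩
      rcases lt_trichotomy i j with hij | rfl | hij
      · exact W.cosec_outside_sector hp hoff S (by omega) h2 ps i1 hij j2 i3 j3
      · obtain ⟨c, d, T, t1, t2⟩ := W.exists_sec i
        exact ⟨c, d, T, mem_arc t1 t2.le, mem_arc t1 t2.le⟩
      · exact (W.cosec_outside_sector hp hoff S (by omega) h2 ps j1 hij i2 j3 i3).symm)
  obtain ⟨c', d', T', t1, t2, e⟩ := W.sec_through T (hZ ⟨r, hbr, r2, rfl, ps'⟩)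
  rw [← e] at hZ
  have hbc := S.le_of_mem T' hbr t2
  have hda := (S.next W.cyc).ge_of_mem T' (i := r) r2 t1
  have P : OffPath G B h (fun _ => p) 0 :=
    ⟨fun i j _ _ => by omega, fun _ _ => hp, fun _ _ => hoff⟩
  suffices hit : _ by
    obtain ⟨q, e₀, e₁, e₂, e₃, e₄, w, H1, H2⟩ := W.star_of_two_secs P S T' hbc hda hit h1 h2.le t1 t2
      ps ps' hco
    refine ⟨q, e₀, e₁, e₂, e₃, e₄, w, H1, ?_⟩
    rw [H2]; ext v; simp [eq_comm]
  · intro t ht i i1 i2 i3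
    rcases le_or_gt i b with i4 | i4
    · exact Or.inl ⟨by omega, i4⟩
    · obtain ⟨j, ⟨j1, j2⟩, e⟩ := hZ ⟨i, i4, i2, rfl, i3⟩
      have := W.cyc.inj (by omega) (by omega) e
      exact Or.inr ⟨by omega, Or.inl (by omega)⟩

theorem star_of_minimal_path {p : ℕ → V} {k : ℕ} (P : OffPath G B h p k) (hk : 0 < k) {s s' : ℤ}
    (hs : G.Adj (p 0) (h s)) (hs' : G.Adj (p k) (h s')) (hco : ¬ Cosec G x h (h s) (h s'))
    (hmin : ∀ i j, i ≤ j → j ≤ k → ¬ (i = 0 ∧ j = k) → ∀ t t', G.Adj (p i) (h t) →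
      G.Adj (p j) (h t') → Cosec G x h (h t) (h t')) :
    ∃ q e₀ e₁ e₂ e₃ e₄ w, StarPath G x B h N q k e₀ e₁ e₂ e₃ e₄ w ∧ q '' Iic k = p '' Iic k := by
  by_cases hm : ∃ t m, 0 < t ∧ t < k ∧ G.Adj (p t) (h m)
  · exfalso
    obtain ⟨t, m, t0, tk, tm⟩ := hm
    have c1 : ∀ j ≤ k, ∀ i, G.Adj (p j) (h i) → Cosec G x h (h m) (h i) := by
      intro j hj i hi
      rcases le_total t j with htj | htj
      · exact hmin t j htj hj (by omega) _ _ tm hi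
      · exact (hmin j t htj (by omega) (by omega) _ _ hi tm).symm
    by_cases xm : G.Adj x (h m)
    · obtain ⟨l, S⟩ := W.prev_sec xm
      obtain ⟨r, T⟩ := W.next_sec xm
      have g := W.two_secs S T
      have s1 := S.lt
      have s2 := T.lt
      have hD := P.conn (Nat.zero_le k) le_rfl
      have hDB : p '' Icc 0 k ⊆ B := by rintro _ ⟨t, ht, rfl⟩; exact P.inB t ht.2
      have hoff : ∀ d ∈ p '' Icc 0 k, ∀ i, d ≠ h i := by rintro _ ⟨t, ht, rfl⟩; exact P.off t ht.2
      have main : ∀ j ≤ k, ∀ i, G.Adj (p j) (h i) →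
          ∃ i', h i' = h i ∧ l ≤ i' ∧ i' ≤ r := by
        intro j hj i hi
        rcases W.cosec_spoke S T (c1 j hj i hi) with ⟨i', ⟨h1, h2⟩, e⟩ | ⟨i', ⟨h1, h2⟩, e⟩
        · exact ⟨i', e, h1, by omega⟩
        · exact ⟨i', e, by omega, h2⟩
      have fin : ∀ i j, (∃ d ∈ p '' Icc 0 k, G.Adj d (h i)) → (∃ d ∈ p '' Icc 0 k, G.Adj d (h j)) →
          l ≤ i → i < m → m < j → j ≤ r → False := by
        intro i j hi hj i1 i2 i3 i4
        refine W.no_straddle hD hDB hoff S T ?_ ⟨i, i1, i2, hi⟩ ⟨j, i3, i4, hj⟩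
        rintro y y1 y2 _ ⟨t, ht, rfl⟩ y3
        obtain ⟨z, z1, z2, z3⟩ := main t ht.2 y y3
        have := W.cyc.inj (by omega) (by omega) z1
        omega
      obtain ⟨y, y1, y2, y3⟩ := main 0 (Nat.zero_le _) s hs
      obtain ⟨z, z1, z2, z3⟩ := main k le_rfl s' hs'
      have d0 : ∃ d ∈ p '' Icc 0 k, G.Adj d (h y) := ⟨p 0, ⟨0, by simp, rfl⟩, by rwa [y1]⟩
      have d1 : ∃ d ∈ p '' Icc 0 k, G.Adj d (h z) := ⟨p k, ⟨k, by simp, rfl⟩, by rwa [z1]⟩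
      rw [← y1, ← z1] at hco
      rcases lt_or_ge m y with a1 | a1
      · rcases lt_or_ge z m with a2 | a2
        · exact fin z y d1 d0 z2 a2 a1 y3
        · exact hco ⟨m, r, T, mem_arc a1.le y3, mem_arc a2 z3⟩
      · rcases lt_or_ge m z with a2 | a2
        · rcases eq_or_lt_of_le a1 with rfl | a1
          · exact hco ⟨y, r, T, mem_arc le_rfl y3, mem_arc a2.le z3⟩
          · exact fin y z d0 d1 y2 a1 a2 z3
        · exact hco ⟨l, m, S, mem_arc y2 a1, mem_arc z2 a2⟩
    · obtain ⟨c, d, S, h1, h2⟩ := W.exists_sec m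
      have hc : c ≠ m := fun e => xm (e ▸ S.left)
      exact hco ⟨c, d, S, W.cosec_mid S (by omega) h2 (c1 0 (Nat.zero_le _) s hs),
        W.cosec_mid S (by omega) h2 (c1 k le_rfl s' hs')⟩
  · push Not at hm
    have sec : ∀ j ≤ k, j = 0 ∨ j = k → ∀ s, G.Adj (p j) (h s) → ∃ c d, Sec G x h c d ∧
        ∀ i, G.Adj (p j) (h i) → h i ∈ h '' Icc c d := by
      intro j hj hj' s hs
      obtain ⟨c, d, S, hZ⟩ := W.sec_of_cosec (P.inB j hj) (Z := {z | z ∈ range h ∧ G.Adj (p j) z})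
        (fun z hz => hz) ⟨h s, ⟨s, rfl⟩, hs⟩ (by
          rintro _ ⟨⟨i, rfl⟩, hi⟩ _ ⟨⟨i', rfl⟩, hi'⟩
          exact hmin j j le_rfl hj (by omega) _ _ hi hi')
      exact ⟨c, d, S, fun i hi => hZ ⟨⟨i, rfl⟩, hi⟩⟩
    obtain ⟨a, b, S, hS⟩ := sec 0 (Nat.zero_le _) (Or.inl rfl) s hs
    obtain ⟨c₀, d₀, T₀, hT₀⟩ := sec k le_rfl (Or.inr rfl) s' hs'
    obtain ⟨y, ⟨y1, y2⟩, y3⟩ := hS s hs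
    obtain ⟨z, z1, z2, z3, -⟩ := W.cyc.rep a s'
    rw [← y3] at hs hco
    rw [← z3] at hs' hco
    have hb := W.sec_le S
    have hbz : b < z := by
      by_contra hn
      exact hco ⟨a, b, S, mem_arc y1 y2, mem_arc z1 (by omega)⟩
    obtain ⟨c, d, T, t1, t2, e⟩ := W.sec_through T₀ (hT₀ z hs')
    have hbc := S.le_of_mem T hbz t2
    have hda := (S.next W.cyc).ge_of_mem T (i := z) z2 t1
    refine W.star_of_two_secs P S T hbc hda ?_ y1 y2 t1 t2 hs hs' hco
    intro t ht i i1 i2 i3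
    rcases Nat.eq_zero_or_pos t with rfl | t0
    · exact Or.inl ⟨rfl, W.le_of_mem_arc i1 i2 (by omega) (hS i i3)⟩
    · rcases eq_or_lt_of_le ht with rfl | tk
      · have := hT₀ i i3
        rw [← e] at this
        obtain ⟨j, ⟨j1, j2⟩, e⟩ := this
        rcases lt_or_ge j (a + N) with j3 | j3
        · have := W.cyc.inj (by omega) (by omega) e
          exact Or.inr ⟨rfl, Or.inl (by omega)⟩
        · rw [← W.cyc.per i] at e
          have := W.cyc.inj (by omega) (by omega) e
          exact Or.inr ⟨rfl, Or.inr (by omega)⟩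
      · exact absurd i3 (hm t i t0 tk)

/-- A connected set off the rim with rim neighbours in no common sector contains a star path. -/
theorem exists_star {D : Set V} (hD : ConnSet G D) (hDB : D ⊆ B) (hoff : ∀ d ∈ D, ∀ i, d ≠ h i)
    {s s' : ℤ} (hs : ∃ d ∈ D, G.Adj d (h s)) (hs' : ∃ d ∈ D, G.Adj d (h s'))
    (hco : ¬ Cosec G x h (h s) (h s')) :
    ∃ k q e₀ e₁ e₂ e₃ e₄ w, StarPath G x B h N q k e₀ e₁ e₂ e₃ e₄ w ∧ q '' Iic k ⊆ D := by
  classical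
  have ex : ∃ k p s s', PathOn G p k ∧ p '' Iic k ⊆ D ∧ G.Adj (p 0) (h s) ∧ G.Adj (p k) (h s') ∧
      ¬ Cosec G x h (h s) (h s') := by
    obtain ⟨a, ha, has⟩ := hs
    obtain ⟨b, hb, hbs⟩ := hs'
    obtain ⟨X, hX, k, p, hp, rfl, rfl, rfl⟩ := hD.exists_path ha hb
    exact ⟨k, p, s, s', hp, hX, has, hbs, hco⟩
  obtain ⟨p, t, t', hp, hpD, ht, ht', hco⟩ := Nat.find_spec ex
  have hmin : ∀ {m}, m < Nat.find ex → _ := fun {m} hm => Nat.find_min ex hm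
  set k := Nat.find ex with hk
  have P : OffPath G B h p k := ⟨hp, fun i hi => hDB (hpD ⟨i, hi, rfl⟩),
    fun i hi => hoff _ (hpD ⟨i, hi, rfl⟩)⟩
  rcases Nat.eq_zero_or_pos k with k0 | k0
  · rw [k0] at ht' P hpD
    have key : ∃ q e₀ e₁ e₂ e₃ e₄ w, StarPath G x B h N q 0 e₀ e₁ e₂ e₃ e₄ w ∧ q '' Iic 0 = {p 0} := by
      by_cases x1 : G.Adj x (h t)
      · by_cases x2 : G.Adj x (h t')
        · exact absurd (W.cosec_of_spokes (P.inB 0 le_rfl) ht ht' x1 x2) hco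
        · exact W.star_of_single (P.inB 0 le_rfl) (P.off 0 le_rfl) ht' ht (fun e => hco e.symm) x2
      · exact W.star_of_single (P.inB 0 le_rfl) (P.off 0 le_rfl) ht ht' hco x1
    obtain ⟨q, e₀, e₁, e₂, e₃, e₄, w, H1, H2⟩ := key
    refine ⟨0, q, e₀, e₁, e₂, e₃, e₄, w, H1, ?_⟩
    rw [H2]
    rintro _ rfl
    exact hpD ⟨0, by simp, rfl⟩
  · obtain ⟨q, e₀, e₁, e₂, e₃, e₄, w, H1, H2⟩ := W.star_of_minimal_path P k0 ht ht' hco (by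
      intro i j hij hj hne y y' hy hy'
      by_contra hc
      refine hmin (m := j - i) (by omega) ⟨fun t => p (i + t), y, y', hp.shift (by omega), ?_, hy, ?_, hc⟩
      · rintro _ ⟨m, hm, rfl⟩
        rw [mem_Iic] at hm
        exact hpD ⟨i + m, by rw [mem_Iic]; omega, rfl⟩
      · show G.Adj (p (i + (j - i))) (h y')
        rwa [show i + (j - i) = j by omega])
    exact ⟨k, q, e₀, e₁, e₂, e₃, e₄, w, H1, H2 ▸ hpD⟩

end HubWheel

end

theorem PathOn.connSet_initial {p : ℕ → V} {k j : ℕ} (hp : PathOn G p k) (hj : j ≤ k) :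
    ConnSet G (p '' Iic j) :=
  PathOn.connSet fun i hi => (hp i (i + 1) (by omega) (by omega)).2.2 rfl

theorem IPath.tail {X : Set V} {a b : V} (h : IPath G X a b) (hne : a ≠ b) :
    ConnSet G (X \ {b}) ∧ a ∈ X \ {b} ∧ ∃ v ∈ X \ {b}, G.Adj b v := by
  obtain ⟨k, p, hp, rfl, rfl, rfl⟩ := h
  have hk : k ≠ 0 := by rintro rfl; exact hne rfl
  have e : p '' Iic k \ {p k} = p '' Iic (k - 1) := by
    ext v
    simp only [mem_sdiff, mem_image, mem_Iic, mem_singleton_iff]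
    constructor
    · rintro ⟨⟨i, hi, rfl⟩, hn⟩
      exact ⟨i, by have : i ≠ k := fun e => hn (by rw [e]); omega, rfl⟩
    · rintro ⟨i, hi, rfl⟩
      exact ⟨⟨i, by omega, rfl⟩, (hp i k (by omega) le_rfl).1⟩
  rw [e]
  refine ⟨hp.connSet_initial (by omega), ⟨0, by simp, rfl⟩, p (k - 1), ⟨k - 1, by simp, rfl⟩, ?_⟩
  exact ((hp (k - 1) k (by omega) le_rfl).2.2 (by omega)).symm

theorem IPath.inner {X : Set V} {a b : V} (h : IPath G X a b) (hne : a ≠ b) (hadj : ¬ G.Adj a b) :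
    ConnSet G (X \ {a, b}) ∧ (∃ v ∈ X \ {a, b}, G.Adj a v) ∧ ∃ v ∈ X \ {a, b}, G.Adj b v := by
  obtain ⟨k, p, hp, rfl, rfl, rfl⟩ := h
  have hk : k ≠ 0 := by rintro rfl; exact hne rfl
  have hk1 : k ≠ 1 := by rintro rfl; exact hadj ((hp 0 1 (by omega) le_rfl).2.2 rfl)
  have e : p '' Iic k \ {p 0, p k} = p '' Icc 1 (k - 1) := by
    ext v
    simp only [mem_sdiff, mem_image, mem_Iic, mem_Icc, mem_insert_iff, mem_singleton_iff, not_or]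
    constructor
    · rintro ⟨⟨i, hi, rfl⟩, hn, hn'⟩
      have : i ≠ k := fun e => hn' (by rw [e])
      have : i ≠ 0 := fun e => hn (by rw [e])
      exact ⟨i, by omega, rfl⟩
    · rintro ⟨i, hi, rfl⟩
      exact ⟨⟨i, by omega, rfl⟩, (hp 0 i (by omega) (by omega)).1.symm,
        (hp i k (by omega) le_rfl).1⟩
  rw [e]
  refine ⟨(hp.iPath (by omega) (by omega)).connSet, ⟨p 1, ⟨1, by simp; omega, rfl⟩, ?_⟩, p (k - 1),
    ⟨k - 1, by simp; omega, rfl⟩, ?_⟩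
  · exact (hp 0 1 (by omega) (by omega)).2.2 rfl
  · exact ((hp (k - 1) k (by omega) le_rfl).2.2 (by omega)).symm

section

variable {x : V} {h : ℤ → V} {N : ℤ} {B : Set V} {n : ℕ}

theorem Five.order {e₀ e₁ e₂ e₃ e₄ : ℤ} (F : Five G x h N e₀ e₁ e₂ e₃ e₄) :
    e₀ < e₁ ∧ e₁ < e₂ ∧ e₂ < e₃ ∧ e₃ < e₄ ∧ e₄ < e₀ + N :=
  ⟨F.s₀.lt, F.s₁.lt, F.s₂.lt, F.s₃.lt, F.s₄.lt⟩

/-- A star path `p` together with a path `r` ending next to its last vertex. -/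
structure Config (G : SimpleGraph V) (x : V) (B : Set V) (h : ℤ → V) (N : ℤ) (p : ℕ → V) (k : ℕ)
    (r : ℕ → V) (m : ℕ) (e₀ e₁ e₂ e₃ e₄ u : ℤ) : Prop where
  star : StarPath G x B h N p k e₀ e₁ e₂ e₃ e₄ u
  path : OffPath G B h r m
  link : ∀ s ≤ m, ∀ t ≤ k, r s ≠ p t ∧ (G.Adj (r s) (p t) ↔ s = m ∧ t = k)
  later : ∀ s ≤ m, 0 < s → ∀ i, e₀ ≤ i → i < e₀ + N → G.Adj (r s) (h i) →
    i = e₀ ∨ (e₂ ≤ i ∧ i ≤ e₃)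

theorem StarPath.conn {p : ℕ → V} {k : ℕ} {e₀ e₁ e₂ e₃ e₄ u : ℤ}
    (S : StarPath G x B h N p k e₀ e₁ e₂ e₃ e₄ u) : ConnSet G (p '' Iic k) :=
  S.path.path.connSet_initial le_rfl

theorem StarPath.iPath {p : ℕ → V} {k : ℕ} {e₀ e₁ e₂ e₃ e₄ u : ℤ}
    (S : StarPath G x B h N p k e₀ e₁ e₂ e₃ e₄ u) : IPath G (p '' Iic k) (p 0) (p k) :=
  ⟨k, p, S.path.path, rfl, rfl, rfl⟩

/-- A star path consisting of one vertex avoids the spokes of the opposite sector. -/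
theorem StarPath.interior (W : HubWheel G x B h N n) {p : ℕ → V} {e₀ e₁ e₂ e₃ e₄ u : ℤ}
    (S : StarPath G x B h N p 0 e₀ e₁ e₂ e₃ e₄ u) : e₂ < u ∧ u + 1 < e₃ := by
  obtain ⟨o1, o2, o3, o4, o5⟩ := S.five.order
  have h1 := S.le
  have h2 := S.lt
  have a0 := (S.adj 0 le_rfl e₀ le_rfl (by omega)).2 (Or.inr ⟨rfl, rfl⟩)
  have au := (S.adj 0 le_rfl u (by omega) (by omega)).2 (Or.inl ⟨rfl, Or.inl rfl⟩)
  have au' := (S.adj 0 le_rfl (u + 1) (by omega) (by omega)).2 (Or.inl ⟨rfl, Or.inr rfl⟩)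
  have key : ∀ i, e₁ < i → i < e₄ → G.Adj (p 0) (h i) → ¬ G.Adj x (h i) := by
    intro i i1 i2 i3 i4
    have := W.clique (S.path.inB 0 le_rfl) a0 i3 S.five.s₀.left i4 (by omega) (by omega)
    omega
  constructor
  · by_contra hn
    obtain rfl : e₂ = u := by omega
    exact key _ (by omega) (by omega) au S.five.s₂.left
  · by_contra hn
    obtain rfl : u + 1 = e₃ := by omega
    exact key _ (by omega) (by omega) au' S.five.s₂.right

namespace Config

variable {p r : ℕ → V} {k m : ℕ} {e₀ e₁ e₂ e₃ e₄ u : ℤ}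
  (W : HubWheel G x B h N n) (C : Config G x B h N p k r m e₀ e₁ e₂ e₃ e₄ u)
include C

theorem rconn : ConnSet G (r '' Iic m) := C.path.path.connSet_initial le_rfl

theorem riPath : IPath G (r '' Iic m) (r 0) (r m) := ⟨m, r, C.path.path, rfl, rfl, rfl⟩

theorem joined : IPath G (r '' Iic m ∪ p '' Iic k) (r 0) (p 0) := by
  refine C.riPath.glue C.star.iPath.symm ((C.link m le_rfl k le_rfl).2.2 ⟨rfl, rfl⟩) ?_
  rintro _ ⟨s, hs, rfl⟩ _ ⟨t, ht, rfl⟩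
  refine ⟨(C.link s hs t ht).1, fun e => ?_⟩
  obtain ⟨rfl, rfl⟩ := (C.link s hs t ht).2.1 e
  exact ⟨rfl, rfl⟩

theorem joined_subset : r '' Iic m ∪ p '' Iic k ⊆ B := by
  rintro _ (⟨s, hs, rfl⟩ | ⟨t, ht, rfl⟩)
  · exact C.path.inB s hs
  · exact C.star.path.inB t ht

theorem joined_off : ∀ d ∈ r '' Iic m ∪ p '' Iic k, ∀ i, d ≠ h i := by
  rintro _ (⟨s, hs, rfl⟩ | ⟨t, ht, rfl⟩)
  · exact C.path.off s hs
  · exact C.star.path.off t ht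

include W

/-- The case where `r` starts at the middle spoke `e₁` and later sees the sector `[e₃, e₄]`. -/
theorem no_far_sector (hk : k = 0)
    (hr : ∀ s ≤ m, ∀ i, e₀ ≤ i → i < e₀ + N → G.Adj (r s) (h i) → i = e₁ ∨ (e₃ ≤ i ∧ i ≤ e₄))
    (h1 : G.Adj (r 0) (h e₁)) : False := by
  subst hk
  obtain ⟨o1, o2, o3, o4, o5⟩ := C.star.five.order
  have hu := C.star.le
  have hu' := C.star.lt
  have p0 := (C.star.adj 0 le_rfl e₀ le_rfl (by omega)).2 (Or.inr ⟨rfl, rfl⟩)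
  have pu := (C.star.adj 0 le_rfl u (by omega) (by omega)).2 (Or.inl ⟨rfl, Or.inl rfl⟩)
  have hlen : e₁ = e₀ + 1 := by
    obtain ⟨h2, -⟩ := W.reroute C.joined.connSet C.joined_subset C.joined_off o1 (by omega)
      ⟨p 0, Or.inr ⟨0, by simp, rfl⟩, p0⟩ ⟨r 0, Or.inl ⟨0, by simp, rfl⟩, h1⟩ (by
        rintro i i1 i2 _ (⟨s, hs, rfl⟩ | ⟨t, ht, rfl⟩) i3
        · have := hr s hs i (by omega) (by omega) i3; omega
        · have := (C.star.adj t ht i (by omega) (by omega)).1 i3; omega)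
    rw [C.star.five.s₀.cnt] at h2
    obtain ⟨-, i, i1, i2, i3, i4⟩ := h2 (by decide) (by decide)
    exact two_adjacent C.star.five.s₀.cnt C.star.five.s₀.left C.star.five.s₀.right o1 le_rfl le_rfl
      i1 i2 i3 i4
  have hp1 : ¬ G.Adj (h e₁) (p 0) := fun e => by
    have := (C.star.adj 0 le_rfl e₁ (by omega) (by omega)).1 e.symm; omega
  refine theta_of_sets W.cls (C.star.path.off 0 le_rfl e₁).symm hp1 (connSet_singleton (h e₀))
    C.rconn (W.cyc.conn (i := e₁ + 1) (j := u) (by omega)) ⟨_, rfl, ?_⟩ ⟨r 0, ⟨0, by simp, rfl⟩, h1.symm⟩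
    ⟨_, mem_arc le_rfl (by omega), W.cyc.adj_succ _⟩ ⟨_, rfl, p0⟩
    ⟨r m, ⟨m, by simp, rfl⟩, ((C.link m le_rfl 0 le_rfl).2.2 ⟨rfl, rfl⟩).symm⟩
    ⟨_, mem_arc (by omega) le_rfl, pu⟩ ?_ ?_ ?_
  · rw [hlen]; exact (W.cyc.adj_succ _).symm
  · rintro _ rfl _ ⟨s, hs, rfl⟩
    refine ⟨(C.path.off s hs _).symm, fun e => ?_⟩
    have := hr s hs e₀ le_rfl (by omega) e.symm; omega
  · have := W.cyc.far (i := e₀) (j := e₀) (k := e₁ + 1) (l := u) (by omega) (by omega)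
    simpa using this
  · rintro _ ⟨s, hs, rfl⟩ _ ⟨i, ⟨i1, i2⟩, rfl⟩
    refine ⟨C.path.off s hs _, fun e => ?_⟩
    have := hr s hs i (by omega) (by omega) e; omega

/-- The case where `r` sees the sector `[e₁, e₂]` and the spoke `e₄`. -/
theorem no_middle_sector (hk : k = 0)
    (hr : ∀ s ≤ m, ∀ i, e₀ ≤ i → i < e₀ + N → G.Adj (r s) (h i) → i = e₄ ∨ (e₁ ≤ i ∧ i ≤ e₂))
    (hs : ∃ s ≤ m, ∃ i, e₀ ≤ i ∧ i < e₀ + N ∧ G.Adj (r s) (h i) ∧ e₁ < i)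
    {z : ℤ} (h1 : G.Adj (r 0) (h z)) (hz : e₀ < z) (hz' : z < e₂) : False := by
  subst hk
  obtain ⟨o1, o2, o3, o4, o5⟩ := C.star.five.order
  obtain ⟨hu, hu'⟩ := C.star.interior W
  have p0 := (C.star.adj 0 le_rfl e₀ le_rfl (by omega)).2 (Or.inr ⟨rfl, rfl⟩)
  have pu := (C.star.adj 0 le_rfl (u + 1) (by omega) (by omega)).2 (Or.inl ⟨rfl, Or.inr rfl⟩)
  by_cases hw : ∃ s ≤ m, ∃ w, e₁ < w ∧ w ≤ e₂ ∧ G.Adj (r s) (h w)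
  · obtain ⟨s, hs, w, w1, w2, w3⟩ := hw
    obtain ⟨hpx, hpx'⟩ := W.far _ (C.star.path.inB 0 le_rfl)
    refine theta_of_sets W.cls hpx.symm hpx' (connSet_singleton (h e₀))
      (W.cyc.conn (i := u + 1) (j := e₃) (by omega))
      (C.rconn.union (W.cyc.conn (i := w) (j := e₂) w2) ⟨s, hs, rfl⟩ (mem_arc le_rfl w2) (Or.inr w3))
      ⟨_, rfl, C.star.five.s₀.left⟩ ⟨_, mem_arc (by omega) le_rfl, C.star.five.s₂.right⟩
      ⟨_, Or.inr (mem_arc w2 le_rfl), C.star.five.s₂.left⟩ ⟨_, rfl, p0⟩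
      ⟨_, mem_arc le_rfl (by omega), pu⟩
      ⟨r m, Or.inl ⟨m, by simp, rfl⟩, ((C.link m le_rfl 0 le_rfl).2.2 ⟨rfl, rfl⟩).symm⟩ ?_ ?_ ?_
    · have := W.cyc.far (i := e₀) (j := e₀) (k := u + 1) (l := e₃) (by omega) (by omega)
      simpa using this
    · refine Far.symm (far_union ?_ ?_)
      · rintro _ ⟨s, hs, rfl⟩ _ rfl
        refine ⟨C.path.off s hs _, fun e => ?_⟩
        have := hr s hs e₀ le_rfl (by omega) e; omega
      · have := W.cyc.far (i := e₀) (j := e₀) (k := w) (l := e₂) (by omega) (by omega)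
        rw [Icc_self, image_singleton] at this
        exact this.symm
    · refine Far.symm (far_union ?_ (W.cyc.far (by omega) (by omega)))
      rintro _ ⟨s, hs, rfl⟩ _ ⟨i, ⟨i1, i2⟩, rfl⟩
      refine ⟨C.path.off s hs _, fun e => ?_⟩
      have := hr s hs i (by omega) (by omega) e; omega
  · push Not at hw
    obtain rfl : z = e₁ := by
      rcases hr 0 (Nat.zero_le _) z (by omega) (by omega) h1 with h2 | h2
      · omega
      · by_contra hne
        exact hw 0 (Nat.zero_le _) z (by omega) (by omega) h1
    obtain ⟨s, hs, i, i1, i2, i3, i4⟩ := hs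
    obtain rfl : i = e₄ := by
      rcases hr s hs i i1 i2 i3 with h2 | h2
      · exact h2
      · exact absurd i3 (hw s hs i i4 h2.2)
    obtain ⟨h2, -⟩ := W.reroute C.rconn (fun d hd => C.joined_subset (Or.inl hd))
      (fun d hd => C.joined_off d (Or.inl hd)) (i := z) (j := i) (by omega) (by omega)
      ⟨r 0, ⟨0, by simp, rfl⟩, h1⟩ ⟨r s, ⟨s, hs, rfl⟩, i3⟩ (by
        rintro j j1 j2 _ ⟨t, ht, rfl⟩ j3
        rcases hr t ht j (by omega) (by omega) j3 with h2 | h2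
        · omega
        · exact hw t ht j j1 h2.2 j3)
    have c1 := C.star.five.s₁.cnt
    have c2 := C.star.five.s₂.cnt
    have c3 := C.star.five.s₃.cnt
    have c4 := cnt_join (G := G) (x := x) (h := h) (i := z) (m := e₂) (j := e₃) (by omega) (by omega)
      C.star.five.s₂.left
    have c5 := cnt_join (G := G) (x := x) (h := h) (i := z) (m := e₃) (j := i) (by omega) (by omega)
      C.star.five.s₂.right
    have c6 : cnt G x h z i = 4 := by omega
    rw [c6] at h2
    have := (h2 (by decide) (by decide)).1
    omega

end Config

end

section

variable {x : V} {h : ℤ → V} {N : ℤ} {B : Set V} {n : ℕ}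

/-- A configuration in which `r` starts in the sector `[e₀, e₁]`, its last neighbour there being
`z`, and has no other rim neighbours except possibly the spokes `e₀` and `e₃`. -/
structure SideConfig (G : SimpleGraph V) (x : V) (B : Set V) (h : ℤ → V) (N : ℤ) (p : ℕ → V) (k : ℕ)
    (r : ℕ → V) (m : ℕ) (e₀ e₁ e₂ e₃ e₄ u z : ℤ) : Prop
    extends Config G x B h N p k r m e₀ e₁ e₂ e₃ e₄ u where
  hz : G.Adj (r 0) (h z)
  gt : e₀ < z
  le : z ≤ e₁
  hit : ∀ s ≤ m, ∀ i, e₀ ≤ i → i < e₀ + N → G.Adj (r s) (h i) → (s = 0 ∧ i ≤ z) ∨ i = e₀ ∨ i = e₃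

namespace SideConfig

variable {p r : ℕ → V} {k m : ℕ} {e₀ e₁ e₂ e₃ e₄ u z : ℤ}
  (W : HubWheel G x B h N n) (C : SideConfig G x B h N p k r m e₀ e₁ e₂ e₃ e₄ u z)
include C

theorem pu : G.Adj (p 0) (h u) := by
  obtain ⟨o1, o2, o3, o4, o5⟩ := C.star.five.order
  have := C.star.le
  have := C.star.lt
  exact (C.star.adj 0 (Nat.zero_le _) u (by omega) (by omega)).2 (Or.inl ⟨rfl, Or.inl rfl⟩)

theorem pu' : G.Adj (p 0) (h (u + 1)) := by
  obtain ⟨o1, o2, o3, o4, o5⟩ := C.star.five.order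
  have := C.star.le
  have := C.star.lt
  exact (C.star.adj 0 (Nat.zero_le _) _ (by omega) (by omega)).2 (Or.inl ⟨rfl, Or.inr rfl⟩)

theorem pe : G.Adj (p k) (h e₀) := by
  obtain ⟨o1, o2, o3, o4, o5⟩ := C.star.five.order
  exact (C.star.adj k le_rfl _ (by omega) (by omega)).2 (Or.inr ⟨rfl, rfl⟩)

theorem rp : G.Adj (r m) (p k) := (C.link m le_rfl k le_rfl).2.2 ⟨rfl, rfl⟩

include W

theorem arc_path : ∀ v ∈ r '' Iic m ∪ p '' Iic k, ∀ w ∈ h '' Icc z u,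
    v ≠ w ∧ (G.Adj v w ↔ (v = r 0 ∧ w = h z) ∨ (v = p 0 ∧ w = h u)) := by
  obtain ⟨o1, o2, o3, o4, o5⟩ := C.star.five.order
  have := C.star.le
  have := C.star.lt
  have := C.gt
  rintro _ hv _ ⟨i, ⟨i1, i2⟩, rfl⟩
  refine ⟨C.joined_off _ hv i, ?_⟩
  rw [W.cyc.eq_iff (by omega) (by omega), W.cyc.eq_iff (by omega) (by omega)]
  rcases hv with ⟨s, hs, rfl⟩ | ⟨t, ht, rfl⟩
  · rw [C.path.eq_iff hs (Nat.zero_le _)]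
    have hne := (C.link s hs 0 (Nat.zero_le _)).1
    constructor
    · intro e
      have := C.hit s hs i (by omega) (by omega) e
      exact Or.inl (by omega)
    · rintro (⟨rfl, rfl⟩ | ⟨e, -⟩)
      · exact C.hz
      · exact absurd e hne
  · rw [C.star.path.eq_iff ht (Nat.zero_le _)]
    have hne := (C.link 0 (Nat.zero_le _) t ht).1
    constructor
    · intro e
      have := (C.star.adj t ht i (by omega) (by omega)).1 e
      exact Or.inr (by omega)
    · rintro (⟨e, -⟩ | ⟨rfl, rfl⟩)
      · exact absurd e.symm hne
      · exact C.pu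

theorem spokes_adjacent : e₂ = e₁ + 1 := by
  obtain ⟨o1, o2, o3, o4, o5⟩ := C.star.five.order
  have hu := C.star.le
  have hu' := C.star.lt
  have hz := C.gt
  have hz' := C.le
  have c1 := cnt_split (G := G) (x := x) (h := h) (i := z) (j := e₁ - 1) (l := u) (by omega) (by omega)
  have c2 := cnt_split (G := G) (x := x) (h := h) (i := e₁) (j := e₂) (l := u) (by omega) (by omega)
  have c3 := cnt_eq_zero (G := G) (x := x) (h := h) (i := z) (j := e₁ - 1)
    fun i h1 h2 => C.star.five.s₀.mid i (by omega) (by omega)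
  have c4 := cnt_eq_zero (G := G) (x := x) (h := h) (i := e₂ + 1) (j := u)
    fun i h1 h2 => C.star.five.s₂.mid i (by omega) (by omega)
  have c5 := C.star.five.s₁.cnt
  rw [sub_add_cancel] at c1
  have c6 : cnt G x h z u = 2 := by omega
  obtain ⟨h2, -⟩ := W.reroute C.joined.connSet C.joined_subset C.joined_off (i := z) (j := u)
    (by omega) (by omega) ⟨r 0, Or.inl ⟨0, by simp, rfl⟩, C.hz⟩ ⟨p 0, Or.inr ⟨0, by simp, rfl⟩, C.pu⟩ (by
      intro i i1 i2 d hd e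
      have := (C.arc_path W d hd (h i) (mem_arc i1.le i2.le)).2.1 e
      rw [W.cyc.eq_iff (by omega) (by omega), W.cyc.eq_iff (by omega) (by omega)] at this
      omega)
  rw [c6] at h2
  obtain ⟨-, i, i1, i2, i3, i4⟩ := h2 (by decide) (by decide)
  exact two_adjacent c6 C.star.five.s₁.left C.star.five.s₁.right o2 hz' hu i1 i2 i3 i4

/-- If `r` misses `e₃`, its only neighbour of `e₀` is its last vertex. -/
theorem meets (hno : ∀ s ≤ m, ¬ G.Adj (r s) (h e₃)) :
    G.Adj (r m) (h e₀) ∧ (∀ s ≤ m, G.Adj (r s) (h e₀) → s = m) ∧ e₀ + 1 < z := by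
  obtain ⟨o1, o2, o3, o4, o5⟩ := C.star.five.order
  have hu := C.star.le
  have hu' := C.star.lt
  have hz := C.gt
  have hz' := C.le
  have he := C.spokes_adjacent W
  have hrp := (C.link 0 (Nat.zero_le _) 0 (Nat.zero_le _)).1
  have K₁ : IsHole G ((r '' Iic m ∪ p '' Iic k) ∪ h '' Icc z u) :=
    close_hole C.joined (W.cyc.iPath (by omega) (by omega)) (C.arc_path W)
      (Or.inl ⟨hrp, W.cyc.ne _ _ (by omega) (by omega)⟩)
  have Y : IPath G (h '' Icc z e₁ ∪ ({x} ∪ h '' Icc (u + 1) e₃)) (h z) (h (u + 1)) := by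
    refine (W.cyc.iPath hz' (by omega)).glue (c := x) ((IPath.single x).glue
      (W.cyc.iPath (i := u + 1) (j := e₃) hu' (by omega)).symm C.star.five.s₂.right ?_)
      C.star.five.s₀.right.symm ?_
    · rintro _ rfl _ ⟨i, ⟨i1, i2⟩, rfl⟩
      refine ⟨(W.ne i).symm, fun e => ⟨rfl, ?_⟩⟩
      rw [W.cyc.eq_iff (by omega) (by omega)]
      by_contra hne
      exact C.star.five.s₂.mid i (by omega) (by omega) e
    · rintro _ ⟨i, ⟨i1, i2⟩, rfl⟩ _ (rfl | hw)
      · refine ⟨W.ne i, fun e => ⟨?_, rfl⟩⟩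
        rw [W.cyc.eq_iff (by omega) (by omega)]
        by_contra hne
        exact C.star.five.s₀.mid i (by omega) (by omega) e.symm
      · have := W.cyc.far (i := z) (j := e₁) (k := u + 1) (l := e₃) (by omega) (by omega) _
          (mem_arc i1 i2) _ hw
        exact ⟨this.1, fun e => absurd e this.2⟩
  have K₂ : IsHole G ((r '' Iic m ∪ p '' Iic k) ∪ (h '' Icc z e₁ ∪ ({x} ∪ h '' Icc (u + 1) e₃))) := by
    refine close_hole C.joined Y ?_ (Or.inl ⟨hrp, W.cyc.ne _ _ (by omega) (by omega)⟩)
    rintro v hv w (hw | rfl | ⟨i, ⟨i1, i2⟩, rfl⟩)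
    · obtain ⟨a1, a2⟩ := C.arc_path W v hv w (image_mono (Icc_subset_Icc_right (by omega)) hw)
      refine ⟨a1, a2.trans (or_congr Iff.rfl (and_congr Iff.rfl ?_))⟩
      obtain ⟨i, ⟨i1, i2⟩, rfl⟩ := hw
      rw [W.cyc.eq_iff (by omega) (by omega), W.cyc.eq_iff (by omega) (by omega)]
      omega
    · have := W.far v (C.joined_subset hv)
      refine ⟨this.1, ?_⟩
      have e1 := W.ne z
      have e2 := W.ne (u + 1)
      have := this.2
      rw [G.adj_comm]
      tauto
    · refine ⟨C.joined_off _ hv i, ?_⟩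
      rw [W.cyc.eq_iff (by omega) (by omega), W.cyc.eq_iff (by omega) (by omega)]
      rcases hv with ⟨s, hs, rfl⟩ | ⟨t, ht, rfl⟩
      · have hne := (C.link s hs 0 (Nat.zero_le _)).1
        constructor
        · intro e
          rcases C.hit s hs i (by omega) (by omega) e with a | a | rfl
          · omega
          · omega
          · exact absurd e (hno s hs)
        · rintro (⟨-, e⟩ | ⟨e, -⟩)
          · omega
          · exact absurd e hne
      · rw [C.star.path.eq_iff ht (Nat.zero_le _)]
        constructor
        · intro e
          have := (C.star.adj t ht i (by omega) (by omega)).1 e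
          exact Or.inr (by omega)
        · rintro (⟨-, e⟩ | ⟨rfl, rfl⟩)
          · omega
          · exact C.pu'
  set T := r '' Iic m ∪ p '' Iic k with hT
  have hx : ∀ {i j k : ℤ}, i < j → k + 1 < i + N → h i ∉ h '' Icc j k := by
    rintro i j k h1 h2 ⟨t, ⟨t1, t2⟩, e⟩
    have := W.cyc.inj (by omega) (by omega) e
    omega
  have n₁ : h e₀ ∉ T ∪ h '' Icc z u := by
    rintro (a | a)
    · exact C.joined_off _ a _ rfl
    · exact hx (by omega) (by omega) a
  have n₂ : h e₀ ∉ T ∪ (h '' Icc z e₁ ∪ ({x} ∪ h '' Icc (u + 1) e₃)) := by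
    rintro (a | a | a | a)
    · exact C.joined_off _ a _ rfl
    · exact hx (by omega) (by omega) a
    · exact W.ne _ a
    · exact hx (by omega) (by omega) a
  have xT : ∀ v ∈ T ∪ h '' Icc z u, v ≠ x := by
    rintro _ (a | ⟨i, -, rfl⟩)
    · exact (W.far _ (C.joined_subset a)).1
    · exact W.ne i
  have hE : holeNbrs G (T ∪ (h '' Icc z e₁ ∪ ({x} ∪ h '' Icc (u + 1) e₃))) (h e₀) =
      insert x (holeNbrs G (T ∪ h '' Icc z u) (h e₀)) := by
    have f1 := W.cyc.far (i := e₀) (j := e₀) (k := e₁ + 1) (l := e₃) (by omega) (by omega) (h e₀)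
      (mem_arc le_rfl le_rfl)
    ext v
    simp only [holeNbrs, mem_ofPred_eq, mem_insert_iff]
    constructor
    · rintro ⟨a | a | a | a, hv⟩
      · exact Or.inr ⟨Or.inl a, hv⟩
      · exact Or.inr ⟨Or.inr (image_mono (Icc_subset_Icc_right (by omega)) a), hv⟩
      · exact Or.inl a
      · exact absurd hv (f1 v (image_mono (Icc_subset_Icc_left (by omega)) a)).2
    · rintro (rfl | ⟨a | ⟨i, ⟨i1, i2⟩, rfl⟩, hv⟩)
      · exact ⟨Or.inr (Or.inr (Or.inl rfl)), C.star.five.s₀.left.symm⟩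
      · exact ⟨Or.inl a, hv⟩
      · refine ⟨Or.inr (Or.inl (mem_arc i1 ?_)), hv⟩
        by_contra hn
        exact (f1 (h i) (mem_arc (by omega) (by omega))).2 hv
  have hpk : p k ∈ holeNbrs G (T ∪ h '' Icc z u) (h e₀) :=
    ⟨Or.inl (Or.inr ⟨k, by simp, rfl⟩), C.pe.symm⟩
  set A := holeNbrs G (T ∪ h '' Icc z u) (h e₀) with hA
  have hfin : A.Finite := by
    refine Set.Finite.subset ?_ (fun v hv => hv.1 : A ⊆ T ∪ h '' Icc z u)
    exact (((finite_Iic m).image _).union ((finite_Iic k).image _)).union ((finite_Icc z u).image _)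
  have hxA : x ∉ A := fun e => xT x e.1 rfl
  have hpos : 0 < A.ncard := (ncard_pos hfin).2 ⟨_, hpk⟩
  have hA2 : A.ncard = 2 ∧ ∃ v ∈ A, G.Adj (p k) v := by
    rcases Nat.even_or_odd A.ncard with ev | od
    · obtain ⟨a2, a, ha, b, hb, h1, h2, h3⟩ := hole_parity W.cls K₁ n₁ ev hpos
      replace a2 : A.ncard = 2 := a2
      refine ⟨a2, ?_⟩
      have ha' : a ∈ A := ⟨ha, h1⟩
      have hb' : b ∈ A := ⟨hb, h2⟩
      by_cases e : p k = a
      · exact ⟨b, hb', e ▸ h3⟩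
      by_cases e' : p k = b
      · exact ⟨a, ha', e' ▸ h3.symm⟩
      · have : ({p k, a, b} : Set V).ncard ≤ A.ncard := by
          refine ncard_le_ncard ?_ hfin
          rintro v (rfl | rfl | rfl) <;> assumption
        rw [Set.ncard_eq_three.2 ⟨_, _, _, e, e', h3.ne, rfl⟩] at this
        omega
    · exfalso
      have e1 := ncard_insert_of_notMem hxA hfin
      obtain ⟨a2, a, ha, b, hb, h1, h2, h3⟩ := hole_parity W.cls K₂ n₂
        (by rw [hE, e1]; exact od.add_one) (by rw [hE, e1]; omega)
      have ha' : a ∈ insert x A := hE ▸ ⟨ha, h1⟩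
      have hb' : b ∈ insert x A := hE ▸ ⟨hb, h2⟩
      rw [hE, e1] at a2
      obtain ⟨c, hc⟩ := ncard_eq_one.1 (by omega : A.ncard = 1)
      have hpx := W.far _ (C.star.path.inB k le_rfl)
      rw [hc] at ha' hb' hpk
      obtain rfl : p k = c := hpk
      rcases ha' with rfl | rfl <;> rcases hb' with rfl | rfl
      · exact h3.ne rfl
      · exact hpx.2 h3
      · exact hpx.2 h3.symm
      · exact h3.ne rfl
  obtain ⟨a2, v, hv, pv⟩ := hA2
  have hvr : v = r m := by
    obtain ⟨(⟨s, hs, rfl⟩ | ⟨t, ht, rfl⟩) | ⟨i, ⟨i1, i2⟩, rfl⟩, hv2⟩ := hv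
    · rw [((C.link s hs k le_rfl).2.1 pv.symm).1]
    · have := (C.star.adj t ht e₀ le_rfl (by omega)).1 hv2.symm
      have ht' : t = k := by omega
      subst ht'
      exact absurd pv (G.loopless.irrefl _)
    · have := (C.star.adj k le_rfl i (by omega) (by omega)).1 pv
      have hiu : i = u := by omega
      subst hiu
      exact absurd hv2 (W.cyc.far (i := e₀) (j := e₀) (k := i) (l := i) (by omega) (by omega) _
        (mem_arc le_rfl le_rfl) _ (mem_arc le_rfl le_rfl)).2
  subst hvr
  have hall : ∀ w ∈ A, w = p k ∨ w = r m := by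
    intro w hw
    by_contra hn
    push Not at hn
    have : ({w, p k, r m} : Set V).ncard ≤ A.ncard := by
      refine ncard_le_ncard ?_ hfin
      rintro v (rfl | rfl | rfl) <;> assumption
    rw [Set.ncard_eq_three.2 ⟨_, _, _, hn.1, hn.2, C.rp.ne.symm, rfl⟩] at this
    omega
  refine ⟨hv.2.symm, fun s hs e => ?_, ?_⟩
  · rcases hall (r s) ⟨Or.inl (Or.inl ⟨s, hs, rfl⟩), e.symm⟩ with a | a
    · exact absurd a (C.link s hs k le_rfl).1
    · exact (C.path.eq_iff hs le_rfl).1 a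
  · by_contra hn
    obtain rfl : z = e₀ + 1 := by omega
    rcases hall (h (e₀ + 1)) ⟨Or.inr (mem_arc le_rfl (by omega)), W.cyc.adj_succ _⟩ with a | a
    · exact C.star.path.off k le_rfl _ a.symm
    · exact C.path.off m le_rfl _ a.symm

end SideConfig

end

section

variable {x : V} {h : ℤ → V} {N : ℤ} {B : Set V} {n : ℕ}

namespace SideConfig

variable {p r : ℕ → V} {k m : ℕ} {e₀ e₁ e₂ e₃ e₄ u z : ℤ}
  (W : HubWheel G x B h N n) (C : SideConfig G x B h N p k r m e₀ e₁ e₂ e₃ e₄ u z)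
include W C

theorem exists_hit : ∃ s ≤ m, G.Adj (r s) (h e₃) := by
  by_contra hno
  push Not at hno
  obtain ⟨o1, o2, o3, o4, o5⟩ := C.star.five.order
  have hu := C.star.le
  have hu' := C.star.lt
  have hz := C.gt
  have hz' := C.le
  obtain ⟨hm, hm', hz1⟩ := C.meets W hno
  have per : h (e₀ + N) = h e₀ := W.cyc.per e₀
  have rhit : ∀ s ≤ m, ∀ i, z ≤ i → i ≤ e₀ + N →
      (G.Adj (r s) (h i) ↔ (s = 0 ∧ i = z) ∨ (s = m ∧ i = e₀ + N)) := by
    intro s hs i i1 i2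
    rcases eq_or_lt_of_le i2 with rfl | i2
    · rw [per]
      constructor
      · intro e; exact Or.inr ⟨hm' s hs e, rfl⟩
      · rintro (⟨-, e⟩ | ⟨rfl, -⟩)
        · omega
        · exact hm
    · constructor
      · intro e
        rcases C.hit s hs i (by omega) i2 e with a | a | rfl
        · exact Or.inl (by omega)
        · omega
        · exact absurd e (hno s hs)
      · rintro (⟨rfl, rfl⟩ | ⟨-, e⟩)
        · exact C.hz
        · omega
  have phit : ∀ t ≤ k, ∀ i, z ≤ i → i ≤ e₀ + N → (G.Adj (p t) (h i) ↔
      (t = 0 ∧ (i = u ∨ i = u + 1)) ∨ (t = k ∧ i = e₀ + N)) := by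
    intro t ht i i1 i2
    rcases eq_or_lt_of_le i2 with rfl | i2
    · rw [per, C.star.adj t ht e₀ le_rfl (by omega)]; omega
    · rw [C.star.adj t ht i (by omega) i2]; omega
  rcases Nat.eq_zero_or_pos k with rfl | hk
  · have K : IsHole G (h '' Icc z (e₀ + N) ∪ r '' Iic m) := by
      refine close_hole (W.cyc.iPath (by omega) (by omega)) C.riPath ?_
        (Or.inr (W.cyc.far (i := z) (j := z) (k := e₀ + N) (l := e₀ + N) (by omega) (by omega) _
          (mem_arc le_rfl le_rfl) _ (mem_arc le_rfl le_rfl)))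
      rintro _ ⟨i, ⟨i1, i2⟩, rfl⟩ _ ⟨s, hs, rfl⟩
      refine ⟨(C.path.off s hs i).symm, ?_⟩
      rw [G.adj_comm, rhit s hs i i1 i2, W.cyc.eq_iff (by omega) (by omega),
        W.cyc.eq_iff (by omega) (by omega), C.path.eq_iff hs (Nat.zero_le _), C.path.eq_iff hs le_rfl]
      tauto
    obtain ⟨h1, h2⟩ := C.star.interior W
    refine no_four_nbrs W.cls K (y := p 0) (a := r m) (b := h (e₀ + N)) (c := h u) (d := h (u + 1))
      ?_ ?_ (C.path.off m le_rfl _) (C.path.off m le_rfl _) (C.path.off m le_rfl _)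
      (W.cyc.ne _ _ (by omega) (by omega)).symm (W.cyc.ne _ _ (by omega) (by omega)).symm
      (W.cyc.ne _ _ (by omega) (by omega))
    · rintro (⟨i, -, e⟩ | ⟨s, hs, e⟩)
      · exact C.star.path.off 0 le_rfl i e.symm
      · exact (C.link s hs 0 le_rfl).1 e
    · ext v
      simp only [holeNbrs, mem_ofPred_eq, mem_insert_iff, mem_singleton_iff]
      constructor
      · rintro ⟨⟨i, ⟨i1, i2⟩, rfl⟩ | ⟨s, hs, rfl⟩, hv⟩
        · rcases (phit 0 le_rfl i i1 i2).1 hv with ⟨-, rfl | rfl⟩ | ⟨-, rfl⟩ <;> simp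
        · rw [((C.link s hs 0 le_rfl).2.1 hv.symm).1]; simp
      · rintro (rfl | rfl | rfl | rfl)
        · exact ⟨Or.inr ⟨m, by simp, rfl⟩, C.rp.symm⟩
        · exact ⟨Or.inl (mem_arc (by omega) le_rfl), (phit 0 le_rfl _ (by omega) le_rfl).2
            (Or.inr ⟨rfl, rfl⟩)⟩
        · exact ⟨Or.inl (mem_arc (by omega) (by omega)), C.pu⟩
        · exact ⟨Or.inl (mem_arc (by omega) (by omega)), C.pu'⟩
  · have h₁₂ : ∀ v ∈ h '' Icc (u + 1) (e₀ + N), ∀ w ∈ r '' Iic m ∪ h '' Icc z u,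
        v ≠ w ∧ (G.Adj v w ↔ (v = h (e₀ + N) ∧ w = r m) ∨ (v = h (u + 1) ∧ w = h u)) := by
      rintro _ ⟨i, ⟨i1, i2⟩, rfl⟩ _ (⟨s, hs, rfl⟩ | ⟨j, ⟨j1, j2⟩, rfl⟩)
      · refine ⟨(C.path.off s hs i).symm, ?_⟩
        rw [G.adj_comm, rhit s hs i (by omega) i2, W.cyc.eq_iff (by omega) (by omega),
          W.cyc.eq_iff (by omega) (by omega), C.path.eq_iff hs le_rfl]
        have := C.path.off s hs u
        constructor
        · rintro (a | a)
          · omega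
          · exact Or.inl ⟨a.2, a.1⟩
        · rintro (a | a)
          · exact Or.inr ⟨a.2, a.1⟩
          · exact absurd a.2 this
      · refine ⟨(W.cyc.ne j i (by omega) (by omega)).symm, ?_⟩
        have := C.path.off m le_rfl j
        rw [G.adj_comm, W.cyc.adj j i (by omega) (by omega), W.cyc.eq_iff (by omega) (by omega),
          W.cyc.eq_iff (by omega) (by omega), W.cyc.eq_iff (by omega) (by omega)]
        constructor
        · intro a; exact Or.inr (by omega)
        · rintro (a | a)
          · exact absurd a.2.symm this
          · omega
    have h₁₃ : ∀ v ∈ h '' Icc (u + 1) (e₀ + N), ∀ w ∈ p '' Iic k,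
        v ≠ w ∧ (G.Adj v w ↔ (v = h (e₀ + N) ∧ w = p k) ∨ (v = h (u + 1) ∧ w = p 0)) := by
      rintro _ ⟨i, ⟨i1, i2⟩, rfl⟩ _ ⟨t, ht, rfl⟩
      refine ⟨(C.star.path.off t ht i).symm, ?_⟩
      rw [G.adj_comm, phit t ht i (by omega) i2, W.cyc.eq_iff (by omega) (by omega),
        W.cyc.eq_iff (by omega) (by omega), C.star.path.eq_iff ht le_rfl,
        C.star.path.eq_iff ht (Nat.zero_le _)]
      omega
    have h₂₃ : ∀ v ∈ r '' Iic m ∪ h '' Icc z u, ∀ w ∈ p '' Iic k,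
        v ≠ w ∧ (G.Adj v w ↔ (v = r m ∧ w = p k) ∨ (v = h u ∧ w = p 0)) := by
      rintro _ (⟨s, hs, rfl⟩ | ⟨j, ⟨j1, j2⟩, rfl⟩) _ ⟨t, ht, rfl⟩
      · refine ⟨(C.link s hs t ht).1, ?_⟩
        rw [(C.link s hs t ht).2, C.path.eq_iff hs le_rfl, C.star.path.eq_iff ht le_rfl]
        have := C.path.off s hs u
        tauto
      · refine ⟨(C.star.path.off t ht j).symm, ?_⟩
        rw [G.adj_comm, phit t ht j j1 (by omega), W.cyc.eq_iff (by omega) (by omega),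
          C.star.path.eq_iff ht le_rfl, C.star.path.eq_iff ht (Nat.zero_le _)]
        have := C.path.off m le_rfl j
        constructor
        · rintro a; exact Or.inr (by omega)
        · rintro (a | a)
          · exact absurd a.1.symm this
          · omega
    exact prism_of_sets W.cls (W.cyc.conn (by omega))
      (C.rconn.union (W.cyc.conn (i := z) (j := u) (by omega)) ⟨0, by simp, rfl⟩
        (mem_arc le_rfl (by omega)) (Or.inr C.hz)) C.star.conn
      (mem_arc (by omega) le_rfl) (Or.inl ⟨m, by simp, rfl⟩) ⟨k, by simp, rfl⟩
      (mem_arc le_rfl (by omega)) (Or.inr (mem_arc (by omega) le_rfl)) ⟨0, by simp, rfl⟩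
      (W.cyc.ne _ _ (by omega) (by omega)).symm (C.path.off m le_rfl _)
      (fun e => by have := (C.star.path.eq_iff le_rfl (Nat.zero_le _)).1 e; omega) h₁₂ h₁₃ h₂₃

end SideConfig

end

section

variable {x : V} {h : ℤ → V} {N : ℤ} {B : Set V} {n : ℕ}

theorem Five.cnt_three {e₀ e₁ e₂ e₃ e₄ : ℤ} (F : Five G x h N e₀ e₁ e₂ e₃ e₄) :
    cnt G x h e₀ e₃ = 4 := by
  obtain ⟨o1, o2, o3, o4, o5⟩ := F.order
  have c1 := F.s₀.cnt
  have c2 := F.s₁.cnt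
  have c3 := F.s₂.cnt
  have c4 := cnt_join (G := G) (x := x) (h := h) (i := e₀) (m := e₁) (j := e₂) (by omega) (by omega)
    F.s₀.right
  have c5 := cnt_join (G := G) (x := x) (h := h) (i := e₀) (m := e₂) (j := e₃) (by omega) (by omega)
    F.s₂.left
  omega

namespace SideConfig

variable {p r : ℕ → V} {k m : ℕ} {e₀ e₁ e₂ e₃ e₄ u z : ℤ}
  (W : HubWheel G x B h N n) (C : SideConfig G x B h N p k r m e₀ e₁ e₂ e₃ e₄ u z)
include W C

theorem far_spoke : p k ≠ h e₃ ∧ ¬ G.Adj (p k) (h e₃) := by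
  obtain ⟨o1, o2, o3, o4, o5⟩ := C.star.five.order
  refine ⟨C.star.path.off k le_rfl _, fun e => ?_⟩
  have := (C.star.adj k le_rfl e₃ (by omega) (by omega)).1 e
  have hu := C.star.le
  have hu' := C.star.lt
  obtain ⟨rfl, -⟩ : k = 0 ∧ e₃ = u + 1 := by omega
  have := C.star.interior W
  omega

theorem spoke_path : IPath G (p '' Iic k ∪ h '' Icc (u + 1) e₃) (p k) (h e₃) := by
  obtain ⟨o1, o2, o3, o4, o5⟩ := C.star.five.order
  have hu := C.star.le
  have hu' := C.star.lt
  refine C.star.iPath.symm.glue (W.cyc.iPath (i := u + 1) (j := e₃) hu' (by omega)) C.pu' ?_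
  rintro _ ⟨t, ht, rfl⟩ _ ⟨i, ⟨i1, i2⟩, rfl⟩
  refine ⟨C.star.path.off t ht i, fun e => ?_⟩
  have := (C.star.adj t ht i (by omega) (by omega)).1 e
  obtain ⟨rfl, rfl⟩ : t = 0 ∧ i = u + 1 := by omega
  exact ⟨rfl, rfl⟩

/-- If `r` sees `e₃`, every neighbour of `e₀` on `r` from there on is the last vertex of `r`. -/
theorem no_early {l f : ℕ} (hl : G.Adj (r l) (h e₃)) (hlf : l ≤ f) (hf : f < m) :
    ¬ G.Adj (r f) (h e₀) := by
  intro e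
  obtain ⟨o1, o2, o3, o4, o5⟩ := C.star.five.order
  have hu := C.star.le
  have hu' := C.star.lt
  have hz := C.gt
  have hz' := C.le
  obtain ⟨c2, m2, t2⟩ := (C.spoke_path W).tail (C.far_spoke W).1
  have cf := W.cyc.far (i := e₀) (j := e₀) (k := u + 1) (l := e₃) (by omega) (by omega)
    (h e₀) (mem_arc le_rfl le_rfl)
  have f3 := cf _ (mem_arc hu' le_rfl)
  refine theta_of_sets W.cls f3.1 f3.2 (connSet_singleton x) (C.path.conn hlf hf.le) c2
    ⟨x, rfl, C.star.five.s₀.left.symm⟩ ⟨_, ⟨f, ⟨hlf, le_rfl⟩, rfl⟩, e.symm⟩ ⟨p k, m2, C.pe.symm⟩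
    ⟨x, rfl, C.star.five.s₂.right.symm⟩ ⟨_, ⟨l, ⟨le_rfl, hlf⟩, rfl⟩, hl.symm⟩ t2 ?_ ?_ ?_
  · rintro _ rfl _ ⟨s, ⟨s1, s2⟩, rfl⟩
    have := W.far _ (C.path.inB s (by omega))
    exact ⟨this.1.symm, this.2⟩
  · rintro _ rfl _ ⟨⟨t, ht, rfl⟩ | ⟨i, ⟨i1, i2⟩, rfl⟩, hn⟩
    · have := W.far _ (C.star.path.inB t ht)
      exact ⟨this.1.symm, this.2⟩
    · refine ⟨(W.ne i).symm, C.star.five.s₂.mid i (by omega) ?_⟩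
      have : i ≠ e₃ := fun e => hn (by rw [e]; rfl)
      omega
  · rintro _ ⟨s, ⟨s1, s2⟩, rfl⟩ _ ⟨⟨t, ht, rfl⟩ | ⟨i, ⟨i1, i2⟩, rfl⟩, hn⟩
    · have := C.link s (by omega) t ht
      exact ⟨this.1, fun e => by have := this.2.1 e; omega⟩
    · refine ⟨C.path.off s (by omega) i, fun e => ?_⟩
      have : i ≠ e₃ := fun e => hn (by rw [e]; rfl)
      have := C.hit s (by omega) i (by omega) (by omega) e
      omega

theorem last_adj : G.Adj (r m) (h e₀) := by
  by_contra hm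
  obtain ⟨o1, o2, o3, o4, o5⟩ := C.star.five.order
  have hu := C.star.le
  have hu' := C.star.lt
  have hz := C.gt
  have hz' := C.le
  obtain ⟨l, hl, hl3⟩ := C.exists_hit W
  have hA : ∀ s, l ≤ s → s ≤ m → ¬ G.Adj (r s) (h e₀) := by
    intro s s1 s2
    rcases eq_or_lt_of_le s2 with rfl | s2
    · exact hm
    · exact C.no_early W hl3 s1 s2
  obtain ⟨f1, f2⟩ := C.far_spoke W
  obtain ⟨c2, t1, t2⟩ := (C.spoke_path W).inner f1 f2
  refine theta_of_sets W.cls f1 f2 (C.path.conn hl le_rfl) c2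
    ((connSet_singleton (h e₀)).insert rfl C.star.five.s₀.left)
    ⟨_, ⟨m, ⟨hl, le_rfl⟩, rfl⟩, C.rp.symm⟩ t1 ⟨_, Or.inr rfl, C.pe⟩ ⟨_, ⟨l, ⟨le_rfl, hl⟩, rfl⟩, hl3.symm⟩ t2
    ⟨x, Or.inl rfl, C.star.five.s₂.right.symm⟩ ?_ ?_ ?_
  · rintro _ ⟨s, ⟨s1, s2⟩, rfl⟩ _ ⟨⟨t, ht, rfl⟩ | ⟨i, ⟨i1, i2⟩, rfl⟩, hn⟩
    · have := C.link s s2 t ht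
      refine ⟨this.1, fun e => hn ?_⟩
      rw [(this.2.1 e).2]; exact Or.inl rfl
    · refine ⟨C.path.off s s2 i, fun e => ?_⟩
      have : i ≠ e₃ := fun e => hn (by rw [e]; exact Or.inr rfl)
      have := C.hit s s2 i (by omega) (by omega) e
      omega
  · rintro _ ⟨s, ⟨s1, s2⟩, rfl⟩ _ (rfl | rfl)
    · have := W.far _ (C.path.inB s s2)
      exact ⟨this.1, fun e => this.2 e.symm⟩
    · exact ⟨C.path.off s s2 _, hA s s1 s2⟩
  · have cf := W.cyc.far (i := e₀) (j := e₀) (k := u + 1) (l := e₃) (by omega) (by omega)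
      (h e₀) (mem_arc le_rfl le_rfl)
    rintro _ ⟨⟨t, ht, rfl⟩ | ⟨i, ⟨i1, i2⟩, rfl⟩, hn⟩ _ (rfl | rfl)
    · have := W.far _ (C.star.path.inB t ht)
      exact ⟨this.1, fun e => this.2 e.symm⟩
    · refine ⟨C.star.path.off t ht _, fun e => hn ?_⟩
      have := (C.star.adj t ht e₀ (by omega) (by omega)).1 e
      have : t = k := by omega
      rw [this]; exact Or.inl rfl
    · refine ⟨W.ne i, fun e => C.star.five.s₂.mid i (by omega) ?_ e.symm⟩
      have : i ≠ e₃ := fun e => hn (by rw [e]; exact Or.inr rfl)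
      omega
    · have := cf _ (mem_arc i1 i2)
      exact ⟨this.1.symm, fun e => this.2 e.symm⟩

protected theorem false : False := by
  obtain ⟨o1, o2, o3, o4, o5⟩ := C.star.five.order
  have hu := C.star.le
  have hu' := C.star.lt
  have hz := C.gt
  have hz' := C.le
  obtain ⟨l, hl, hl3⟩ := C.exists_hit W
  have hm := C.last_adj W
  rcases Nat.eq_zero_or_pos l with rfl | hl0
  · rcases Nat.eq_zero_or_pos m with rfl | hm0
    · have := W.clique (C.path.inB 0 le_rfl) hm hl3 C.star.five.s₀.left C.star.five.s₂.right
        (by omega) (by omega)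
      omega
    have h0 : ¬ G.Adj (r 0) (h e₀) := C.no_early W hl3 le_rfl hm0
    have hz1 : z ≠ e₁ := by
      rintro rfl
      have := W.clique (C.path.inB 0 (Nat.zero_le _)) C.hz hl3 C.star.five.s₁.left
        C.star.five.s₂.right (by omega) (by omega)
      omega
    obtain ⟨y, y1, y2, y3, y4⟩ := exists_least_of_mem (P := fun i => G.Adj (r 0) (h i))
      ⟨z, hz.le, le_rfl, C.hz⟩
    have y0 : y ≠ e₀ := by rintro rfl; exact h0 y3
    have hrx := W.far _ (C.path.inB 0 (Nat.zero_le _))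
    obtain ⟨g1, g2⟩ := W.pair C.star.five.s₀ (C.path.off 0 (Nat.zero_le _)) hrx.1
      (fun e => hrx.2 e.symm) (E := {h e₃}) (connSet_singleton _) (by
        have := (W.cyc.far (i := e₀) (j := e₁) (k := e₃) (l := e₃) (by omega) (by omega)).symm
        simpa using this) ⟨_, rfl, C.star.five.s₂.right⟩ ⟨_, rfl, hl3⟩ y1 y2 hz' y3 C.hz (by
        intro i i1 i2 i3
        constructor
        · by_contra hn
          exact y4 i i1 (by omega) i3
        · have := C.hit 0 (Nat.zero_le _) i i1 (by omega) i3
          omega)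
    obtain rfl : z = y + 1 := by omega
    have h₁₂ : ∀ v ∈ h '' Icc e₀ y, ∀ w ∈ r '' Iic m,
        v ≠ w ∧ (G.Adj v w ↔ (v = h e₀ ∧ w = r m) ∨ (v = h y ∧ w = r 0)) := by
      rintro _ ⟨i, ⟨i1, i2⟩, rfl⟩ _ ⟨s, hs, rfl⟩
      refine ⟨(C.path.off s hs i).symm, ?_⟩
      rw [G.adj_comm, W.cyc.eq_iff (by omega) (by omega), W.cyc.eq_iff (by omega) (by omega),
        C.path.eq_iff hs le_rfl, C.path.eq_iff hs (Nat.zero_le _)]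
      constructor
      · intro e
        by_cases hi : i = e₀
        · subst hi
          left
          refine ⟨rfl, ?_⟩
          by_contra hn
          exact C.no_early W hl3 (Nat.zero_le _) (lt_of_le_of_ne hs hn) e
        · have := C.hit s hs i i1 (by omega) e
          obtain rfl : s = 0 := by omega
          refine Or.inr ⟨?_, rfl⟩
          by_contra hn
          exact y4 i i1 (by omega) e
      · rintro (⟨rfl, rfl⟩ | ⟨rfl, rfl⟩)
        · exact hm
        · exact y3
    have h₁₃ : ∀ v ∈ h '' Icc e₀ y, ∀ w ∈ p '' Iic k ∪ h '' Icc (y + 1) u,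
        v ≠ w ∧ (G.Adj v w ↔ (v = h e₀ ∧ w = p k) ∨ (v = h y ∧ w = h (y + 1))) := by
      rintro _ ⟨i, ⟨i1, i2⟩, rfl⟩ _ (⟨t, ht, rfl⟩ | ⟨j, ⟨j1, j2⟩, rfl⟩)
      · refine ⟨(C.star.path.off t ht i).symm, ?_⟩
        rw [G.adj_comm, C.star.adj t ht i i1 (by omega), W.cyc.eq_iff (by omega) (by omega),
          W.cyc.eq_iff (by omega) (by omega), C.star.path.eq_iff ht le_rfl]
        have := C.star.path.off t ht (y + 1)
        constructor
        · intro a; exact Or.inl (by omega)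
        · rintro (a | a)
          · omega
          · exact absurd a.2 this
      · refine ⟨W.cyc.ne i j (by omega) (by omega), ?_⟩
        rw [W.cyc.adj i j (by omega) (by omega), W.cyc.eq_iff (by omega) (by omega),
          W.cyc.eq_iff (by omega) (by omega), W.cyc.eq_iff (by omega) (by omega)]
        have := C.star.path.off k le_rfl j
        constructor
        · intro a; exact Or.inr (by omega)
        · rintro (a | a)
          · exact absurd a.2.symm this
          · omega
    have h₂₃ : ∀ v ∈ r '' Iic m, ∀ w ∈ p '' Iic k ∪ h '' Icc (y + 1) u,
        v ≠ w ∧ (G.Adj v w ↔ (v = r m ∧ w = p k) ∨ (v = r 0 ∧ w = h (y + 1))) := by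
      rintro _ ⟨s, hs, rfl⟩ _ (⟨t, ht, rfl⟩ | ⟨j, ⟨j1, j2⟩, rfl⟩)
      · refine ⟨(C.link s hs t ht).1, ?_⟩
        rw [(C.link s hs t ht).2, C.path.eq_iff hs le_rfl, C.star.path.eq_iff ht le_rfl]
        have := C.star.path.off t ht (y + 1)
        tauto
      · refine ⟨C.path.off s hs j, ?_⟩
        rw [C.path.eq_iff hs le_rfl, C.path.eq_iff hs (Nat.zero_le _),
          W.cyc.eq_iff (by omega) (by omega)]
        have := C.star.path.off k le_rfl j
        constructor
        · intro e
          have := C.hit s hs j (by omega) (by omega) e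
          exact Or.inr (by omega)
        · rintro (a | ⟨rfl, rfl⟩)
          · exact absurd a.2.symm this
          · exact C.hz
    exact prism_of_sets W.cls (W.cyc.conn y1) C.rconn
      (C.star.conn.union (W.cyc.conn (i := y + 1) (j := u) (by omega)) ⟨0, by simp, rfl⟩
        (mem_arc (by omega) le_rfl) (Or.inr C.pu))
      (mem_arc le_rfl y1) ⟨m, by simp, rfl⟩ (Or.inl ⟨k, by simp, rfl⟩)
      (mem_arc y1 le_rfl) ⟨0, by simp, rfl⟩ (Or.inr (mem_arc le_rfl (by omega)))
      (W.cyc.ne _ _ (by omega) (by omega))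
      (fun e => by have := (C.path.eq_iff le_rfl (Nat.zero_le _)).1 e; omega)
      (C.star.path.off k le_rfl _) h₁₂ h₁₃ h₂₃
  · obtain ⟨h2, -⟩ := W.reroute (C.path.conn hl le_rfl)
      (by rintro _ ⟨s, hs, rfl⟩; exact C.path.inB s hs.2)
      (by rintro _ ⟨s, hs, rfl⟩; exact C.path.off s hs.2) (i := e₀) (j := e₃) (by omega) (by omega)
      ⟨_, ⟨m, ⟨hl, le_rfl⟩, rfl⟩, hm⟩ ⟨_, ⟨l, ⟨le_rfl, hl⟩, rfl⟩, hl3⟩ (by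
        rintro i i1 i2 _ ⟨s, ⟨s1, s2⟩, rfl⟩ e
        have := C.hit s s2 i (by omega) (by omega) e
        omega)
    rw [C.star.five.cnt_three] at h2
    have := (h2 (by decide) (by decide)).1
    omega

end SideConfig

end

section

variable {x : V} {h : ℤ → V} {N : ℤ} {B : Set V} {n : ℕ}

theorem Cyc.image_translate (C : Cyc G h N) (a b t : ℤ) :
    h '' Icc (a + t * N) (b + t * N) = h '' Icc a b := by
  ext v
  constructor
  · rintro ⟨i, ⟨i1, i2⟩, rfl⟩
    refine ⟨i + (-t) * N, ⟨by rw [neg_mul]; omega, by rw [neg_mul]; omega⟩, C.per_mul i (-t)⟩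
  · rintro ⟨i, ⟨i1, i2⟩, rfl⟩
    exact ⟨i + t * N, ⟨by omega, by omega⟩, C.per_mul i t⟩

theorem Sec.right_unique {a b c : ℤ} (S : Sec G x h a b) (T : Sec G x h a c) : b = c := by
  have h1 := S.lt
  have h2 := T.lt
  rcases lt_trichotomy b c with h3 | h3 | h3
  · exact absurd S.right (T.mid b h1 h3)
  · exact h3
  · exact absurd T.right (S.mid c h2 h3)

theorem Five.rotate {e₀ e₁ e₂ e₃ e₄ : ℤ} (F : Five G x h N e₀ e₁ e₂ e₃ e₄) (C : Cyc G h N) :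
    Five G x h N e₁ e₂ e₃ e₄ (e₀ + N) :=
  ⟨F.s₁, F.s₂, F.s₃, F.s₄, F.s₀.next C⟩

theorem Five.translate {e₀ e₁ e₂ e₃ e₄ : ℤ} (F : Five G x h N e₀ e₁ e₂ e₃ e₄) (C : Cyc G h N) (t : ℤ) :
    Five G x h N (e₀ + t * N) (e₁ + t * N) (e₂ + t * N) (e₃ + t * N) (e₄ + t * N) := by
  refine ⟨F.s₀.translate C t, F.s₁.translate C t, F.s₂.translate C t, F.s₃.translate C t, ?_⟩
  have := F.s₄.translate C t
  rwa [add_right_comm] at this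

theorem Five.reflect {e₀ e₁ e₂ e₃ e₄ : ℤ} (F : Five G x h N e₀ e₁ e₂ e₃ e₄) :
    Five G x (fun i => h (-i)) N (-(e₀ + N)) (-e₄) (-e₃) (-e₂) (-e₁) := by
  refine ⟨F.s₄.reflect, F.s₃.reflect, F.s₂.reflect, F.s₁.reflect, ?_⟩
  rw [neg_add, neg_add_cancel_right]
  exact F.s₀.reflect

theorem Five.unique {a e₁ e₂ e₃ e₄ f₁ f₂ f₃ f₄ : ℤ} (F : Five G x h N a e₁ e₂ e₃ e₄)
    (F' : Five G x h N a f₁ f₂ f₃ f₄) : e₁ = f₁ ∧ e₂ = f₂ ∧ e₃ = f₃ ∧ e₄ = f₄ := by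
  obtain rfl := F.s₀.right_unique F'.s₀
  obtain rfl := F.s₁.right_unique F'.s₁
  obtain rfl := F.s₂.right_unique F'.s₂
  obtain rfl := F.s₃.right_unique F'.s₃
  exact ⟨rfl, rfl, rfl, rfl⟩

theorem Five.spoke {e₀ e₁ e₂ e₃ e₄ i : ℤ} (F : Five G x h N e₀ e₁ e₂ e₃ e₄) (h1 : e₀ ≤ i)
    (h2 : i < e₀ + N) (hi : G.Adj x (h i)) : i = e₀ ∨ i = e₁ ∨ i = e₂ ∨ i = e₃ ∨ i = e₄ := by
  have a0 := F.s₀.mid i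
  have a1 := F.s₁.mid i
  have a2 := F.s₂.mid i
  have a3 := F.s₃.mid i
  have a4 := F.s₄.mid i
  by_contra hn
  rcases lt_or_ge i e₁ with h3 | h3
  · exact a0 (by omega) h3 hi
  rcases lt_or_ge i e₂ with h3 | h3
  · exact a1 (by omega) h3 hi
  rcases lt_or_ge i e₃ with h3 | h3
  · exact a2 (by omega) h3 hi
  rcases lt_or_ge i e₄ with h3 | h3
  · exact a3 (by omega) h3 hi
  · exact a4 (by omega) h2 hi

/-- Every rim neighbour of `E` is `a` or lies between `b` and `c`. -/
def Limited (G : SimpleGraph V) (h : ℤ → V) (E : Set V) (a b c : ℤ) : Prop :=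
  ∀ d ∈ E, ∀ i, G.Adj d (h i) → h i = h a ∨ h i ∈ h '' Icc b c

theorem Limited.window {E : Set V} {a b c e i : ℤ} {d : V} (L : Limited G h E a b c) (C : Cyc G h N)
    (hd : d ∈ E) (h1 : e ≤ i) (h2 : i < e + N) (ha : e ≤ a) (ha' : a < e + N) (hb : e ≤ b)
    (hc : c < e + N) (hi : G.Adj d (h i)) : i = a ∨ (b ≤ i ∧ i ≤ c) := by
  rcases L d hd i hi with e1 | ⟨j, ⟨j1, j2⟩, e1⟩
  · exact Or.inl (C.inj (by omega) (by omega) e1)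
  · have := C.inj (by omega) (by omega) e1
    omega

/-- The rim neighbours of `E` lie in a sector and the spoke opposite to it. -/
def Allowed (G : SimpleGraph V) (x : V) (h : ℤ → V) (N : ℤ) (E : Set V) : Prop :=
  ∃ e₀ e₁ e₂ e₃ e₄, Five G x h N e₀ e₁ e₂ e₃ e₄ ∧ Limited G h E e₀ e₂ e₃

theorem Allowed.cases {E : Set V} (A : Allowed G x h N E) (C : Cyc G h N) {e₀ e₁ e₂ e₃ e₄ : ℤ}
    (F : Five G x h N e₀ e₁ e₂ e₃ e₄) :
    Limited G h E e₀ e₂ e₃ ∨ Limited G h E e₁ e₃ e₄ ∨ Limited G h E e₂ e₄ (e₀ + N) ∨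
      Limited G h E e₃ e₀ e₁ ∨ Limited G h E e₄ e₁ e₂ := by
  obtain ⟨f₀, f₁, f₂, f₃, f₄, F', L⟩ := A
  obtain ⟨_, j1, j2, -, t, rfl⟩ := C.rep e₀ f₀
  replace F' := F'.translate C t
  replace L : Limited G h E (f₀ + t * N) (f₂ + t * N) (f₃ + t * N) := by
    intro d hd i hi
    rw [C.per_mul, C.image_translate]
    exact L d hd i hi
  generalize f₀ + t * N = g₀ at *
  generalize f₁ + t * N = g₁ at *
  generalize f₂ + t * N = g₂ at *
  generalize f₃ + t * N = g₃ at *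
  generalize f₄ + t * N = g₄ at *
  have im : ∀ a b, h '' Icc (a + N) (b + N) = h '' Icc a b := fun a b => by
    simpa using C.image_translate a b 1
  have F1 := F.rotate C
  have F2 := F1.rotate C
  have F3 := F2.rotate C
  have F4 := F3.rotate C
  rcases F.spoke j1 j2 F'.s₀.left with rfl | rfl | rfl | rfl | rfl
  · obtain ⟨rfl, rfl, rfl, rfl⟩ := F.unique F'
    exact Or.inl L
  · obtain ⟨rfl, rfl, rfl, rfl⟩ := F1.unique F'
    exact Or.inr (Or.inl L)
  · obtain ⟨rfl, rfl, rfl, rfl⟩ := F2.unique F'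
    exact Or.inr (Or.inr (Or.inl L))
  · obtain ⟨rfl, rfl, rfl, rfl⟩ := F3.unique F'
    refine Or.inr (Or.inr (Or.inr (Or.inl ?_)))
    intro d hd i hi
    rw [← im]
    exact L d hd i hi
  · obtain ⟨rfl, rfl, rfl, rfl⟩ := F4.unique F'
    refine Or.inr (Or.inr (Or.inr (Or.inr ?_)))
    intro d hd i hi
    rw [← im]
    exact L d hd i hi

theorem image_Icc_neg (h : ℤ → V) (a b : ℤ) : (fun i => h (-i)) '' Icc (-b) (-a) = h '' Icc a b := by
  ext v
  constructor
  · rintro ⟨i, ⟨i1, i2⟩, rfl⟩; exact ⟨-i, ⟨by omega, by omega⟩, rfl⟩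
  · rintro ⟨i, ⟨i1, i2⟩, rfl⟩; exact ⟨-i, ⟨by omega, by omega⟩, by simp⟩

theorem Allowed.reflect {E : Set V} (A : Allowed G x h N E) (C : Cyc G h N) :
    Allowed G x (fun i => h (-i)) N E := by
  obtain ⟨e₀, e₁, e₂, e₃, e₄, F, L⟩ := A
  refine ⟨_, _, _, _, _, F.reflect, fun d hd i hi => ?_⟩
  rw [image_Icc_neg]
  simp only [neg_neg, C.per]
  exact L d hd (-i) hi

theorem Five.exists_rotate {e₀ e₁ e₂ e₃ e₄ : ℤ} (F : Five G x h N e₀ e₁ e₂ e₃ e₄) (C : Cyc G h N)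
    (i : ℤ) : ∃ f₀ f₁ f₂ f₃ f₄ j, Five G x h N f₀ f₁ f₂ f₃ f₄ ∧ h j = h i ∧ f₂ ≤ j ∧ j < f₃ := by
  obtain ⟨j, j1, j2, e, -⟩ := C.rep e₂ i
  have F1 := F.rotate C
  have F2 := F1.rotate C
  have F3 := F2.rotate C
  have F4 := F3.rotate C
  rcases lt_or_ge j e₃ with h3 | h3
  · exact ⟨_, _, _, _, _, j, F, e, j1, h3⟩
  rcases lt_or_ge j e₄ with h4 | h4
  · exact ⟨_, _, _, _, _, j, F1, e, h3, h4⟩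
  rcases lt_or_ge j (e₀ + N) with h5 | h5
  · exact ⟨_, _, _, _, _, j, F2, e, h4, h5⟩
  rcases lt_or_ge j (e₁ + N) with h6 | h6
  · exact ⟨_, _, _, _, _, j, F3, e, h5, h6⟩
  · exact ⟨_, _, _, _, _, j, F4, e, h6, j2⟩

theorem Five.cosec_arc {e₀ e₁ e₂ e₃ e₄ : ℤ} (F : Five G x h N e₀ e₁ e₂ e₃ e₄) {E : Set V}
    (H : ∀ d ∈ E, ∀ i, G.Adj d (h i) → h i ∈ h '' Icc e₂ e₃) : Allowed G x h N E :=
  ⟨_, _, _, _, _, F, fun d hd i hi => Or.inr (H d hd i hi)⟩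

/-- A set whose rim neighbours are pairwise in a common sector is allowed. -/
theorem Five.allowed_of_cosec (W : HubWheel G x B h N n) {e₀ e₁ e₂ e₃ e₄ : ℤ}
    (F : Five G x h N e₀ e₁ e₂ e₃ e₄) {E : Set V}
    (H : ∀ d ∈ E, ∀ d' ∈ E, ∀ i j, G.Adj d (h i) → G.Adj d' (h j) → Cosec G x h (h i) (h j)) :
    Allowed G x h N E := by
  by_cases h1 : ∃ d ∈ E, ∃ i, G.Adj d (h i) ∧ ¬ G.Adj x (h i)
  · obtain ⟨d, hd, i, di, xi⟩ := h1
    obtain ⟨f₀, f₁, f₂, f₃, f₄, j, F', e, j1, j2⟩ := F.exists_rotate W.cyc i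
    rw [← e] at di xi
    refine F'.cosec_arc fun d' hd' t ht => W.cosec_mid F'.s₂ ?_ j2 (H d hd d' hd' j t di ht)
    have : f₂ ≠ j := by rintro rfl; exact xi F'.s₂.left
    omega
  · push Not at h1
    by_cases h2 : ∃ d ∈ E, ∃ i, G.Adj d (h i)
    · obtain ⟨d, hd, i, di⟩ := h2
      have xi := h1 d hd i di
      obtain ⟨f₀, f₁, f₂, f₃, f₄, j, F', e, j1, j2⟩ := F.exists_rotate W.cyc i
      rw [← e] at di xi
      obtain rfl : j = f₂ := by
        by_contra hn
        exact F'.s₂.mid j (by omega) j2 xi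
      have hall := fun d' hd' t ht => W.cosec_spoke F'.s₁ F'.s₂ (H d hd d' hd' j t di ht)
      by_cases h3 : ∃ d ∈ E, ∃ t, G.Adj d (h t) ∧ h t ∉ h '' Icc f₁ j
      · obtain ⟨d₁, hd₁, t, ht, hn⟩ := h3
        have ht3 : h t ∈ h '' Icc j f₃ := (hall d₁ hd₁ t ht).resolve_left hn
        refine F'.cosec_arc fun d₂ hd₂ s hs => ?_
        rcases hall d₂ hd₂ s hs with a | a
        · obtain ⟨a', ⟨a1, a2⟩, ea⟩ := a
          obtain ⟨b', ⟨b1, b2⟩, eb⟩ := ht3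
          obtain ⟨o1, o2, o3, o4, o5⟩ := F'.order
          have xa : G.Adj x (h a') := by rw [ea]; exact h1 d₂ hd₂ s hs
          have xb : G.Adj x (h b') := by rw [eb]; exact h1 d₁ hd₁ t ht
          have hb' : b' ≠ j := by rintro rfl; exact hn ⟨_, ⟨a1.trans a2, le_rfl⟩, eb⟩
          have hb3 : b' = f₃ := by
            by_contra hh
            exact F'.s₂.mid b' (by omega) (by omega) xb
          subst hb3
          by_cases haj : a' = j
          · subst haj; exact ⟨_, ⟨le_rfl, j2.le⟩, ea⟩
          have ha1 : a' = f₁ := by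
            by_contra hh
            exact F'.s₁.mid a' (by omega) (by omega) xa
          subst ha1
          have hc := H d₁ hd₁ d₂ hd₂ t s ht hs
          rw [← ea, ← eb] at hc
          exfalso
          rcases W.cosec_spoke F'.s₂ F'.s₃ hc with b | b
          · obtain ⟨c, ⟨c1, c2⟩, ec⟩ := b
            have := W.cyc.inj (by omega) (by omega) ec
            omega
          · obtain ⟨c, ⟨c1, c2⟩, ec⟩ := b
            have := W.cyc.inj (by omega) (by omega) ec
            omega
        · exact a
      · push Not at h3
        exact ((((F'.rotate W.cyc).rotate W.cyc).rotate W.cyc).rotate W.cyc).cosec_arc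
          fun d hd t ht => by
            have := h3 d hd t ht
            have im := W.cyc.image_translate f₁ j 1
            rw [one_mul] at im
            rwa [im]
    · push Not at h2
      exact ⟨_, _, _, _, _, F, fun d hd i hi => absurd hi (h2 d hd i)⟩

theorem StarPath.reflect (W : HubWheel G x B h N n) {p : ℕ → V} {k : ℕ} {e₀ e₁ e₂ e₃ e₄ u : ℤ}
    (S : StarPath G x B h N p k e₀ e₁ e₂ e₃ e₄ u) :
    StarPath G x B (fun i => h (-i)) N p k (-(e₀ + N)) (-e₄) (-e₃) (-e₂) (-e₁) (-(u + 1)) where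
  five := S.five.reflect
  path := ⟨S.path.path, S.path.inB, fun t ht i => S.path.off t ht (-i)⟩
  le := by have := S.lt; omega
  lt := by have := S.le; omega
  adj t ht i i1 i2 := by
    obtain ⟨o1, o2, o3, o4, o5⟩ := S.five.order
    have := S.le
    have := S.lt
    show G.Adj (p t) (h (-i)) ↔ _
    by_cases hi : i = -(e₀ + N)
    · subst hi
      rw [neg_neg, W.per_adj, S.adj t ht e₀ le_rfl (by omega)]
      omega
    · rw [S.adj t ht (-i) (by omega) (by omega)]
      omega

namespace Config

variable {p r : ℕ → V} {k m : ℕ} {e₀ e₁ e₂ e₃ e₄ u z : ℤ}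
  (W : HubWheel G x B h N n) (C : Config G x B h N p k r m e₀ e₁ e₂ e₃ e₄ u)
include W C

theorem no_near_sector (hz : G.Adj (r 0) (h z)) (h1 : e₀ < z) (h2 : z ≤ e₁)
    (hr : ∀ s ≤ m, ∀ i, e₀ ≤ i → i < e₀ + N → G.Adj (r s) (h i) → i = e₃ ∨ (e₀ ≤ i ∧ i ≤ e₁)) :
    False := by
  obtain ⟨o1, o2, o3, o4, o5⟩ := C.star.five.order
  obtain ⟨y, y1, y2, y3, y4⟩ := exists_greatest_of_mem (P := fun i => G.Adj (r 0) (h i))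
    ⟨z, le_rfl, h2, hz⟩
  refine SideConfig.false W (z := y) ⟨C, y3, by omega, y2, fun s hs i i1 i2 i3 => ?_⟩
  have a := hr s hs i i1 i2 i3
  rcases Nat.eq_zero_or_pos s with rfl | hs0
  · by_contra hn
    exact y4 i (by omega) (by omega) i3
  · have := C.later s hs hs0 i i1 i2 i3
    omega

theorem not_allowed (hz : G.Adj (r 0) (h z)) (h1 : e₀ < z) (h2 : z < e₂)
    (A : Allowed G x h N (r '' Iic m ∪ p '' Icc 1 k)) : False := by
  obtain ⟨o1, o2, o3, o4, o5⟩ := C.star.five.order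
  have hr0 : r 0 ∈ r '' Iic m ∪ p '' Icc 1 k := Or.inl ⟨0, by simp, rfl⟩
  have pe := (C.star.adj k le_rfl e₀ le_rfl (by omega)).2 (Or.inr ⟨rfl, rfl⟩)
  have hpk : 1 ≤ k → p k ∈ r '' Iic m ∪ p '' Icc 1 k := fun hk => Or.inr ⟨k, ⟨hk, le_rfl⟩, rfl⟩
  have hr : ∀ s ≤ m, r s ∈ r '' Iic m ∪ p '' Icc 1 k := fun s hs => Or.inl ⟨s, hs, rfl⟩
  rcases A.cases W.cyc C.star.five with L | L | L | L | L
  · have := L.window W.cyc hr0 (e := e₀) h1.le (by omega) (by omega) (by omega) (by omega) (by omega) hz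
    omega
  · have hw : ∀ d ∈ _, ∀ i, e₀ ≤ i → i < e₀ + N → G.Adj d (h i) → _ := fun d hd i i1 i2 =>
      L.window W.cyc hd (e := e₀) i1 i2 (by omega) (by omega) (by omega) (by omega)
    have hk : k = 0 := by
      by_contra hk
      have := hw _ (hpk (by omega)) e₀ le_rfl (by omega) pe
      omega
    have h3 := hw _ hr0 z (by omega) (by omega) hz
    obtain rfl : z = e₁ := by omega
    exact C.no_far_sector W hk (fun s hs => hw _ (hr s hs)) hz
  · have := L.window W.cyc hr0 (e := e₀ + 1) h1 (by omega) (by omega) (by omega) (by omega)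
      (by omega) hz
    omega
  · have hw : ∀ d ∈ _, ∀ i, e₀ ≤ i → i < e₀ + N → G.Adj d (h i) → _ := fun d hd i i1 i2 =>
      L.window W.cyc hd (e := e₀) i1 i2 (by omega) (by omega) (by omega) (by omega)
    have h3 := hw _ hr0 z (by omega) (by omega) hz
    exact C.no_near_sector W hz h1 (by omega) fun s hs => hw _ (hr s hs)
  · have hw : ∀ d ∈ _, ∀ i, e₀ ≤ i → i < e₀ + N → G.Adj d (h i) → _ := fun d hd i i1 i2 =>
      L.window W.cyc hd (e := e₀) i1 i2 (by omega) (by omega) (by omega) (by omega)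
    have hk : k = 0 := by
      by_contra hk
      have := hw _ (hpk (by omega)) e₀ le_rfl (by omega) pe
      omega
    by_cases hs : ∃ s ≤ m, ∃ i, e₀ ≤ i ∧ i < e₀ + N ∧ G.Adj (r s) (h i) ∧ e₁ < i
    · exact C.no_middle_sector W hk (fun s hs => hw _ (hr s hs)) hs hz h1 h2
    · push Not at hs
      have h3 := hs 0 (Nat.zero_le _) z (by omega) (by omega) hz
      refine C.no_near_sector W hz h1 h3 fun s hs' i i1 i2 i3 => ?_
      have := hs s hs' i i1 i2 i3
      omega

end Config

end

section

variable {x : V} {h : ℤ → V} {N : ℤ} {B : Set V} {n : ℕ}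

theorem Config.reflect (W : HubWheel G x B h N n) {p r : ℕ → V} {k m : ℕ} {e₀ e₁ e₂ e₃ e₄ u : ℤ}
    (C : Config G x B h N p k r m e₀ e₁ e₂ e₃ e₄ u) :
    Config G x B (fun i => h (-i)) N p k r m (-(e₀ + N)) (-e₄) (-e₃) (-e₂) (-e₁) (-(u + 1)) where
  star := C.star.reflect W
  path := ⟨C.path.path, C.path.inB, fun t ht i => C.path.off t ht (-i)⟩
  link := C.link
  later s hs hs0 i i1 i2 hi := by
    by_cases h1 : i = -(e₀ + N)
    · exact Or.inl h1
    · have := C.later s hs hs0 (-i) (by omega) (by omega) hi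
      omega

theorem StarPath.not_allowed {p : ℕ → V} {k : ℕ} {e₀ e₁ e₂ e₃ e₄ u z : ℤ}
    (S : StarPath G x B h N p k e₀ e₁ e₂ e₃ e₄ u) (C : Cyc G h N) {E : Set V} (h0 : p 0 ∈ E) {d : V}
    (hd : d ∈ E) (hz : G.Adj d (h z)) (h1 : e₀ < z) (h2 : z < e₀ + N) (h3 : ¬ (e₂ ≤ z ∧ z ≤ e₃)) :
    ¬ Allowed G x h N E := by
  intro A
  obtain ⟨o1, o2, o3, o4, o5⟩ := S.five.order
  have hu := S.le
  have hu' := S.lt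
  have pu := (S.adj 0 (Nat.zero_le _) u (by omega) (by omega)).2 (Or.inl ⟨rfl, Or.inl rfl⟩)
  have pu' := (S.adj 0 (Nat.zero_le _) (u + 1) (by omega) (by omega)).2 (Or.inl ⟨rfl, Or.inr rfl⟩)
  rcases A.cases C S.five with L | L | L | L | L
  · have := L.window C hd (e := e₀) h1.le (by omega) (by omega) (by omega) (by omega) (by omega) hz
    omega
  · have := L.window C h0 (e := e₀) (by omega) (by omega) (by omega) (by omega) (by omega) (by omega) pu
    omega
  · have := L.window C h0 (e := e₀ + 1) (by omega) (by omega) (by omega) (by omega) (by omega)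
      (by omega) pu'
    omega
  · have := L.window C h0 (e := e₀) (by omega) (by omega) (by omega) (by omega) (by omega) (by omega) pu
    omega
  · have := L.window C h0 (e := e₀) (by omega) (by omega) (by omega) (by omega) (by omega) (by omega) pu'
    omega

/-- A shortest path from a set `Y` to a neighbour of a disjoint set `P`. -/
theorem ConnSet.exists_shortest {E P : Set V} (hE : ConnSet G E) (hPE : P ⊆ E) (hP : P.Nonempty)
    {Y : V → Prop} (hY : ∃ d ∈ E, Y d) (hYP : ∀ v ∈ P, ¬ Y v) :
    ∃ (m : ℕ) (g : ℕ → V), PathOn G g m ∧ (∀ t ≤ m, g t ∈ E) ∧ (∀ t ≤ m, g t ∉ P) ∧ Y (g 0) ∧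
      (∃ w ∈ P, G.Adj (g m) w) ∧ (∀ t < m, ∀ w ∈ P, ¬ G.Adj (g t) w) ∧
      ∀ t ≤ m, 0 < t → ¬ Y (g t) := by
  classical
  have ex : ∃ m : ℕ, ∃ g : ℕ → V, PathOn G g m ∧ (∀ t ≤ m, g t ∈ E) ∧ (∀ t ≤ m, g t ∉ P) ∧ Y (g 0) ∧
      ∃ w ∈ P, G.Adj (g m) w := by
    obtain ⟨d, hd, yd⟩ := hY
    obtain ⟨q, hq⟩ := hP
    obtain ⟨X, hX, M, g, hg, rfl, rfl, rfl⟩ := hE.exists_path hd (hPE hq)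
    have ex : ∃ j, g j ∈ P := ⟨M, hq⟩
    have hjM : Nat.find ex ≤ M := Nat.find_min' ex hq
    have hj := Nat.find_spec ex
    have hmin : ∀ t < Nat.find ex, g t ∉ P := fun t ht => Nat.find_min ex ht
    generalize Nat.find ex = j at *
    have hj0 : j ≠ 0 := by rintro rfl; exact hYP _ hj yd
    refine ⟨j - 1, g, fun a b hab hb => hg a b hab (by omega), fun t ht => hX ⟨t, ?_, rfl⟩,
      fun t ht => hmin t (by omega), yd, g j, hj, (hg (j - 1) j (by omega) hjM).2.2 (by omega)⟩
    simp only [mem_Iic]; omega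
  obtain ⟨g, hg, gE, gP, gY, w, hw, hwg⟩ := Nat.find_spec ex
  have hmin : ∀ t < Nat.find ex, _ := fun t ht => Nat.find_min ex ht
  generalize Nat.find ex = m at *
  refine ⟨m, g, hg, gE, gP, gY, ⟨w, hw, hwg⟩, fun t ht w' hw' e => ?_, fun t ht h0 yt => ?_⟩
  · exact hmin t ht ⟨g, fun a b hab hb => hg a b hab (by omega), fun s hs => gE s (by omega),
      fun s hs => gP s (by omega), gY, w', hw', e⟩
  · refine hmin (m - t) (by omega) ⟨fun s => g (t + s), hg.shift (by omega),
      fun s hs => gE _ (by omega), fun s hs => gP _ (by omega), yt, w, hw, ?_⟩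
    show G.Adj (g (t + (m - t))) w
    rwa [Nat.add_sub_cancel' ht]

/-- Connected subsets of `B` off the rim are allowed. -/
theorem HubWheel.allowed [Finite V] (W : HubWheel G x B h N n) {f₀ f₁ f₂ f₃ f₄ : ℤ}
    (F : Five G x h N f₀ f₁ f₂ f₃ f₄) {E : Set V} (hE : ConnSet G E) (hEB : E ⊆ B)
    (hoff : ∀ d ∈ E, ∀ i, d ≠ h i) : Allowed G x h N E := by
  induction hc : E.ncard using Nat.strong_induction_on generalizing E with
  | _ c ih =>
  subst hc
  by_contra hA
  have small : ∀ E' ⊆ E, ConnSet G E' → (∃ d ∈ E, d ∉ E') → Allowed G x h N E' := by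
    rintro E' hE' hc ⟨d, hd, hd'⟩
    exact ih _ (ncard_lt_ncard ⟨hE', fun e => hd' (e hd)⟩ (toFinite _)) hc (hE'.trans hEB)
      (fun d hd => hoff d (hE' hd)) rfl
  have hco := mt (F.allowed_of_cosec W) hA
  push Not at hco
  obtain ⟨d₁, hd₁, d₂, hd₂, i, j, di, dj, hco⟩ := hco
  obtain ⟨k, q, e₀, e₁, e₂, e₃, e₄, u, S, hq⟩ := W.exists_star hE hEB hoff ⟨d₁, hd₁, di⟩ ⟨d₂, hd₂, dj⟩ hco
  obtain ⟨o1, o2, o3, o4, o5⟩ := S.five.order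
  have hu := S.le
  have hu' := S.lt
  obtain ⟨m, g, hg, gE, gP, ⟨z, z1, z2, z3, gz⟩, ⟨w, ⟨t, ht, rfl⟩, gw⟩, gno, glate⟩ :=
    hE.exists_shortest hq ⟨q 0, 0, by simp, rfl⟩
      (Y := fun v => ∃ i, e₀ < i ∧ i < e₀ + N ∧ ¬ (e₂ ≤ i ∧ i ≤ e₃) ∧ G.Adj v (h i)) (by
        by_contra hn
        push Not at hn
        refine hA ⟨_, _, _, _, _, S.five, fun d hd i hi => ?_⟩
        obtain ⟨j, j1, j2, e, -⟩ := W.cyc.rep e₀ i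
        rw [← e] at hi ⊢
        by_cases hj : j = e₀
        · exact Or.inl (by rw [hj])
        by_cases hj' : e₂ ≤ j ∧ j ≤ e₃
        · exact Or.inr (mem_arc hj'.1 hj'.2)
        · exact absurd hi (hn d hd j (by omega) j2 (fun a => by omega))) (by
        rintro _ ⟨t, ht, rfl⟩ ⟨i, i1, i2, i3, i4⟩
        have := (S.adj t ht i i1.le i2).1 i4
        omega)
  have gq : ∀ s ≤ m, ∀ t ≤ k, g s ≠ q t := fun s hs t ht e => gP s hs ⟨t, ht, e.symm⟩
  have gB : ∀ s ≤ m, g s ∈ B := fun s hs => hEB (gE s hs)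
  have gconn : ConnSet G (g '' Iic m) := hg.connSet_initial le_rfl
  have gsub : g '' Iic m ⊆ E := by rintro _ ⟨s, hs, rfl⟩; exact gE s hs
  have gend : ∀ t ≤ k, G.Adj (g m) (q t) → t = k := by
    intro t ht e
    by_contra hn
    refine S.not_allowed W.cyc (E := g '' Iic m ∪ q '' Iic t) (Or.inr ⟨0, by simp, rfl⟩)
      (Or.inl ⟨0, by simp, rfl⟩) gz z1 z2 z3 (small _ ?_ ?_ ⟨q k, hq ⟨k, by simp, rfl⟩, ?_⟩)
    · exact union_subset gsub ((image_mono (Iic_subset_Iic.2 ht)).trans hq)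
    · exact gconn.union (S.path.path.connSet_initial ht) ⟨m, by simp, rfl⟩ ⟨t, by simp, rfl⟩ (Or.inr e)
    · rintro (⟨s, hs, e⟩ | ⟨s, hs, e⟩)
      · exact gq s hs k le_rfl e
      · have hs' : s ≤ t := hs
        have := (S.path.eq_iff (s := s) (t := k) (by omega) le_rfl).1 e
        omega
  obtain rfl := gend t ht gw
  have C : Config G x B h N q t g m e₀ e₁ e₂ e₃ e₄ u :=
    { star := S
      path := ⟨hg, gB, fun s hs => hoff _ (gE s hs)⟩
      link := fun s hs j hj => ⟨gq s hs j hj, fun e => by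
        have hsm : s = m := by
          by_contra hn
          exact gno s (by omega) _ ⟨j, hj, rfl⟩ e
        subst hsm
        exact ⟨rfl, gend j hj e⟩, by rintro ⟨rfl, rfl⟩; exact gw⟩
      later := fun s hs hs0 i i1 i2 hi => by
        by_contra hn
        exact glate s hs hs0 ⟨i, by omega, i2, by omega, hi⟩ }
  have A : Allowed G x h N (g '' Iic m ∪ q '' Icc 1 t) := by
    refine small _ (union_subset gsub ((image_mono fun i hi => hi.2).trans hq)) ?_
      ⟨q 0, hq ⟨0, by simp, rfl⟩, ?_⟩
    · rcases Nat.eq_zero_or_pos t with rfl | ht0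
      · simpa using gconn
      · exact gconn.union (S.path.conn ht0 le_rfl) ⟨m, by simp, rfl⟩ ⟨t, ⟨ht0, le_rfl⟩, rfl⟩ (Or.inr gw)
    · rintro (⟨s, hs, e⟩ | ⟨s, hs, e⟩)
      · exact gq s hs 0 (Nat.zero_le _) e
      · have := (S.path.eq_iff (t := 0) hs.2 (Nat.zero_le _)).1 e
        have := hs.1
        omega
  by_cases hz : z < e₂
  · exact C.not_allowed W gz z1 hz A
  · exact (C.reflect W).not_allowed W.reflect (z := -z) (by simpa using gz) (by omega) (by omega)
      (A.reflect W.cyc)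

end

section

variable {x : V} {h : ℤ → V} {N : ℤ} {B : Set V} {n : ℕ}

namespace HubWheel

variable (W : HubWheel G x B h N n)
include W

theorem notMem_B {i : ℤ} (hi : G.Adj x (h i)) : h i ∉ B := fun e => (W.far _ e).2 hi

theorem exists_nbr {i : ℤ} (hi : G.Adj x (h i)) : ∃ b ∈ B, G.Adj (h i) b :=
  ((W.mem i).resolve_left (W.notMem_B hi)).2

theorem exists_spoke_off {a b : ℤ} (S : Sec G x h a b) :
    ∃ s, b < s ∧ s < a + N ∧ G.Adj x (h s) := by
  have h1 := W.sec_le S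
  have h2 := S.lt
  have c1 := cnt_split (G := G) (x := x) (h := h) (i := a) (j := b) (l := a + N - 1) (by omega) (by omega)
  have c2 := W.card a
  have c3 := W.three
  have c4 := S.cnt
  obtain ⟨s, s1, s2, s3⟩ := exists_of_cnt_pos (by omega : 0 < cnt G x h (b + 1) (a + N - 1))
  exact ⟨s, by omega, by omega, s3⟩

/-- A connected part of `B` off the rim links the interior of a sector to a given spoke, or to a rim
vertex which is not a spoke, outside of the sector. -/
theorem exists_link {a b i s : ℤ} (S : Sec G x h a b) (ai : a < i) (ib : i < b) (hs : G.Adj x (h s))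
    (hsab : h s ∉ h '' Icc a b) :
    ∃ E, ConnSet G E ∧ E ⊆ B ∧ (∀ d ∈ E, ∀ i, d ≠ h i) ∧
      (∃ d ∈ E, ∃ j, a < j ∧ j < b ∧ G.Adj d (h j)) ∧
      ∃ d ∈ E, ∃ t, G.Adj d (h t) ∧ h t ∉ h '' Icc a b ∧ (h t = h s ∨ ¬ G.Adj x (h t)) := by
  classical
  have hab := W.sec_le S
  obtain ⟨b₀, hb₀, sb⟩ := W.exists_nbr hs
  obtain ⟨X, hX, M, g, hg, g0, gM, rfl⟩ := (W.conn.insert hb₀ sb).exists_path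
    (mem_insert_of_mem _ (W.mem_B (S.mid i ai ib))) (mem_insert (h s) B)
  have gB : ∀ t < M, g t ∈ B := fun t ht =>
    (hX ⟨t, ht.le, rfl⟩).resolve_left (gM ▸ (hg t M ht le_rfl).1)
  have last : ∃ α, α ≤ M ∧ g α ∈ h '' Ioo a b ∧ ∀ t ≤ M, α < t → g t ∉ h '' Ioo a b := by
    refine ⟨Nat.findGreatest (fun t => g t ∈ h '' Ioo a b) M, Nat.findGreatest_le M,
      Nat.findGreatest_spec (P := fun t => g t ∈ h '' Ioo a b) (Nat.zero_le _) ⟨i, ⟨ai, ib⟩, g0.symm⟩,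
      fun t ht h1 h2 => ?_⟩
    have := Nat.le_findGreatest (P := fun t => g t ∈ h '' Ioo a b) ht h2
    omega
  obtain ⟨α, αM, ⟨j, ⟨j1, j2⟩, hj⟩, hα⟩ := last
  have αM' : α < M := by
    refine lt_of_le_of_ne αM ?_
    rintro rfl
    exact hsab ⟨j, ⟨j1.le, j2.le⟩, hj.trans gM⟩
  have ex : ∃ β, α < β ∧ g β ∈ range h := ⟨M, αM', s, gM.symm⟩
  have βM : Nat.find ex ≤ M := Nat.find_min' ex ⟨αM', s, gM.symm⟩
  obtain ⟨αβ, t, ht⟩ := Nat.find_spec ex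
  have hmin : ∀ t < Nat.find ex, ¬ (α < t ∧ g t ∈ range h) := fun t ht => Nat.find_min ex ht
  generalize Nat.find ex = β at *
  have hts : h t = h s ∨ h t ∈ B := by
    rcases eq_or_lt_of_le βM with rfl | hlt
    · exact Or.inl (ht.trans gM)
    · exact Or.inr (ht ▸ gB β hlt)
  have hta : h t ∉ h '' Icc a b := by
    rintro ⟨c, ⟨c1, c2⟩, hc⟩
    have hcn : ¬ (a < c ∧ c < b) := fun hh => hα β βM αβ ⟨c, hh, hc.trans ht⟩
    have xt : G.Adj x (h t) := by
      rw [← hc]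
      rcases eq_or_lt_of_le c1 with rfl | c1
      · exact S.left
      · obtain rfl : c = b := by omega
        exact S.right
    rcases hts with e | e
    · exact hsab ⟨c, ⟨c1, c2⟩, hc.trans e⟩
    · exact W.notMem_B xt e
  have hgap : β ≠ α + 1 := by
    rintro rfl
    have e := (hg α (α + 1) (by omega) βM).2.2 rfl
    rw [← hj, ← ht] at e
    obtain ⟨t', t1, t2, et, -⟩ := W.cyc.rep a t
    rw [← et] at e hta
    have hbt : b < t' := by
      by_contra hn
      exact hta (mem_arc t1 (by omega))
    have := (W.cyc.adj j t' (by omega) (by omega)).1 e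
    omega
  refine ⟨g '' Icc (α + 1) (β - 1), (hg.iPath (by omega) (by omega)).connSet, ?_, ?_,
    ⟨g (α + 1), ⟨α + 1, ⟨le_rfl, by omega⟩, rfl⟩, j, j1, j2, ?_⟩,
    g (β - 1), ⟨β - 1, ⟨by omega, le_rfl⟩, rfl⟩, t, ?_, hta, hts.imp_right fun e e' => W.notMem_B e' e⟩
  · rintro _ ⟨c, ⟨c1, c2⟩, rfl⟩
    exact gB c (by omega)
  · rintro _ ⟨c, ⟨c1, c2⟩, rfl⟩ l e
    exact hmin c (by omega) ⟨by omega, l, e.symm⟩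
  · rw [hj]
    exact ((hg α (α + 1) (by omega) (by omega)).2.2 rfl).symm
  · rw [ht]
    exact (hg (β - 1) β (by omega) βM).2.2 (by omega)

theorem false_of_universal [Finite V] (hall : ∀ i, G.Adj x (h i)) : False := by
  have hoff : ∀ d ∈ B, ∀ i, d ≠ h i := by
    rintro _ hd i rfl
    exact W.notMem_B (hall i) hd
  have hit : ∀ i, ∃ d ∈ B, G.Adj d (h i) := fun i => by
    obtain ⟨b, hb, e⟩ := W.exists_nbr (hall i)
    exact ⟨b, hb, e.symm⟩
  have hN := W.cyc.four
  have hco : ¬ Cosec G x h (h 0) (h 2) := by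
    rintro ⟨c, d, S, ⟨i, ⟨i1, i2⟩, ei⟩, j, ⟨j1, j2⟩, ej⟩
    have hcd : d ≤ c + 1 := by
      by_contra hn
      exact S.mid (c + 1) (by omega) (by omega) (hall _)
    have h02 := W.cyc.adj 0 2 (by omega) (by omega)
    have n02 := W.cyc.ne 0 2 (by omega) (by omega)
    rw [← ei, ← ej] at h02 n02
    have hij : i ≠ j := by rintro rfl; exact n02 rfl
    have : G.Adj (h i) (h j) := by
      rcases lt_or_gt_of_ne hij with hlt | hlt
      · obtain rfl : j = i + 1 := by omega
        exact W.cyc.adj_succ i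
      · obtain rfl : i = j + 1 := by omega
        exact (W.cyc.adj_succ j).symm
    have := h02.1 this
    omega
  obtain ⟨k, q, e₀, e₁, e₂, e₃, e₄, w, S, -⟩ := W.exists_star W.conn le_rfl hoff (hit 0) (hit 2) hco
  obtain ⟨f₀, f₁, f₂, f₃, f₄, F, L⟩ := W.allowed S.five W.conn le_rfl hoff
  obtain ⟨o1, o2, o3, o4, o5⟩ := F.order
  obtain ⟨d, hd, e⟩ := hit f₁
  have := L.window W.cyc hd (e := f₀) (by omega) (by omega) (by omega) (by omega) (by omega)
    (by omega) e
  omega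

protected theorem false [Finite V] : False := by
  by_cases hall : ∀ i, G.Adj x (h i)
  · exact W.false_of_universal hall
  push Not at hall
  obtain ⟨i, hi⟩ := hall
  obtain ⟨c, d, S, ci, id⟩ := W.exists_sec i
  have hc : c ≠ i := by rintro rfl; exact hi S.left
  obtain ⟨s, s1, s2, s3⟩ := W.exists_spoke_off S
  have := S.lt
  obtain ⟨E, hE, hEB, hoff, ⟨d₁, hd₁, j, j1, j2, hj⟩, d₂, hd₂, t, ht, ht', -⟩ :=
    W.exists_link S (by omega) id s3 (fun e => by
      have := W.le_of_mem_arc (by omega) s2 (by omega) e; omega)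
  obtain ⟨k, q, e₀, e₁, e₂, e₃, e₄, w, P, -⟩ := W.exists_star hE hEB hoff ⟨d₁, hd₁, hj⟩ ⟨d₂, hd₂, ht⟩
    (fun H => ht' (W.cosec_mid S j1 j2 H))
  obtain ⟨f₀, f₁, f₂, f₃, f₄, j', F, ej, j3, j4⟩ := P.five.exists_rotate W.cyc i
  rw [← ej] at hi
  have hf : f₂ ≠ j' := by rintro rfl; exact hi F.s₂.left
  obtain ⟨o1, o2, o3, o4, o5⟩ := F.order
  obtain ⟨E, hE, hEB, hoff, ⟨d₁, hd₁, j, j1, j2, hj⟩, d₂, hd₂, t, ht, ht', hts⟩ :=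
    W.exists_link F.s₂ (by omega) j4 F.s₀.right (by
      rintro ⟨l, ⟨l1, l2⟩, e⟩
      have := W.cyc.inj (by omega) (by omega) e
      omega)
  rcases (W.allowed F hE hEB hoff).cases W.cyc F with L | L | L | L | L
  · rcases (L d₂ hd₂ t ht).resolve_right ht' with e
    rcases hts with e' | e'
    · have := W.cyc.inj (by omega) (by omega) (e.symm.trans e')
      omega
    · exact e' (e ▸ F.s₀.left)
  · have := L.window W.cyc hd₁ (e := f₀) (by omega) (by omega) (by omega) (by omega) (by omega)
      (by omega) hj
    omega
  · have := L.window W.cyc hd₁ (e := f₀ + 1) (by omega) (by omega) (by omega) (by omega) (by omega)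
      (by omega) hj
    omega
  · have := L.window W.cyc hd₁ (e := f₀) (by omega) (by omega) (by omega) (by omega) (by omega)
      (by omega) hj
    omega
  · have := L.window W.cyc hd₁ (e := f₀) (by omega) (by omega) (by omega) (by omega) (by omega)
      (by omega) hj
    omega

end HubWheel

end

section

variable {h : ℤ → V} {N : ℤ} {x : V}

theorem Cyc.image_period (C : Cyc G h N) (i : ℤ) : h '' Icc i (i + N - 1) = range h := by
  apply (image_subset_range _ _).antisymm
  rintro _ ⟨k, rfl⟩
  obtain ⟨j, h1, h2, e, -⟩ := C.rep i k
  exact ⟨j, ⟨h1, by omega⟩, e⟩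

theorem Cyc.no_triangle (C : Cyc G h N) {i k : ℤ} (h1 : G.Adj (h k) (h i))
    (h2 : G.Adj (h k) (h (i + 1))) : False := by
  obtain ⟨j, j1, j2, e, -⟩ := C.rep i k
  rw [← e] at h1 h2
  have := C.four
  have n1 : j ≠ i := fun e => h1.ne (by rw [e])
  have n2 : j ≠ i + 1 := fun e => h2.ne (by rw [e])
  have := (C.adj i j (by omega) (by omega)).1 h1.symm
  have := (C.adj (i + 1) j (by omega) (by omega)).1 h2.symm
  omega

theorem IsProperWheel.spokes_nonadj (C : Cyc G h N) (W : IsProperWheel G (range h) x)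
    (h3 : (holeNbrs G (range h) x).ncard = 3) {i : ℤ} (hi : G.Adj x (h i)) :
    ¬ G.Adj x (h (i + 1)) := by
  intro hi'
  have had := C.adj_succ i
  have fin : (holeNbrs G (range h) x).Finite := finite_of_ncard_pos (by omega)
  have sub : {h i, h (i + 1)} ⊆ holeNbrs G (range h) x := by
    rintro _ (rfl | rfl)
    exacts [⟨mem_range_self _, hi⟩, ⟨mem_range_self _, hi'⟩]
  obtain ⟨r, hr, hr'⟩ : ∃ r ∈ holeNbrs G (range h) x, r ∉ ({h i, h (i + 1)} : Set V) := by
    apply exists_mem_notMem_of_ncard_lt_ncard _ (toFinite _)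
    rw [ncard_pair had.ne, h3]; omega
  simp only [mem_insert_iff, mem_singleton_iff, not_or] at hr'
  have eq : holeNbrs G (range h) x = {h i, h (i + 1), r} := by
    refine (eq_of_subset_of_ncard_le ?_ ?_ fin).symm
    · rintro _ (rfl | rfl | rfl)
      exacts [sub (by simp), sub (by simp), hr]
    · rw [h3, ncard_eq_three.2 ⟨_, _, _, had.ne, Ne.symm hr'.1, Ne.symm hr'.2, rfl⟩]
  obtain ⟨⟨k, rfl⟩, -⟩ := hr
  by_cases a1 : G.Adj (h k) (h i)
  · have a2 : ¬ G.Adj (h k) (h (i + 1)) := fun a2 => C.no_triangle a1 a2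
    refine W.2.1 ⟨W.1, h (i + 1), h i, h k, had.ne', Ne.symm hr'.1, Ne.symm hr'.2, ?_, had.symm,
      a1.symm, fun a => a2 a.symm⟩
    rw [eq, insert_comm]
  · by_cases a2 : G.Adj (h k) (h (i + 1))
    · exact W.2.1 ⟨W.1, h i, h (i + 1), h k, had.ne, Ne.symm hr'.2, Ne.symm hr'.1, eq, had,
        a2.symm, fun a => a1 a.symm⟩
    · exact W.2.2 ⟨W.1, h i, h (i + 1), h k, had.ne, Ne.symm hr'.2, Ne.symm hr'.1, eq, had,
        fun a => a2 a.symm, fun a => a1 a.symm⟩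

theorem IsWheel.isProperWheel {H : Set V} (W : IsWheel G H x) (h3 : (holeNbrs G H x).ncard ≠ 3) :
    IsProperWheel G H x := by
  refine ⟨W, ?_, ?_⟩ <;> rintro ⟨-, p, q, r, pq, qr, pr, e, -⟩ <;>
    exact h3 (ncard_eq_three.2 ⟨p, q, r, pq, pr, qr, e⟩)

theorem IsCompOf.adj_of_mem_setNbhd {v u : V} {B : Set V}
    (hB : IsCompOf G (univ \ {u : V | u = v ∨ G.Adj u v}) B) (hu : u ∈ setNbhd G B)
    (huv : u ≠ v) : G.Adj v u := by
  by_contra hadj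
  obtain ⟨b, hb, hub⟩ := hu.2
  have := hB.2.2 (insert u B) (subset_insert _ _) (insert_subset ⟨trivial, ?_⟩ hB.1)
    (hB.2.1.insert hb hub)
  · exact hu.1 (this ▸ mem_insert _ _)
  · rintro (e | e)
    exacts [huv e, hadj e.symm]

theorem not_isHubIn_of_isCompOf [Finite V] (hC : MemC G) {v : V} {B : Set V}
    (hB : IsCompOf G (univ \ {u : V | u = v ∨ G.Adj u v}) B) :
    ¬ IsHubIn G (B ∪ setNbhd G B ∪ {v}) v := by
  classical
  rintro ⟨-, hub⟩
  have ex : ∃ n, ∃ H ⊆ B ∪ setNbhd G B ∪ {v}, IsProperWheel G H v ∧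
      (holeNbrs G H v).ncard = n := by
    obtain ⟨H, h1, h2⟩ := hub
    exact ⟨_, H, h1, h2, rfl⟩
  obtain ⟨H, hH, hW, hn⟩ := Nat.find_spec ex
  have hmin := fun m => Nat.find_min (H := ex) (m := m)
  generalize Nat.find ex = n at hn hmin
  have hBv : ∀ b ∈ B, b ≠ v ∧ ¬ G.Adj v b := fun b hb =>
    ⟨fun e => (hB.1 hb).2 (Or.inl e), fun e => (hB.1 hb).2 (Or.inr e.symm)⟩
  obtain ⟨h, N, C, rfl⟩ := hW.1.1.exists_cyc
  have hne : ∀ i, h i ≠ v := fun i e => hW.1.2.1 ⟨i, e⟩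
  refine HubWheel.false (G := G) (x := v) (B := B) (h := h) (N := N) (n := n)
    ⟨hC, C, hW.1.1, hne, hB.2.1, hBv, ?_, ?_, ?_, ?_, ?_, ?_⟩
  · intro i
    rcases hH (mem_range_self i) with (hi | hi) | hi
    · exact Or.inl hi
    · exact Or.inr ⟨hB.adj_of_mem_setNbhd hi (hne i), hi.2⟩
    · exact (hne i hi).elim
  · intro i
    rw [← C.ncard_eq_cnt (by omega), C.image_period]
    exact hn
  · rw [← hn, ← Nat.not_even_iff_odd]
    exact hC.2.2.2 _ _ hW.1
  · exact hn ▸ hW.1.2.2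
  · intro e i
    exact hW.spokes_nonadj C (hn.trans e)
  · intro K hK hKB h3 hlt
    by_contra hc
    refine hmin _ hlt ⟨K, fun u hu => ?_, IsWheel.isProperWheel ⟨hK, fun hv => ?_, h3⟩ hc, rfl⟩
    · by_cases hb : u ∈ B
      · exact Or.inl (Or.inl hb)
      · exact Or.inl (Or.inr ⟨hb, ((hKB u hu).resolve_left hb).2⟩)
    · rcases hKB v hv with hb | hb
      exacts [(hBv v hb).1 rfl, hb.1.ne rfl]

end

end

/-- if `G ∈ 𝒞` and `B` is a component of `G ∖ N[v]`, then `v` is not a hub of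
the subgraph induced on `B ∪ N(B) ∪ {v}`. -/
theorem stmt_10 {V : Type} [Fintype V] (G : SimpleGraph V) (hC : MemC G)
    (v : V) (B : Set V)
    (hB : IsCompOf G (Set.univ \ {u : V | u = v ∨ G.Adj u v}) B) :
    ¬ IsHubIn G (B ∪ setNbhd G B ∪ {v}) v :=
  not_isHubIn_of_isCompOf hC hB
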